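/- arXiv:2111.10366 — 2 statements merged into one kernel-verified Lean document; each statement's English description precedes it below -/
import Mathlib

section
/- For every real λ > 2: the number −λ is a limit point (accumulation point) of the set {λ₁(G) : G a graph with at least one vertex} ⊆ ℝ if and only if λ ≥ λ*. -/
open Classical

/-- An eigenvalue of a real matrix indexed by a finite type. -/
def IsEigenvalue {V : Type*} [Fintype V] (A : Matrix V V ℝ) (μ : ℝ) : Prop :=
  ∃ v : V → ℝ, v ≠ 0 ∧ A.mulVec v = μ • v

/-- The adjacency matrix (over ℝ) of a simple graph. -/
noncomputable def adjMat {V : Type*} [Fintype V] (G : SimpleGraph V) : Matrix V V ℝ :=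
  fun i j => if G.Adj i j then 1 else 0

/-- The smallest eigenvalue of a real matrix (for a symmetric matrix on a nonempty finite
index type this is the minimum of the spectrum). -/
noncomputable def minEig {V : Type*} [Fintype V] (A : Matrix V V ℝ) : ℝ :=
  sInf {μ : ℝ | IsEigenvalue A μ}

/-- The quadratic form of `A + t I`, with `A` the adjacency matrix. -/
noncomputable def qform {V : Type*} [Fintype V] (G : SimpleGraph V) (t : ℝ) (f : V → ℝ) : ℝ :=
  ∑ u, ∑ v, adjMat G u v * f u * f v + t * ∑ u, f u ^ 2

section Spectral

variable {V : Type*} [Fintype V]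

theorem qform_eq_dotProduct (G : SimpleGraph V) (t : ℝ) (f : V → ℝ) :
    qform G t f = f ⬝ᵥ (adjMat G).mulVec f + t * (f ⬝ᵥ f) := by
  simp only [qform, dotProduct, Matrix.mulVec, Finset.mul_sum, pow_two]
  congr 1
  refine Finset.sum_congr rfl fun u _ => Finset.sum_congr rfl fun v _ => ?_
  ring

theorem adjMat_isHermitian (G : SimpleGraph V) : (adjMat G).IsHermitian := by
  ext i j
  simp [adjMat, Matrix.conjTranspose_apply, G.adj_comm]

theorem sum_sq_pos {f : V → ℝ} (hf : f ≠ 0) : 0 < ∑ u, f u ^ 2 := by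
  obtain ⟨v, hv⟩ := Function.ne_iff.mp hf
  exact Finset.sum_pos' (fun _ _ => sq_nonneg _)
      ⟨v, Finset.mem_univ _, by simpa using pow_pos (abs_pos.mpr hv) 2⟩

theorem qform_of_eigenvector {G : SimpleGraph V} {μ : ℝ} {f : V → ℝ}
    (hf : (adjMat G).mulVec f = μ • f) (t : ℝ) : qform G t f = (μ + t) * ∑ u, f u ^ 2 := by
  rw [qform_eq_dotProduct, hf, dotProduct_smul]
  simp only [dotProduct, smul_eq_mul, pow_two]
  ring

theorem isEigenvalue_eigenvalues (G : SimpleGraph V) (i : V) :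
    IsEigenvalue (adjMat G) ((adjMat_isHermitian G).eigenvalues i) := by
  refine ⟨(adjMat_isHermitian G).eigenvectorBasis i, ?_,
      (adjMat_isHermitian G).mulVec_eigenvectorBasis i⟩
  intro h
  apply (adjMat_isHermitian G).eigenvectorBasis.toBasis.ne_zero i
  ext j
  simpa using congrFun h j

theorem finite_setOf_isEigenvalue (A : Matrix V V ℝ) : {μ : ℝ | IsEigenvalue A μ}.Finite := by
  refine (Module.End.finite_hasEigenvalue (Matrix.toLin' A)).subset ?_
  rintro μ ⟨v, hv, h⟩
  exact Module.End.hasEigenvalue_of_hasEigenvector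
    (x := v) ⟨Module.End.mem_eigenspace_iff.mpr (by simpa using h), hv⟩

theorem isEigenvalue_minEig [Nonempty V] (G : SimpleGraph V) :
    IsEigenvalue (adjMat G) (minEig (adjMat G)) := by
  have hne : {μ : ℝ | IsEigenvalue (adjMat G) μ}.Nonempty :=
    ⟨_, isEigenvalue_eigenvalues G (Classical.arbitrary V)⟩
  exact hne.csInf_mem (finite_setOf_isEigenvalue (adjMat G))

theorem qform_nonneg_of_le_eigenvalues {G : SimpleGraph V} {c : ℝ}
    (h : ∀ μ, IsEigenvalue (adjMat G) μ → c ≤ μ) (f : V → ℝ) : 0 ≤ qform G (-c) f := by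
  set hA := adjMat_isHermitian G
  have hB : (adjMat G - c • (1 : Matrix V V ℝ)).IsHermitian :=
    hA.sub (by simp [Matrix.IsHermitian])
  have hpsd : (adjMat G - c • (1 : Matrix V V ℝ)).PosSemidef := by
    rw [hB.posSemidef_iff_eigenvalues_nonneg]
    intro i
    have hv := hB.mulVec_eigenvectorBasis i
    have : IsEigenvalue (adjMat G) (hB.eigenvalues i + c) := by
      refine ⟨hB.eigenvectorBasis i, ?_, ?_⟩
      · intro h
        apply hB.eigenvectorBasis.toBasis.ne_zero i
        ext j
        simpa using congrFun h j
      · rw [Matrix.sub_mulVec, Matrix.smul_mulVec, Matrix.one_mulVec] at hv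
        rw [add_smul, ← hv]
        simp
    have := h _ this
    simp only [Pi.zero_apply]
    linarith
  have := hpsd.dotProduct_mulVec_nonneg f
  rw [Matrix.sub_mulVec, Matrix.smul_mulVec, Matrix.one_mulVec, dotProduct_sub,
    dotProduct_smul] at this
  rw [qform_eq_dotProduct]
  simp only [star_trivial, smul_eq_mul] at this
  linarith

theorem le_minEig_iff [Nonempty V] (G : SimpleGraph V) (c : ℝ) :
    c ≤ minEig (adjMat G) ↔ ∀ f, 0 ≤ qform G (-c) f := by
  constructor
  · intro h
    exact qform_nonneg_of_le_eigenvalues fun μ hμ =>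
      h.trans (csInf_le (finite_setOf_isEigenvalue _).bddBelow hμ)
  · intro h
    obtain ⟨v, hv, hv'⟩ := isEigenvalue_minEig G
    have h1 := h v
    rw [qform_of_eigenvector hv'] at h1
    have := nonneg_of_mul_nonneg_left h1 (sum_sq_pos hv)
    linarith

theorem qform_comp_equiv {W : Type*} [Fintype W] (G : SimpleGraph V) (e : W ≃ V) (t : ℝ)
    (f : V → ℝ) : qform (G.comap e) t (f ∘ e) = qform G t f := by
  simp only [qform, adjMat, SimpleGraph.comap_adj, Function.comp]
  congr 1
  · rw [← e.sum_comp]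
    exact Finset.sum_congr rfl fun u _ => by rw [← e.sum_comp]
  · rw [← e.sum_comp]

theorem minEig_comap_equiv {W : Type*} [Fintype W] [Nonempty V] [Nonempty W] (G : SimpleGraph V)
    (e : W ≃ V) : minEig (adjMat (G.comap e)) = minEig (adjMat G) := by
  refine eq_of_forall_le_iff fun c => ?_
  rw [le_minEig_iff, le_minEig_iff]
  constructor
  · intro h f
    rw [← qform_comp_equiv G e]
    exact h _
  · intro h f
    have := h (f ∘ e.symm)
    rw [← qform_comp_equiv G e] at this
    simpa [Function.comp_assoc] using this

theorem qform_mono {G : SimpleGraph V} {s t : ℝ} (hst : s ≤ t) (f : V → ℝ) :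
    qform G s f ≤ qform G t f := by
  have : 0 ≤ ∑ u, f u ^ 2 := Finset.sum_nonneg fun _ _ => sq_nonneg _
  unfold qform
  nlinarith

end Spectral

section Anchored

variable {V : Type*} [Fintype V]

/-- The Gram entry of two vertices with respect to `A + t I`. -/
noncomputable def gramEntry (G : SimpleGraph V) (t : ℝ) (u v : V) : ℝ :=
  adjMat G u v + if u = v then t else 0

/-- On every combination of at most `N` vertices from `S`, the form of `A + t I` dominates
`r⁻¹` times the square of the functional given by adjacency to `o`. -/
def Anchored (G : SimpleGraph V) (t r : ℝ) (N : ℕ) (o : V) (S : Set V) : Prop :=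
  ∀ n ≤ N, ∀ s : Fin n → V, (∀ i, s i ∈ S) → ∀ c : Fin n → ℝ,
    (∑ i, c i * adjMat G o (s i)) ^ 2 ≤ r * ∑ i, ∑ j, c i * c j * gramEntry G t (s i) (s j)

theorem adjMat_comm (G : SimpleGraph V) (u v : V) : adjMat G u v = adjMat G v u := by
  simp [adjMat, G.adj_comm]

theorem gramEntry_comm (G : SimpleGraph V) (t : ℝ) (u v : V) :
    gramEntry G t u v = gramEntry G t v u := by
  simp only [gramEntry, adjMat_comm G u v, eq_comm]

theorem Anchored.mono {G : SimpleGraph V} {t r : ℝ} {N N' : ℕ} {o : V} {S S' : Set V}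
    (h : Anchored G t r N o S) (hN : N' ≤ N) (hS : S' ⊆ S) : Anchored G t r N' o S' :=
  fun n hn s hs c => h n (hn.trans hN) s (fun i => hS (hs i)) c

/-- Moving the anchor from `g` to a neighbour `o`. -/
theorem Anchored.move {G : SimpleGraph V} {t r : ℝ} {N : ℕ} {g o : V} {S S' : Set V}
    (h : Anchored G t r (N + 1) g S') (hr : 0 < r) (hr' : 0 < t - 1 / r) (ho : o ∈ S')
    (hgo : G.Adj g o) (hS : S ⊆ S') (hoS : o ∉ S) (hSg : ∀ v ∈ S, ¬ G.Adj g v) :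
    Anchored G t (t - 1 / r) N o S := by
  intro n hn s hs c
  set σ := ∑ i, c i * adjMat G o (s i) with hσ
  set Q := ∑ i, ∑ j, c i * c j * gramEntry G t (s i) (s j) with hQ
  have key : ∀ τ : ℝ, τ ^ 2 ≤ r * (t * τ ^ 2 + 2 * τ * σ + Q) := by
    intro τ
    have := h (n + 1) (by omega) (Fin.cons o s)
      (Fin.cases (by simpa using ho) (fun i => by simpa using hS (hs i))) (Fin.cons τ c)
    simp only [Fin.sum_univ_succ, Fin.cons_zero, Fin.cons_succ] at this
    have e1 : ∑ i, c i * adjMat G g (s i) = 0 :=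
      Finset.sum_eq_zero fun i _ => by simp [adjMat, hSg _ (hs i)]
    have e2 : ∀ i, gramEntry G t o (s i) = adjMat G o (s i) := fun i => by
      have : o ≠ s i := fun h => hoS (h ▸ hs i)
      simp [gramEntry, this]
    have e3 : adjMat G g o = 1 := by simp [adjMat, hgo]
    have e4 : gramEntry G t o o = t := by simp [gramEntry, adjMat]
    rw [e1, e3, e4] at this
    simp only [gramEntry_comm G t (s _) o, e2, Finset.sum_add_distrib] at this
    have e5 : ∑ i, τ * c i * adjMat G o (s i) = τ * σ := by
      rw [hσ, Finset.mul_sum]; exact Finset.sum_congr rfl fun i _ => by ring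
    have e6 : ∑ i, c i * τ * adjMat G o (s i) = τ * σ := by
      rw [hσ, Finset.mul_sum]; exact Finset.sum_congr rfl fun i _ => by ring
    rw [e5, e6, ← hQ] at this
    nlinarith
  have h1 := key (-σ / (t - 1 / r))
  set d := t - 1 / r with hd
  have h2 : r * t = r * d + 1 := by rw [hd]; field_simp; ring
  have h3 : -σ / d * d = -σ := by field_simp
  set τ := -σ / d
  have h4 : 0 ≤ r * (d * τ ^ 2 + 2 * τ * σ + Q) := by nlinarith
  have h5 : 0 ≤ d * τ ^ 2 + 2 * τ * σ + Q := nonneg_of_mul_nonneg_right h4 hr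
  have h6 : 0 ≤ d * (d * τ ^ 2 + 2 * τ * σ + Q) := by positivity
  have h7 : σ = - (τ * d) := by linarith
  rw [h7] at h6 ⊢
  nlinarith

/-- A rooted configuration with an integral test vector violating the anchoring inequality. -/
theorem Anchored.false_of_config {G : SimpleGraph V} {x : ℝ} {N : ℕ} {o : V} {S : Set V}
    (h : Anchored G (x + 1 / x) x N o S) (hx : 1 < x) (hx' : x ≤ 1151 / 1000) {n : ℕ} (hn : n ≤ N)
    (s : Fin n → V) (hs : ∀ i, s i ∈ S) (R : Fin n → Bool) (E : Fin n → Fin n → Bool)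
    (hR : ∀ i, G.Adj o (s i) ↔ R i)
    (hE : ∀ i j, i < j → s i ≠ s j ∧ (G.Adj (s i) (s j) ↔ E i j)) (c : Fin n → ℤ)
    (hc : (∑ i, c i ^ 2) * (1151 ^ 2 + 1000 ^ 2) +
      2 * (∑ i, ∑ j, if i < j ∧ E i j then c i * c j else 0) * (1151 * 1000) -
      (∑ i, if R i then c i else 0) ^ 2 * 1000 ^ 2 < 0) : False := by
  have key := h n hn s hs (fun i => (c i : ℝ))
  set P : ℤ := ∑ i, c i ^ 2 with hP
  set T : ℤ := ∑ i, ∑ j, if i < j ∧ E i j then c i * c j else 0 with hT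
  set U : ℤ := ∑ i, if R i then c i else 0 with hU
  have e1 : ∑ i, (c i : ℝ) * adjMat G o (s i) = U := by
    rw [hU]; push_cast
    exact Finset.sum_congr rfl fun i _ => by by_cases hi : R i <;> simp [adjMat, hR, hi]
  have e2 : ∑ i, ∑ j, (c i : ℝ) * c j * gramEntry G (x + 1 / x) (s i) (s j) =
      (x + 1 / x) * P + 2 * T := by
    have : ∀ i j, (c i : ℝ) * c j * gramEntry G (x + 1 / x) (s i) (s j) =
        (if i = j then (x + 1 / x) * (c i : ℝ) ^ 2 else 0) +
        ((if i < j ∧ E i j then (c i : ℝ) * c j else 0) +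
        (if j < i ∧ E j i then (c j : ℝ) * c i else 0)) := by
      intro i j
      rcases lt_trichotomy i j with hij | rfl | hij
      · have := hE i j hij
        by_cases hh : E i j <;> simp_all [gramEntry, adjMat, hij.ne, hij.not_gt]
      · simp [gramEntry, adjMat]; ring
      · have := hE j i hij
        have h2 := this.1.symm
        have h3 := G.adj_comm (s i) (s j)
        by_cases hh : E j i <;> simp_all [gramEntry, adjMat, hij.ne', hij.not_gt]
        ring
    simp only [this, Finset.sum_add_distrib]
    rw [Finset.sum_comm (f := fun i j => if j < i ∧ E j i then (c j : ℝ) * c i else 0)]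
    rw [hP, hT]; push_cast
    rw [two_mul, Finset.mul_sum]
    simp only [Finset.sum_ite_eq, Finset.mem_univ, if_true]
  rw [e1, e2] at key
  have hc' : (P : ℝ) * (1151 ^ 2 + 1000 ^ 2) + 2 * T * (1151 * 1000) - U ^ 2 * 1000 ^ 2 < 0 := by
    exact_mod_cast hc
  have e3 : x * ((x + 1 / x) * P + 2 * T) = P * (x ^ 2 + 1) + 2 * T * x := by
    field_simp
  rw [e3] at key
  have hP0 : (0 : ℝ) ≤ P := by exact_mod_cast Finset.sum_nonneg fun i _ => sq_nonneg (c i)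
  have hx0 : 0 < x := by linarith
  have hU0 : (0 : ℝ) ≤ (U : ℝ) ^ 2 := sq_nonneg _
  generalize (U : ℝ) ^ 2 = u at *
  have k1 : 0 ≤ P * (x ^ 2 + 1) * (1151 / 1000 - x) + 2 * T * x * (1151 / 1000 - x) - u *
      (1151 / 1000 - x) := by
    nlinarith [mul_nonneg (sub_nonneg.2 hx') (sub_nonneg.2 key)]
  have k2 : (1151 / 1000 : ℝ) * u ≤ (1151 / 1000) * (P * (x ^ 2 + 1) + 2 * T * x) := by linarith
  have k3 : x * (P * ((1151 / 1000) ^ 2 + 1) + 2 * T * (1151 / 1000)) < x * u := by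
    apply mul_lt_mul_of_pos_left _ hx0
    linarith
  have k4 : 0 ≤ P * ((1151 / 1000 - x) * ((1151 / 1000) * x - 1)) := by
    apply mul_nonneg hP0
    apply mul_nonneg <;> nlinarith
  have k5 : 0 ≤ u * (1151 / 1000 - x) := mul_nonneg hU0 (by linarith)
  nlinarith

end Anchored

section Forbidden

variable {V : Type*} [Fintype V] {G : SimpleGraph V} {x : ℝ} {o : V} {S : Set V}

theorem le_of_pow_six_lt {x : ℝ} (hx6 : x ^ 6 < x ^ 2 + 1) : x ≤ 1151 / 1000 := by
  by_contra! h
  have h1 : (1151 / 1000 : ℝ) ^ 2 < x ^ 2 := by gcongr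
  have h2 : (1151 / 1000 : ℝ) ^ 4 < x ^ 4 := by gcongr
  nlinarith

theorem Anchored.false_of_nonadj_of_adj_left (h : Anchored G (x + 1 / x) x 6 o S) (hx : 1 < x)
    (hx6 : x ^ 6 < x ^ 2 + 1) {p p' q : V} (hp : p ∈ S) (hp' : p' ∈ S) (hq : q ∈ S)
    (op : G.Adj o p) (op' : G.Adj o p') (oq : ¬ G.Adj o q) (pp' : ¬ G.Adj p p') (hne : p ≠ p')
    (qp : G.Adj q p) (qp' : ¬ G.Adj q p') : False := by
  have hqp : q ≠ p := qp.ne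
  have hqp' : q ≠ p' := by rintro rfl; exact oq op'
  have key := h 3 (by norm_num) ![p, q, p'] (by simp [Fin.forall_fin_succ, *])
    ![x ^ 2 * (x ^ 2 + 1), -x ^ 3, x ^ 2 + 1]
  have pp'' : ¬ G.Adj p' p := fun h => pp' h.symm
  have qp'' : ¬ G.Adj p' q := fun h => qp' h.symm
  have hx0 : 0 < x := by linarith
  obtain ⟨t, ht, hxt⟩ : ∃ t, t = x + x⁻¹ ∧ x * t = x ^ 2 + 1 :=
    ⟨_, rfl, by field_simp⟩
  simp [Fin.sum_univ_succ, adjMat, gramEntry, op, op', oq, pp', hne, qp, qp', hqp, hqp',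
    hne.symm, hqp.symm, hqp'.symm, qp.symm, pp'', qp'', ← ht] at key
  have e : (x ^ 2 + 1) ^ 4 ≤ (x * t) * ((x ^ 2 * (x ^ 2 + 1)) ^ 2 + x ^ 6 + (x ^ 2 + 1) ^ 2) -
      2 * x ^ 6 * (x ^ 2 + 1) := by linear_combination key
  rw [hxt] at e
  have : 0 < x ^ 2 * (x ^ 2 + 1) * (x ^ 2 + 1 - x ^ 6) := by
    apply mul_pos (by positivity); linarith
  nlinarith

theorem Anchored.false_of_nonadj_of_adj_both (h : Anchored G (x + 1 / x) x 6 o S) (hx : 1 < x)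
    (hx6 : x ^ 6 < x ^ 2 + 1) {p p' q : V} (hp : p ∈ S) (hp' : p' ∈ S) (hq : q ∈ S)
    (op : G.Adj o p) (op' : G.Adj o p') (oq : ¬ G.Adj o q) (pp' : ¬ G.Adj p p') (hne : p ≠ p')
    (qp : G.Adj q p) (qp' : G.Adj q p') : False := by
  refine h.false_of_config hx (le_of_pow_six_lt hx6) (n := 3) (by norm_num) ![p, q, p'] ?_
    ![true, false, true] (fun i j => (i, j) ∈ ([(0, 1), (1, 2)] : List _)) ?_ ?_ ![1, -1, 1]
    (by decide)
  · simp [Fin.forall_fin_succ]; grind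
  · simp [Fin.forall_fin_succ]; grind
  · simp [Fin.forall_fin_succ]; grind [G.adj_comm, G.ne_of_adj]

theorem Anchored.false_of_three_nonadj (h : Anchored G (x + 1 / x) x 6 o S) (hx : 1 < x)
    (hx6 : x ^ 6 < x ^ 2 + 1) {p q r : V}
    (hp : p ∈ S) (hq : q ∈ S) (hr : r ∈ S)
    (op : G.Adj o p) (oq : G.Adj o q) (or : G.Adj o r)
    (pq : ¬ G.Adj p q) (pr : ¬ G.Adj p r) (qr : ¬ G.Adj q r)
    (ne_pq : p ≠ q) (ne_pr : p ≠ r) (ne_qr : q ≠ r) : False := by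
  refine h.false_of_config hx (le_of_pow_six_lt hx6) (n := 3) (by norm_num) ![p, q, r] ?_
    ![true, true, true]
    (fun i j => (i, j) ∈ ([] : List _)) ?_ ?_
    ![1, 1, 1] (by decide)
  · simp [Fin.forall_fin_succ]; grind
  · simp [Fin.forall_fin_succ]; grind
  · simp [Fin.forall_fin_succ]; grind [G.adj_comm, G.ne_of_adj]

theorem Anchored.false_of_three_one_adj (h : Anchored G (x + 1 / x) x 6 o S) (hx : 1 < x)
    (hx6 : x ^ 6 < x ^ 2 + 1) {p q r : V}
    (hp : p ∈ S) (hq : q ∈ S) (hr : r ∈ S)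
    (op : G.Adj o p) (oq : G.Adj o q) (or : G.Adj o r)
    (pq : ¬ G.Adj p q) (pr : G.Adj p r) (qr : ¬ G.Adj q r)
    (ne_pq : p ≠ q) (ne_qr : q ≠ r) : False := by
  refine h.false_of_config hx (le_of_pow_six_lt hx6) (n := 3) (by norm_num) ![p, q, r] ?_
    ![true, true, true]
    (fun i j => (i, j) ∈ ([(0, 2)] : List _)) ?_ ?_
    ![2, 3, 2] (by decide)
  · simp [Fin.forall_fin_succ]; grind
  · simp [Fin.forall_fin_succ]; grind
  · simp [Fin.forall_fin_succ]; grind [G.adj_comm, G.ne_of_adj]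

theorem Anchored.false_of_four_pendant (h : Anchored G (x + 1 / x) x 6 o S) (hx : 1 < x)
    (hx6 : x ^ 6 < x ^ 2 + 1) {p q r s : V}
    (hp : p ∈ S) (hq : q ∈ S) (hr : r ∈ S) (hs : s ∈ S)
    (op : G.Adj o p) (noq : ¬ G.Adj o q) (nor : ¬ G.Adj o r) (os : G.Adj o s)
    (pq : G.Adj p q) (pr : G.Adj p r) (ps : G.Adj p s) (qr : ¬ G.Adj q r) (qs : G.Adj q s)
    (rs : ¬ G.Adj r s)
    (ne_qr : q ≠ r) : False := by
  refine h.false_of_config hx (le_of_pow_six_lt hx6) (n := 4) (by norm_num) ![p, q, r, s] ?_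
    ![true, false, false, true]
    (fun i j => (i, j) ∈ ([(0, 1), (0, 2), (0, 3), (1, 3)] : List _)) ?_ ?_
    ![-4, 3, 2, -2] (by decide)
  · simp [Fin.forall_fin_succ]; grind
  · simp [Fin.forall_fin_succ]; grind
  · simp [Fin.forall_fin_succ]; grind [G.adj_comm, G.ne_of_adj]

theorem Anchored.false_of_four_twins (h : Anchored G (x + 1 / x) x 6 o S) (hx : 1 < x)
    (hx6 : x ^ 6 < x ^ 2 + 1) {p q r s : V}
    (hp : p ∈ S) (hq : q ∈ S) (hr : r ∈ S) (hs : s ∈ S)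
    (op : G.Adj o p) (noq : ¬ G.Adj o q) (nor : ¬ G.Adj o r) (os : G.Adj o s)
    (pq : G.Adj p q) (pr : G.Adj p r) (ps : G.Adj p s) (qr : ¬ G.Adj q r) (qs : G.Adj q s)
    (rs : G.Adj r s)
    (ne_qr : q ≠ r) : False := by
  refine h.false_of_config hx (le_of_pow_six_lt hx6) (n := 4) (by norm_num) ![p, q, r, s] ?_
    ![true, false, false, true]
    (fun i j => (i, j) ∈ ([(0, 1), (0, 2), (0, 3), (1, 3), (2, 3)] : List _)) ?_ ?_
    ![-1, 1, 1, -1] (by decide)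
  · simp [Fin.forall_fin_succ]; grind
  · simp [Fin.forall_fin_succ]; grind
  · simp [Fin.forall_fin_succ]; grind [G.adj_comm, G.ne_of_adj]

theorem Anchored.false_of_four_tail (h : Anchored G (x + 1 / x) x 6 o S) (hx : 1 < x)
    (hx6 : x ^ 6 < x ^ 2 + 1) {p q r s : V}
    (hp : p ∈ S) (hq : q ∈ S) (hr : r ∈ S) (hs : s ∈ S)
    (op : G.Adj o p) (noq : ¬ G.Adj o q) (nor : ¬ G.Adj o r) (os : G.Adj o s)
    (pq : G.Adj p q) (pr : ¬ G.Adj p r) (ps : G.Adj p s) (qr : G.Adj q r) (qs : G.Adj q s)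
    (rs : ¬ G.Adj r s) : False := by
  refine h.false_of_config hx (le_of_pow_six_lt hx6) (n := 4) (by norm_num) ![p, q, r, s] ?_
    ![true, false, false, true]
    (fun i j => (i, j) ∈ ([(0, 1), (1, 2), (0, 3), (1, 3)] : List _)) ?_ ?_
    ![3, -4, 2, 3] (by decide)
  · simp [Fin.forall_fin_succ]; grind
  · simp [Fin.forall_fin_succ]; grind
  · simp [Fin.forall_fin_succ]; grind [G.adj_comm, G.ne_of_adj]

theorem Anchored.false_of_four_clique (h : Anchored G (x + 1 / x) x 6 o S) (hx : 1 < x)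
    (hx6 : x ^ 6 < x ^ 2 + 1) {p q r s : V}
    (hp : p ∈ S) (hq : q ∈ S) (hr : r ∈ S) (hs : s ∈ S)
    (op : G.Adj o p) (noq : ¬ G.Adj o q) (nor : ¬ G.Adj o r) (os : G.Adj o s)
    (pq : G.Adj p q) (pr : G.Adj p r) (ps : G.Adj p s) (qr : G.Adj q r) (qs : G.Adj q s)
    (rs : G.Adj r s) : False := by
  refine h.false_of_config hx (le_of_pow_six_lt hx6) (n := 4) (by norm_num) ![p, q, r, s] ?_
    ![true, false, false, true]
    (fun i j => (i, j) ∈ ([(0, 1), (0, 2), (1, 2), (0, 3), (1, 3), (2, 3)] : List _)) ?_ ?_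
    ![3, -2, -2, 3] (by decide)
  · simp [Fin.forall_fin_succ]; grind
  · simp [Fin.forall_fin_succ]; grind
  · simp [Fin.forall_fin_succ]; grind [G.adj_comm, G.ne_of_adj]

theorem Anchored.false_of_four_cap (h : Anchored G (x + 1 / x) x 6 o S) (hx : 1 < x)
    (hx6 : x ^ 6 < x ^ 2 + 1) {p q r s : V}
    (hp : p ∈ S) (hq : q ∈ S) (hr : r ∈ S) (hs : s ∈ S)
    (op : G.Adj o p) (noq : ¬ G.Adj o q) (or : G.Adj o r) (os : G.Adj o s)
    (pq : G.Adj p q) (pr : G.Adj p r) (ps : G.Adj p s) (qr : G.Adj q r) (qs : G.Adj q s)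
    (rs : G.Adj r s) : False := by
  refine h.false_of_config hx (le_of_pow_six_lt hx6) (n := 4) (by norm_num) ![p, q, r, s] ?_
    ![true, false, true, true]
    (fun i j => (i, j) ∈ ([(0, 1), (0, 2), (0, 3), (1, 2), (1, 3), (2, 3)] : List _)) ?_ ?_
    ![2, -3, 2, 2] (by decide)
  · simp [Fin.forall_fin_succ]; grind
  · simp [Fin.forall_fin_succ]; grind
  · simp [Fin.forall_fin_succ]; grind [G.adj_comm, G.ne_of_adj]

theorem Anchored.false_of_five_path (h : Anchored G (x + 1 / x) x 6 o S) (hx : 1 < x)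
    (hx6 : x ^ 6 < x ^ 2 + 1) {p q r s t : V}
    (hp : p ∈ S) (hq : q ∈ S) (hr : r ∈ S) (hs : s ∈ S) (ht : t ∈ S)
    (op : G.Adj o p) (noq : ¬ G.Adj o q) (nor : ¬ G.Adj o r) (nos : ¬ G.Adj o s) (ot : G.Adj o t)
    (pq : G.Adj p q) (pr : ¬ G.Adj p r) (ps : ¬ G.Adj p s) (pt : G.Adj p t) (qr : G.Adj q r)
    (qs : G.Adj q s) (qt : ¬ G.Adj q t) (rs : ¬ G.Adj r s) (rt : G.Adj r t) (st : ¬ G.Adj s t) :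
    False := by
  refine h.false_of_config hx (le_of_pow_six_lt hx6) (n := 5) (by norm_num) ![p, q, r, s, t] ?_
    ![true, false, false, false, true]
    (fun i j => (i, j) ∈ ([(0, 1), (1, 2), (1, 3), (0, 4), (2, 4)] : List _)) ?_ ?_
    ![2, -2, 2, 1, -1] (by decide)
  · simp [Fin.forall_fin_succ]; grind
  · simp [Fin.forall_fin_succ]; grind
  · simp [Fin.forall_fin_succ]; grind [G.adj_comm, G.ne_of_adj]

theorem Anchored.false_of_five_fan (h : Anchored G (x + 1 / x) x 6 o S) (hx : 1 < x)
    (hx6 : x ^ 6 < x ^ 2 + 1) {p q r s t : V}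
    (hp : p ∈ S) (hq : q ∈ S) (hr : r ∈ S) (hs : s ∈ S) (ht : t ∈ S)
    (op : G.Adj o p) (noq : ¬ G.Adj o q) (nor : ¬ G.Adj o r) (nos : ¬ G.Adj o s) (ot : G.Adj o t)
    (pq : G.Adj p q) (pr : ¬ G.Adj p r) (ps : ¬ G.Adj p s) (pt : G.Adj p t) (qr : G.Adj q r)
    (qs : G.Adj q s) (qt : ¬ G.Adj q t) (rs : G.Adj r s) (rt : G.Adj r t) (st : G.Adj s t) :
    False := by
  refine h.false_of_config hx (le_of_pow_six_lt hx6) (n := 5) (by norm_num) ![p, q, r, s, t] ?_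
    ![true, false, false, false, true]
    (fun i j => (i, j) ∈ ([(0, 1), (1, 2), (1, 3), (2, 3), (0, 4), (2, 4), (3, 4)] : List _)) ?_ ?_
    ![-2, 2, -1, -1, 2] (by decide)
  · simp [Fin.forall_fin_succ]; grind
  · simp [Fin.forall_fin_succ]; grind
  · simp [Fin.forall_fin_succ]; grind [G.adj_comm, G.ne_of_adj]

theorem Anchored.false_of_six_path (h : Anchored G (x + 1 / x) x 6 o S) (hx : 1 < x)
    (hx6 : x ^ 6 < x ^ 2 + 1) {p q r s t u : V}
    (hp : p ∈ S) (hq : q ∈ S) (hr : r ∈ S) (hs : s ∈ S) (ht : t ∈ S) (hu : u ∈ S)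
    (op : G.Adj o p) (noq : ¬ G.Adj o q) (nor : ¬ G.Adj o r) (nos : ¬ G.Adj o s)
    (not : ¬ G.Adj o t) (ou : G.Adj o u)
    (pq : G.Adj p q) (pr : ¬ G.Adj p r) (ps : ¬ G.Adj p s) (pt : ¬ G.Adj p t) (pu : G.Adj p u)
    (qr : G.Adj q r) (qs : ¬ G.Adj q s) (qt : ¬ G.Adj q t) (qu : ¬ G.Adj q u) (rs : G.Adj r s)
    (rt : G.Adj r t) (ru : ¬ G.Adj r u) (st : ¬ G.Adj s t) (su : G.Adj s u) (tu : ¬ G.Adj t u) :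
    False := by
  refine h.false_of_config hx (le_of_pow_six_lt hx6) (n := 6) (by norm_num) ![p, q, r, s, t, u] ?_
    ![true, false, false, false, false, true]
    (fun i j => (i, j) ∈ ([(0, 1), (1, 2), (2, 3), (2, 4), (0, 5), (3, 5)] : List _)) ?_ ?_
    ![-2, 3, -4, 3, 2, -2] (by decide)
  · simp [Fin.forall_fin_succ]; grind
  · simp [Fin.forall_fin_succ]; grind
  · simp [Fin.forall_fin_succ]; grind [G.adj_comm, G.ne_of_adj]

theorem Anchored.false_of_six_fan (h : Anchored G (x + 1 / x) x 6 o S) (hx : 1 < x)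
    (hx6 : x ^ 6 < x ^ 2 + 1) {p q r s t u : V}
    (hp : p ∈ S) (hq : q ∈ S) (hr : r ∈ S) (hs : s ∈ S) (ht : t ∈ S) (hu : u ∈ S)
    (op : G.Adj o p) (noq : ¬ G.Adj o q) (nor : ¬ G.Adj o r) (nos : ¬ G.Adj o s)
    (not : ¬ G.Adj o t) (ou : G.Adj o u)
    (pq : G.Adj p q) (pr : ¬ G.Adj p r) (ps : ¬ G.Adj p s) (pt : ¬ G.Adj p t) (pu : G.Adj p u)
    (qr : G.Adj q r) (qs : ¬ G.Adj q s) (qt : G.Adj q t) (qu : ¬ G.Adj q u) (rs : G.Adj r s)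
    (rt : G.Adj r t) (ru : ¬ G.Adj r u) (st : G.Adj s t) (su : G.Adj s u) (tu : ¬ G.Adj t u) :
    False := by
  refine h.false_of_config hx (le_of_pow_six_lt hx6) (n := 6) (by norm_num) ![p, q, r, s, t, u] ?_
    ![true, false, false, false, false, true]
    (fun i j => (i, j) ∈
    ([(0, 1), (1, 2), (2, 3), (1, 4), (2, 4), (3, 4), (0, 5), (3, 5)] : List _)) ?_ ?_
    ![2, -3, 2, -3, 2, 2] (by decide)
  · simp [Fin.forall_fin_succ]; grind
  · simp [Fin.forall_fin_succ]; grind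
  · simp [Fin.forall_fin_succ]; grind [G.adj_comm, G.ne_of_adj]

end Forbidden

/-- A level function in which levels of adjacent vertices differ by at most one, every vertex of
positive level has a neighbour one level below, and at most one vertex has level zero; moreover
every vertex of level at least `L` anchors the set of vertices of larger level. -/
structure AnchoredLevels {V : Type*} [Fintype V] (G : SimpleGraph V) (lev : V → ℕ) (x : ℝ)
    (L : ℕ) : Prop where
  one_lt : 1 < x
  pow_lt : x ^ 6 < x ^ 2 + 1
  lev_le : ∀ u v, G.Adj u v → lev u ≤ lev v + 1
  exists_lower : ∀ v, 0 < lev v → ∃ u, G.Adj u v ∧ lev u + 1 = lev v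
  eq_of_zero : ∀ u v, lev u = 0 → lev v = 0 → u = v
  anchored : ∀ o, L ≤ lev o → Anchored G (x + 1 / x) x 9 o {v | lev o < lev v}

/-- An anchoring whose parameter lies in the range where the forbidden configurations apply. -/
structure StrongAnchor {V : Type*} [Fintype V] (G : SimpleGraph V) (o : V) (S : Set V) : Prop where
  exists_anchored : ∃ x : ℝ, 1 < x ∧ x ^ 6 < x ^ 2 + 1 ∧ Anchored G (x + 1 / x) x 6 o S

namespace StrongAnchor

variable {V : Type*} [Fintype V] {G : SimpleGraph V} {o : V} {S : Set V}

theorem false_of_nonadj (h : StrongAnchor G o S) {p p' q : V}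
    (H : (p ∈ S ∧ p' ∈ S ∧ q ∈ S) ∧ G.Adj o p ∧ G.Adj o p' ∧ ¬ G.Adj o q ∧ ¬ G.Adj p p' ∧
      p ≠ p' ∧ G.Adj q p) : False := by
  obtain ⟨x, hx, hx6, h⟩ := h.exists_anchored
  obtain ⟨⟨h1, h2, h3⟩, h4, h5, h6, h7, h8, h9⟩ := H
  by_cases h10 : G.Adj q p'
  · exact h.false_of_nonadj_of_adj_both hx hx6 h1 h2 h3 h4 h5 h6 h7 h8 h9 h10
  · exact h.false_of_nonadj_of_adj_left hx hx6 h1 h2 h3 h4 h5 h6 h7 h8 h9 h10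

theorem false_of_three (h : StrongAnchor G o S) {p p' p'' : V}
    (H : (p ∈ S ∧ p' ∈ S ∧ p'' ∈ S) ∧ G.Adj o p ∧ G.Adj o p' ∧ G.Adj o p'' ∧ ¬ G.Adj p p' ∧
      ¬ G.Adj p p'' ∧ p ≠ p' ∧ p ≠ p'' ∧ p' ≠ p'') : False := by
  obtain ⟨x, hx, hx6, h⟩ := h.exists_anchored
  obtain ⟨⟨h1, h2, h3⟩, h4, h5, h6, h7, h8, h9, h10, h11⟩ := H
  by_cases h12 : G.Adj p' p''
  · exact h.false_of_three_one_adj hx hx6 h2 h1 h3 h5 h4 h6 (fun h => h7 h.symm) h12 h8 h9.symm h10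
  · exact h.false_of_three_nonadj hx hx6 h1 h2 h3 h4 h5 h6 h7 h8 h12 h9 h10 h11

theorem false_of_cap (h : StrongAnchor G o S) {p p' p'' q : V}
    (H : (p ∈ S ∧ p' ∈ S ∧ p'' ∈ S ∧ q ∈ S) ∧ G.Adj o p ∧ G.Adj o p' ∧ G.Adj o p'' ∧ ¬ G.Adj o q ∧
      G.Adj p p' ∧ G.Adj p p'' ∧ G.Adj p' p'' ∧ G.Adj q p ∧ G.Adj q p' ∧ G.Adj q p'') : False := by
  obtain ⟨x, hx, hx6, h⟩ := h.exists_anchored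
  obtain ⟨⟨h1, h2, h3, h4⟩, h5, h6, h7, h8, h9, h10, h11, h12, h13, h14⟩ := H
  exact h.false_of_four_cap hx hx6 h1 h4 h2 h3 h5 h8 h6 h7 h12.symm h9 h10 h13 h14 h11

theorem adj_iff_of_adj_both (h : StrongAnchor G o S) {p p' q q' : V}
    (H : (p ∈ S ∧ p' ∈ S ∧ q ∈ S ∧ q' ∈ S) ∧ G.Adj o p ∧ G.Adj o p' ∧ ¬ G.Adj o q ∧ ¬ G.Adj o q' ∧
      G.Adj p p' ∧ G.Adj q p ∧ G.Adj q p' ∧ q ≠ q') :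
    ¬ (G.Adj q' p ∧ G.Adj q' p') ∧ (G.Adj q q' ↔ G.Adj q' p ∨ G.Adj q' p') := by
  obtain ⟨x, hx, hx6, h⟩ := h.exists_anchored
  obtain ⟨⟨h1, h2, h3, h4⟩, h5, h6, h7, h8, h9, h10, h11, h12⟩ := H
  by_cases a : G.Adj q' p <;> by_cases b : G.Adj q' p' <;> by_cases c : G.Adj q q'
  · exact (h.false_of_four_clique hx hx6 h1 h3 h4 h2 h5 h7 h8 h6 h10.symm a.symm h9 c h11 b).elim
  · exact (h.false_of_four_twins hx hx6 h1 h3 h4 h2 h5 h7 h8 h6 h10.symm a.symm h9 c h11 b h12).elim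
  · simp [*]
  · exact (h.false_of_four_pendant hx hx6 h1 h3 h4 h2 h5 h7 h8 h6 h10.symm a.symm h9 c h11 b
        h12).elim
  · simp [*]
  · exact (h.false_of_four_pendant hx hx6 h2 h3 h4 h1 h6 h7 h8 h5 h11.symm b.symm h9.symm c h10 a
      h12).elim
  · exact (h.false_of_four_tail hx hx6 h1 h3 h4 h2 h5 h7 h8 h6 h10.symm (fun h => a h.symm) h9 c
      h11 b).elim
  · simp [*]

theorem false_of_path (h : StrongAnchor G o S) {p q r s t : V}
    (H : (p ∈ S ∧ q ∈ S ∧ r ∈ S ∧ s ∈ S ∧ t ∈ S) ∧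
      (G.Adj o p ∧ ¬ G.Adj o q ∧ ¬ G.Adj o r ∧ ¬ G.Adj o s ∧ G.Adj o t) ∧
      (G.Adj p q ∧ ¬ G.Adj p r ∧ ¬ G.Adj p s ∧ G.Adj p t) ∧
      (G.Adj q r ∧ G.Adj q s ∧ ¬ G.Adj q t) ∧ ¬ G.Adj r s ∧ G.Adj r t ∧ ¬ G.Adj s t) : False := by
  obtain ⟨x, hx, hx6, h⟩ := h.exists_anchored
  obtain ⟨⟨h1, h2, h3, h4, h5⟩, ⟨a1, a2, a3, a4, a5⟩, ⟨b1, b2, b3, b4⟩, ⟨c1, c2, c3⟩, d, e, f⟩ := H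
  exact h.false_of_five_path hx hx6 h1 h2 h3 h4 h5 a1 a2 a3 a4 a5 b1 b2 b3 b4 c1 c2 c3 d e f

theorem false_of_fan (h : StrongAnchor G o S) {p q r s t : V}
    (H : (p ∈ S ∧ q ∈ S ∧ r ∈ S ∧ s ∈ S ∧ t ∈ S) ∧
      (G.Adj o p ∧ ¬ G.Adj o q ∧ ¬ G.Adj o r ∧ ¬ G.Adj o s ∧ G.Adj o t) ∧
      (G.Adj p q ∧ ¬ G.Adj p r ∧ ¬ G.Adj p s ∧ G.Adj p t) ∧
      (G.Adj q r ∧ G.Adj q s ∧ ¬ G.Adj q t) ∧ G.Adj r s ∧ G.Adj r t ∧ G.Adj s t) : False := by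
  obtain ⟨x, hx, hx6, h⟩ := h.exists_anchored
  obtain ⟨⟨h1, h2, h3, h4, h5⟩, ⟨a1, a2, a3, a4, a5⟩, ⟨b1, b2, b3, b4⟩, ⟨c1, c2, c3⟩, d, e, f⟩ := H
  exact h.false_of_five_fan hx hx6 h1 h2 h3 h4 h5 a1 a2 a3 a4 a5 b1 b2 b3 b4 c1 c2 c3 d e f

theorem false_of_long_path (h : StrongAnchor G o S) {p q r s t u : V}
    (H : (p ∈ S ∧ q ∈ S ∧ r ∈ S ∧ s ∈ S ∧ t ∈ S ∧ u ∈ S) ∧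
      (G.Adj o p ∧ ¬ G.Adj o q ∧ ¬ G.Adj o r ∧ ¬ G.Adj o s ∧ ¬ G.Adj o t ∧ G.Adj o u) ∧
      (G.Adj p q ∧ ¬ G.Adj p r ∧ ¬ G.Adj p s ∧ ¬ G.Adj p t ∧ G.Adj p u) ∧
      (G.Adj q r ∧ ¬ G.Adj q s ∧ ¬ G.Adj q t ∧ ¬ G.Adj q u) ∧
      (G.Adj r s ∧ G.Adj r t ∧ ¬ G.Adj r u) ∧ ¬ G.Adj s t ∧ G.Adj s u ∧ ¬ G.Adj t u) : False := by
  obtain ⟨x, hx, hx6, h⟩ := h.exists_anchored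
  obtain ⟨⟨h1, h2, h3, h4, h5, h6⟩, ⟨a1, a2, a3, a4, a5, a6⟩, ⟨b1, b2, b3, b4, b5⟩,
    ⟨c1, c2, c3, c4⟩, ⟨d1, d2, d3⟩, e1, e2, e3⟩ := H
  exact h.false_of_six_path hx hx6 h1 h2 h3 h4 h5 h6 a1 a2 a3 a4 a5 a6 b1 b2 b3 b4 b5 c1 c2 c3 c4
    d1 d2 d3 e1 e2 e3

theorem false_of_long_fan (h : StrongAnchor G o S) {p q r s t u : V}
    (H : (p ∈ S ∧ q ∈ S ∧ r ∈ S ∧ s ∈ S ∧ t ∈ S ∧ u ∈ S) ∧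
      (G.Adj o p ∧ ¬ G.Adj o q ∧ ¬ G.Adj o r ∧ ¬ G.Adj o s ∧ ¬ G.Adj o t ∧ G.Adj o u) ∧
      (G.Adj p q ∧ ¬ G.Adj p r ∧ ¬ G.Adj p s ∧ ¬ G.Adj p t ∧ G.Adj p u) ∧
      (G.Adj q r ∧ ¬ G.Adj q s ∧ G.Adj q t ∧ ¬ G.Adj q u) ∧
      (G.Adj r s ∧ G.Adj r t ∧ ¬ G.Adj r u) ∧ G.Adj s t ∧ G.Adj s u ∧ ¬ G.Adj t u) : False := by
  obtain ⟨x, hx, hx6, h⟩ := h.exists_anchored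
  obtain ⟨⟨h1, h2, h3, h4, h5, h6⟩, ⟨a1, a2, a3, a4, a5, a6⟩, ⟨b1, b2, b3, b4, b5⟩,
    ⟨c1, c2, c3, c4⟩, ⟨d1, d2, d3⟩, e1, e2, e3⟩ := H
  exact h.false_of_six_fan hx hx6 h1 h2 h3 h4 h5 h6 a1 a2 a3 a4 a5 a6 b1 b2 b3 b4 b5 c1 c2 c3 c4
    d1 d2 d3 e1 e2 e3

end StrongAnchor

namespace AnchoredLevels

variable {V : Type*} [Fintype V] {G : SimpleGraph V} {lev : V → ℕ} {x : ℝ} {L : ℕ}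

theorem basic (h : AnchoredLevels G lev x L) (u v : V) (huv : G.Adj u v) :
    G.Adj v u ∧ lev u ≤ lev v + 1 ∧ lev v ≤ lev u + 1 ∧ u ≠ v :=
  ⟨huv.symm, h.lev_le u v huv, h.lev_le v u huv.symm, huv.ne⟩

theorem move (h : AnchoredLevels G lev x L) {N : ℕ} {g o : V} {S S' : Set V}
    (hA : Anchored G (x + 1 / x) x (N + 1) g S') (ho : o ∈ S')
    (hgo : G.Adj g o) (hS : S ⊆ S') (hoS : o ∉ S) (hSg : ∀ v ∈ S, ¬ G.Adj g v) :
    Anchored G (x + 1 / x) x N o S := by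
  have h1 := h.one_lt
  simpa using hA.move (by linarith) (by simp; linarith) ho hgo hS hoS hSg

theorem anchor_zero (h : AnchoredLevels G lev x L) {o : V} (ho : L ≤ lev o) :
    StrongAnchor G o {v | lev o < lev v} :=
  ⟨x, h.one_lt, h.pow_lt, (h.anchored o ho).mono (by norm_num) subset_rfl⟩

theorem anchored_one (h : AnchoredLevels G lev x L) {g o : V} (hg : L ≤ lev g)
    (hgo : G.Adj g o ∧ lev g + 1 = lev o) :
    Anchored G (x + 1 / x) x 8 o {v | lev o ≤ lev v ∧ ¬ G.Adj g v ∧ v ≠ o} :=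
  h.move (h.anchored g hg) (by simp; omega) hgo.1 (fun v hv => by simp at *; omega) (by simp)
    (fun v hv => hv.2.1)

theorem anchor_one (h : AnchoredLevels G lev x L) {g o : V} (hg : L ≤ lev g)
    (hgo : G.Adj g o ∧ lev g + 1 = lev o) :
    StrongAnchor G o {v | lev o ≤ lev v ∧ ¬ G.Adj g v ∧ v ≠ o} :=
  ⟨x, h.one_lt, h.pow_lt, (h.anchored_one hg hgo).mono (by norm_num) subset_rfl⟩

theorem anchored_two (h : AnchoredLevels G lev x L) {k g o : V} (hk : L ≤ lev k)
    (hkg : G.Adj k g ∧ lev k + 1 = lev g) (hgo : G.Adj g o ∧ lev g + 1 = lev o) :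
    Anchored G (x + 1 / x) x 7 o
      {v | lev g ≤ lev v ∧ ¬ G.Adj k v ∧ ¬ G.Adj g v ∧ v ≠ g ∧ v ≠ o} := by
  have hb := h.basic
  refine h.move (h.anchored_one hk hkg) ?_ hgo.1 (fun v hv => ?_) (by simp) (fun v hv => hv.2.2.1)
  · simp only [Set.mem_ofPred_eq]; grind
  · simp only [Set.mem_ofPred_eq] at *; grind

theorem anchor_two (h : AnchoredLevels G lev x L) {k g o : V} (hk : L ≤ lev k)
    (hkg : G.Adj k g ∧ lev k + 1 = lev g) (hgo : G.Adj g o ∧ lev g + 1 = lev o) :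
    StrongAnchor G o {v | lev g ≤ lev v ∧ ¬ G.Adj k v ∧ ¬ G.Adj g v ∧ v ≠ g ∧ v ≠ o} :=
  ⟨x, h.one_lt, h.pow_lt, (h.anchored_two hk hkg hgo).mono (by norm_num) subset_rfl⟩

theorem anchor_three (h : AnchoredLevels G lev x L) {l k g o : V} (hl : L ≤ lev l)
    (hlk : G.Adj l k ∧ lev l + 1 = lev k)
    (hkg : G.Adj k g ∧ lev k + 1 = lev g) (hgo : G.Adj g o ∧ lev g + 1 = lev o) :
    StrongAnchor G o {v | lev k ≤ lev v ∧ ¬ G.Adj l v ∧ ¬ G.Adj k v ∧ ¬ G.Adj g v ∧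
      v ≠ k ∧ v ≠ g ∧ v ≠ o} := by
  have hb := h.basic
  refine ⟨x, h.one_lt, h.pow_lt, h.move (h.anchored_two hl hlk hkg) ?_ hgo.1 (fun v hv => ?_)
    (by simp) (fun v hv => hv.2.2.2.1)⟩
  · simp only [Set.mem_ofPred_eq]; grind
  · simp only [Set.mem_ofPred_eq] at *; grind

end AnchoredLevels

/-- `g` is a neighbour of `v` one level below. -/
abbrev IsParent {V : Type*} (G : SimpleGraph V) (lev : V → ℕ) (g v : V) : Prop :=
  G.Adj g v ∧ lev g + 1 = lev v

/-- `u` and `v` have a common parent. -/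
abbrev HasCommonParent {V : Type*} (G : SimpleGraph V) (lev : V → ℕ) (u v : V) : Prop :=
  ∃ h, IsParent G lev h u ∧ IsParent G lev h v

namespace AnchoredLevels

variable {V : Type*} [Fintype V] {G : SimpleGraph V} {lev : V → ℕ} {x : ℝ} {L : ℕ}

theorem false_of_split (h : AnchoredLevels G lev x L) {o o' t g g' : V}
    (hd : L = 0 ∨ L + 2 ≤ lev o) (hlev : lev o = lev o') (hoo : G.Adj o o')
    (hcp : ¬ HasCommonParent G lev o o') (ht : lev o ≤ lev t) (hto : G.Adj t o)
    (hto' : ¬ G.Adj t o') (hne : t ≠ o') (hg : IsParent G lev g o) (hg' : IsParent G lev g' o')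
    (hgt : ¬ G.Adj g t) (hgt' : ¬ G.Adj g' t) : False := by
  have hb := h.basic
  have hgo' : ¬ G.Adj g o' := fun hh => hcp ⟨g, hg, hh, by omega⟩
  have hgo : ¬ G.Adj g' o := fun hh => hcp ⟨g', ⟨hh, by omega⟩, hg'⟩
  have hg0 : 0 < lev g := by
    by_contra hh
    exact hgo' (h.eq_of_zero g g' (by omega) (by omega) ▸ hg'.1)
  obtain ⟨k, hk⟩ := h.exists_lower g hg0
  have hL : L ≤ lev k := by omega
  by_cases hkg' : G.Adj k g' <;> by_cases hgg' : G.Adj g g'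
  · refine (h.anchor_zero hL).false_of_path (p := g) (q := o) (r := o') (s := t) (t := g') ?_
    simp only [Set.mem_ofPred_eq]; and_intros <;> grind
  · refine (h.anchor_zero hL).false_of_nonadj (p := g) (p' := g') (q := o) ?_
    simp only [Set.mem_ofPred_eq]; and_intros <;> grind
  · refine (h.anchor_one hL hk).false_of_nonadj (p := o) (p' := g') (q := o') ?_
    simp only [Set.mem_ofPred_eq]; and_intros <;> grind
  · refine (h.anchor_two hL hk hg).false_of_nonadj (p := o') (p' := t) (q := g') ?_
    simp only [Set.mem_ofPred_eq]; and_intros <;> grind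

/-- Adjacent vertices of the same level without common parent have the same children. -/
theorem adj_child_iff (h : AnchoredLevels G lev x L) {o o' t : V}
    (hd : L = 0 ∨ L + 2 ≤ lev o) (hlev : lev o = lev o') (hoo : G.Adj o o')
    (hcp : ¬ HasCommonParent G lev o o') (ht : lev o + 1 = lev t) : G.Adj o t ↔ G.Adj o' t := by
  have hb := h.basic
  have h0 : 0 < lev o := by
    by_contra hh
    exact hoo.ne (h.eq_of_zero _ _ (by omega) (by omega))
  obtain ⟨g, hg⟩ := h.exists_lower o h0
  obtain ⟨g', hg'⟩ := h.exists_lower o' (hlev ▸ h0)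
  have hcp' : ¬ HasCommonParent G lev o' o := fun ⟨k, h1, h2⟩ => hcp ⟨k, h2, h1⟩
  constructor <;> intro hot <;> by_contra hh
  · exact h.false_of_split hd hlev hoo hcp (t := t) (by omega) hot.symm (fun h => hh h.symm)
      (by grind) hg hg' (by grind) (by grind)
  · exact h.false_of_split (hlev ▸ hd) hlev.symm hoo.symm hcp' (t := t) (by omega) hot.symm
      (fun h => hh h.symm) (by grind) hg' hg (by grind) (by grind)

theorem not_adj_of_nonadj_siblings (h : AnchoredLevels G lev x L) {o v w q : V}
    (hd : L ≤ lev o) (hv : IsParent G lev o v) (hw : IsParent G lev o w) (hvw : ¬ G.Adj v w)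
    (hne : v ≠ w) (hq : lev v ≤ lev q) (hoq : ¬ G.Adj o q) : ¬ G.Adj v q := by
  intro hh
  have hb := h.basic
  refine (h.anchor_zero hd).false_of_nonadj (p := v) (p' := w) (q := q) ?_
  simp only [Set.mem_ofPred_eq]; and_intros <;> grind

theorem false_of_triangle (h : AnchoredLevels G lev x L) {a b c o g : V}
    (hd : L = 0 ∨ L + 2 ≤ lev a) (hlev : lev a = lev b) (hab : G.Adj a b) (hac : G.Adj a c)
    (hbc : G.Adj b c) (hob : IsParent G lev o b) (hoc : IsParent G lev o c) (hoa : ¬ G.Adj o a)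
    (hga : IsParent G lev g a) (hgb : ¬ G.Adj g b) (hgc : ¬ G.Adj g c) : False := by
  have hb := h.basic
  have ho0 : 0 < lev o := by
    by_contra hh
    exact hoa (h.eq_of_zero g o (by omega) (by omega) ▸ hga.1)
  obtain ⟨k, hk⟩ := h.exists_lower o ho0
  have hL : L ≤ lev k := by omega
  by_cases hkg : G.Adj k g <;> by_cases hgo : G.Adj g o
  · refine (h.anchor_zero hL).false_of_fan (p := g) (q := a) (r := b) (s := c) (t := o) ?_
    simp only [Set.mem_ofPred_eq]; and_intros <;> grind
  · refine (h.anchor_zero hL).false_of_nonadj (p := o) (p' := g) (q := b) ?_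
    simp only [Set.mem_ofPred_eq]; and_intros <;> grind
  · refine (h.anchor_one hL hk).false_of_three (p := g) (p' := b) (p'' := c) ?_
    simp only [Set.mem_ofPred_eq]; and_intros <;> grind
  · have := (h.anchor_one hL hk).adj_iff_of_adj_both (p := b) (p' := c) (q := a) (q' := g) (by
      simp only [Set.mem_ofPred_eq]; and_intros <;> grind)
    grind

theorem false_of_grand_one (h : AnchoredLevels G lev x L) {v g g' k k' t : V}
    (hd : L = 0 ∨ L + 3 ≤ lev v) (hg : IsParent G lev g v) (hg' : IsParent G lev g' v)
    (hk : IsParent G lev k g) (hk' : IsParent G lev k' g') (hgg' : ¬ G.Adj g g')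
    (hcp : ¬ HasCommonParent G lev g g') (ht : lev g ≤ lev t) (hvt : G.Adj v t)
    (hgt : ¬ G.Adj g t) (hgt' : ¬ G.Adj g' t) (hkt : ¬ G.Adj k t) (hkt' : ¬ G.Adj k' t)
    (htg : t ≠ g) (htg' : t ≠ g') : False := by
  have hb := h.basic
  have hkg' : ¬ G.Adj k g' := fun hh => hcp ⟨k, hk, hh, by omega⟩
  have hkg : ¬ G.Adj k' g := fun hh => hcp ⟨k', ⟨hh, by omega⟩, hk'⟩
  have hk0 : 0 < lev k := by
    by_contra hh
    exact hkg' (h.eq_of_zero k k' (by omega) (by omega) ▸ hk'.1)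
  by_cases hc : HasCommonParent G lev k k'
  · obtain ⟨l, hl, hl'⟩ := hc
    have hL : L ≤ lev l := by omega
    by_cases hkk : G.Adj k k'
    · refine (h.anchor_zero hL).false_of_long_path (p := k) (q := g) (r := v) (s := g') (t := t)
        (u := k') ?_
      simp only [Set.mem_ofPred_eq]; and_intros <;> grind
    · refine (h.anchor_zero hL).false_of_nonadj (p := k) (p' := k') (q := g) ?_
      simp only [Set.mem_ofPred_eq]; and_intros <;> grind
  · obtain ⟨l, hl⟩ := h.exists_lower k hk0
    have hL : L ≤ lev l := by omega
    have hlk' : ¬ G.Adj l k' := fun hh => hc ⟨l, hl, hh, by omega⟩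
    by_cases hkk : G.Adj k k'
    · refine (h.anchor_one hL hl).false_of_nonadj (p := g) (p' := k') (q := v) ?_
      simp only [Set.mem_ofPred_eq]; and_intros <;> grind
    · refine (h.anchor_three hL hl hk hg).false_of_nonadj (p := g') (p' := t) (q := k') ?_
      simp only [Set.mem_ofPred_eq]; and_intros <;> grind

theorem false_of_grand_three (h : AnchoredLevels G lev x L) {v g g' k k' t : V}
    (hd : L = 0 ∨ L + 3 ≤ lev v) (hg : IsParent G lev g v) (hg' : IsParent G lev g' v)
    (hk : IsParent G lev k g) (hk' : IsParent G lev k' g') (hgg' : ¬ G.Adj g g')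
    (hcp : ¬ HasCommonParent G lev g g') (ht : lev v ≤ lev t) (hvt : G.Adj v t)
    (hgt : G.Adj g t) (hgt' : G.Adj g' t) : False := by
  have hb := h.basic
  have hkg' : ¬ G.Adj k g' := fun hh => hcp ⟨k, hk, hh, by omega⟩
  have hkg : ¬ G.Adj k' g := fun hh => hcp ⟨k', ⟨hh, by omega⟩, hk'⟩
  have hk0 : 0 < lev k := by
    by_contra hh
    exact hkg' (h.eq_of_zero k k' (by omega) (by omega) ▸ hk'.1)
  by_cases hc : HasCommonParent G lev k k'
  · obtain ⟨l, hl, hl'⟩ := hc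
    have hL : L ≤ lev l := by omega
    by_cases hkk : G.Adj k k'
    · refine (h.anchor_zero hL).false_of_long_fan (p := k) (q := g) (r := v) (s := g') (t := t)
        (u := k') ?_
      simp only [Set.mem_ofPred_eq]; and_intros <;> grind
    · refine (h.anchor_zero hL).false_of_nonadj (p := k) (p' := k') (q := g) ?_
      simp only [Set.mem_ofPred_eq]; and_intros <;> grind
  · obtain ⟨l, hl⟩ := h.exists_lower k hk0
    have hL : L ≤ lev l := by omega
    have hlk' : ¬ G.Adj l k' := fun hh => hc ⟨l, hl, hh, by omega⟩
    by_cases hkk : G.Adj k k'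
    · refine (h.anchor_one hL hl).false_of_nonadj (p := g) (p' := k') (q := v) ?_
      simp only [Set.mem_ofPred_eq]; and_intros <;> grind
    · have := (h.anchor_two hL hl hk).adj_iff_of_adj_both (p := v) (p' := t) (q := g') (q' := k')
          (by
        simp only [Set.mem_ofPred_eq]; and_intros <;> grind)
      grind

end AnchoredLevels

/-- Distinct vertices of the same level that are nonadjacent or have a common parent. -/
abbrev Separated {V : Type*} (G : SimpleGraph V) (lev : V → ℕ) (u v : V) : Prop :=
  u ≠ v ∧ (¬ G.Adj u v ∨ HasCommonParent G lev u v)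

/-- All parents of `v` are pairwise equivalent. -/
def SingleParented {V : Type*} (G : SimpleGraph V) (lev : V → ℕ) (v : V) : Prop :=
  ∀ g g', IsParent G lev g v → IsParent G lev g' v → ¬ Separated G lev g g'

namespace AnchoredLevels

variable {V : Type*} [Fintype V] {G : SimpleGraph V} {lev : V → ℕ} {x : ℝ} {L : ℕ}

theorem adj_iff_of_separated_parents (h : AnchoredLevels G lev x L) {v g g' t : V}
    (hd : L = 0 ∨ L + 3 ≤ lev v) (hg : IsParent G lev g v) (hg' : IsParent G lev g' v)
    (hs : Separated G lev g g') (ht : lev v ≤ lev t) (hne : t ≠ v) :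
    ¬ (G.Adj g t ∧ G.Adj g' t) ∧ (G.Adj v t ↔ G.Adj g t ∨ G.Adj g' t) := by
  have hb := h.basic
  obtain ⟨hgg, hs⟩ := hs
  by_cases hc : HasCommonParent G lev g g'
  · obtain ⟨k, hk, hk'⟩ := hc
    have hL : L ≤ lev k := by omega
    by_cases hgg' : G.Adj g g'
    · have := (h.anchor_zero hL).adj_iff_of_adj_both (p := g) (p' := g') (q := v) (q' := t) (by
        simp only [Set.mem_ofPred_eq]; and_intros <;> grind)
      grind
    · refine ((h.anchor_zero hL).false_of_nonadj (p := g) (p' := g') (q := v) ?_).elim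
      simp only [Set.mem_ofPred_eq]; and_intros <;> grind
  · have hgg' : ¬ G.Adj g g' := hs.resolve_right hc
    have hg0 : 0 < lev g := by
      by_contra hh
      exact hgg (h.eq_of_zero g g' (by omega) (by omega))
    obtain ⟨k, hk⟩ := h.exists_lower g hg0
    obtain ⟨k', hk'⟩ := h.exists_lower g' (by omega)
    have hL : L ≤ lev k := by omega
    have hkg' : ¬ G.Adj k g' := fun hh => hc ⟨k, hk, hh, by omega⟩
    have hkg : ¬ G.Adj k' g := fun hh => hc ⟨k', ⟨hh, by omega⟩, hk'⟩
    by_cases a : G.Adj v t <;> by_cases b : G.Adj g t <;> by_cases b' : G.Adj g' t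
    · exact (h.false_of_grand_three hd hg hg' hk hk' hgg' hc ht a b b').elim
    · simp [*]
    · simp [*]
    · exact (h.false_of_grand_one hd hg hg' hk hk' hgg' hc (by omega) a b b' (by grind) (by grind)
        (by grind) (by grind)).elim
    · refine ((h.anchor_one hL hk).false_of_nonadj (p := v) (p' := t) (q := g') ?_).elim
      simp only [Set.mem_ofPred_eq]; and_intros <;> grind
    · refine ((h.anchor_one hL hk).false_of_nonadj (p := v) (p' := t) (q := g') ?_).elim
      simp only [Set.mem_ofPred_eq]; and_intros <;> grind
    · refine ((h.anchor_one (by omega) hk').false_of_nonadj (p := v) (p' := t) (q := g) ?_).elim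
      simp only [Set.mem_ofPred_eq]; and_intros <;> grind
    · simp [*]

theorem singleParented_of_child (h : AnchoredLevels G lev x L) {v t : V}
    (hd : L = 0 ∨ L + 3 ≤ lev v) (hvt : IsParent G lev v t) : SingleParented G lev v := by
  have hb := h.basic
  intro g g' hg hg' hs
  have := (h.adj_iff_of_separated_parents hd hg hg' hs (t := t) (by omega) (by grind)).2
  grind

/-- The parents of a single-parented vertex have the same children. -/
theorem adj_iff_of_parents (h : AnchoredLevels G lev x L) {v g g' t : V}
    (hd : L = 0 ∨ L + 3 ≤ lev v) (hv : SingleParented G lev v) (hg : IsParent G lev g v)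
    (hg' : IsParent G lev g' v) (ht : lev t = lev v) : G.Adj g t ↔ G.Adj g' t := by
  have hs := hv g g' hg hg'
  by_cases hgg : g = g'
  · rw [hgg]
  · have : G.Adj g g' ∧ ¬ HasCommonParent G lev g g' := by grind
    exact h.adj_child_iff (by omega) (by omega) this.1 this.2 (by omega)

theorem not_three_separated_parents (h : AnchoredLevels G lev x L) {v g g' g'' : V}
    (hd : L = 0 ∨ L + 4 ≤ lev v) (hg : IsParent G lev g v) (hg' : IsParent G lev g' v)
    (hg'' : IsParent G lev g'' v) (h1 : Separated G lev g g') (h2 : Separated G lev g g'')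
    (h3 : Separated G lev g' g'') : False := by
  have hb := h.basic
  have hsym : ∀ a b, HasCommonParent G lev a b → HasCommonParent G lev b a :=
    fun a b ⟨k, h1, h2⟩ => ⟨k, h2, h1⟩
  -- a pair of parents is adjacent if and only if it has a common parent
  have key : ∀ a b, IsParent G lev a v → IsParent G lev b v → a ≠ b →
      HasCommonParent G lev a b → G.Adj a b := by
    rintro a b ha hb' hab ⟨k, hk, hk'⟩
    by_contra hh
    refine (h.anchor_zero (o := k) (by omega)).false_of_nonadj (p := a) (p' := b) (q := v) ?_
    simp only [Set.mem_ofPred_eq]; and_intros <;> grind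
  have adjacent : ∀ a b c, IsParent G lev a v → IsParent G lev b v → IsParent G lev c v →
      Separated G lev a b → Separated G lev a c → Separated G lev b c → ¬ G.Adj a b := by
    intro a b c ha hb' hc hab hac hbc hadj
    obtain ⟨k, hk, hk'⟩ := hab.2.resolve_left (not_not.2 hadj)
    by_cases hkc : G.Adj k c
    · have hk'' : IsParent G lev k c := ⟨hkc, by omega⟩
      refine (h.anchor_zero (o := k) (by omega)).false_of_cap (p := a) (p' := b) (p'' := c)
        (q := v) ?_
      have := key a c ha hc hac.1 ⟨k, hk, hk''⟩
      have := key b c hb' hc hbc.1 ⟨k, hk', hk''⟩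
      simp only [Set.mem_ofPred_eq]; and_intros <;> grind
    · have h4 := (h.anchor_zero (o := k) (by omega)).adj_iff_of_adj_both (p := a) (p' := b) (q := v)
        (q' := c) (by simp only [Set.mem_ofPred_eq]; and_intros <;> grind)
      have h5 : ∀ d, IsParent G lev d v → IsParent G lev k d → Separated G lev d c →
          ¬ G.Adj c d := by
        intro d hd' hkd hdc hcd
        obtain ⟨l, hl, hl'⟩ := hdc.2.resolve_left (not_not.2 hcd.symm)
        have := h.adj_iff_of_parents (v := d) (t := c) (by omega)
          (h.singleParented_of_child (by omega) hd') hkd hl (by omega)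
        grind
      grind
  have h4 := adjacent g g' g'' hg hg' hg'' h1 h2 h3
  have h5 := adjacent g g'' g' hg hg'' hg' h2 h1 (by grind)
  have h6 := adjacent g' g'' g hg' hg'' hg h3 (by grind) (by grind)
  have hg0 : 0 < lev g := by
    by_contra hh
    exact h1.1 (h.eq_of_zero g g' (by omega) (by omega))
  obtain ⟨k, hk⟩ := h.exists_lower g hg0
  obtain ⟨k', hk'⟩ := h.exists_lower g' (by omega)
  have c1 : ¬ HasCommonParent G lev g g' := fun hh => h4 (key g g' hg hg' h1.1 hh)
  have c2 : ¬ HasCommonParent G lev g g'' := fun hh => h5 (key g g'' hg hg'' h2.1 hh)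
  have c3 : ¬ HasCommonParent G lev g' g'' := fun hh => h6 (key g' g'' hg' hg'' h3.1 hh)
  refine h.false_of_grand_one (by omega) hg hg' hk hk' h4 c1 (t := g'') (by omega) hg''.1.symm
    (by grind) (by grind) (fun hh => c2 ⟨k, hk, hh, by omega⟩)
    (fun hh => c3 ⟨k', hk', hh, by omega⟩) (by grind) (by grind)

end AnchoredLevels

/-- The Gram entry of two single-parented vertices of the same level after removing the
contribution of their common parents. -/
noncomputable def levelSign {V : Type*} [Fintype V] (G : SimpleGraph V) (lev : V → ℕ) (u v : V) :
    ℝ :=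
  if u = v then 1 else if lev u = lev v then
    adjMat G u v - (if HasCommonParent G lev u v then 1 else 0) else 0

/-- A canonical representative of the class of `v` among single-parented vertices. -/
noncomputable def levelRep {V : Type*} [Fintype V] [Nonempty V] (G : SimpleGraph V) (lev : V → ℕ)
    (v : V) : V :=
  Classical.epsilon fun o => SingleParented G lev o ∧ levelSign G lev o v ≠ 0

/-- Coordinates of a vector representing `u` in a realisation of `A + 2 I` as a Gram matrix. -/
noncomputable def levelVec {V : Type*} [Fintype V] [Nonempty V] (G : SimpleGraph V) (lev : V → ℕ)
    (u o : V) : ℝ :=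
  if SingleParented G lev o ∧ levelRep G lev o = o then
    if lev u = lev o + 1 then adjMat G o u
    else if lev u = lev o ∧ SingleParented G lev u then levelSign G lev o u else 0
  else 0

section LevelSign

variable {V : Type*} [Fintype V] {G : SimpleGraph V} {lev : V → ℕ}

theorem levelSign_self (v : V) : levelSign G lev v v = 1 := by simp [levelSign]

theorem levelSign_comm (u v : V) : levelSign G lev u v = levelSign G lev v u := by
  have : HasCommonParent G lev u v ↔ HasCommonParent G lev v u :=
    ⟨fun ⟨k, h1, h2⟩ => ⟨k, h2, h1⟩, fun ⟨k, h1, h2⟩ => ⟨k, h2, h1⟩⟩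
  simp only [levelSign, this, adjMat_comm G u v, eq_comm]

theorem lev_eq_of_levelSign_ne_zero {u v : V} (h : levelSign G lev u v ≠ 0) : lev u = lev v := by
  unfold levelSign at h
  by_contra hh
  have : u ≠ v := by rintro rfl; exact hh rfl
  simp [this, hh] at h

theorem levelSign_cases {u v : V} (h : levelSign G lev u v ≠ 0) (hne : u ≠ v) :
    (levelSign G lev u v = 1 ∧ G.Adj u v ∧ ¬ HasCommonParent G lev u v) ∨
      (levelSign G lev u v = -1 ∧ ¬ G.Adj u v ∧ HasCommonParent G lev u v) := by
  have hl := lev_eq_of_levelSign_ne_zero h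
  have e : levelSign G lev u v = adjMat G u v - (if HasCommonParent G lev u v then 1 else 0) := by
    rw [levelSign, if_neg hne, if_pos hl]
  by_cases a : G.Adj u v <;> by_cases b : HasCommonParent G lev u v <;>
    simp only [adjMat, a, b, if_true, if_false] at e <;> simp_all

theorem levelSign_mul_self {u v : V} (h : levelSign G lev u v ≠ 0) :
    levelSign G lev u v * levelSign G lev u v = 1 := by
  by_cases hne : u = v
  · simp [hne, levelSign_self]
  · rcases levelSign_cases h hne with h | h <;> simp [h.1]

end LevelSign

namespace AnchoredLevels

variable {V : Type*} [Fintype V] {G : SimpleGraph V} {lev : V → ℕ} {x : ℝ} {L : ℕ}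

theorem levelSign_eq_of_adj (h : AnchoredLevels G lev x L) {u v w : V}
    (hd : L = 0 ∨ L + 3 ≤ lev v) (hu : SingleParented G lev u) (hv : lev v = lev w)
    (huv : lev u = lev v) (hne : u ≠ v) (hne' : u ≠ w) (hvw : G.Adj v w)
    (hcp : ¬ HasCommonParent G lev v w) : levelSign G lev v u = levelSign G lev w u := by
  have hb := h.basic
  have hsym : ∀ a b, HasCommonParent G lev a b → HasCommonParent G lev b a :=
    fun a b ⟨k, h1, h2⟩ => ⟨k, h2, h1⟩
  have h0 : 0 < lev v := by
    by_contra hh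
    exact hvw.ne (h.eq_of_zero _ _ (by omega) (by omega))
  -- the two asymmetric situations, for `v` and `w` in either role
  have split : ∀ a b, lev a = lev v → lev b = lev v → G.Adj a b → ¬ HasCommonParent G lev a b →
      u ≠ a → u ≠ b → ¬ HasCommonParent G lev a u → ¬ HasCommonParent G lev b u →
      G.Adj a u → G.Adj b u := by
    intro a b ha hb' hab hc hua hub ca cb hau
    by_contra hbu
    obtain ⟨g, hg⟩ := h.exists_lower a (by omega)
    obtain ⟨g', hg'⟩ := h.exists_lower b (by omega)
    exact h.false_of_split (o := a) (o' := b) (t := u) (g := g) (g' := g') (by omega) (by omega) hab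
      hc (by omega) hau.symm (fun hh => hbu hh.symm) hub hg hg'
      (fun hh => ca ⟨g, hg, hh, by omega⟩) (fun hh => cb ⟨g', hg', hh, by omega⟩)
  have tri : ∀ a b, lev a = lev v → lev b = lev v → G.Adj a b → ¬ HasCommonParent G lev a b →
      u ≠ a → u ≠ b → HasCommonParent G lev a u → ¬ HasCommonParent G lev b u →
      G.Adj a u ∧ ¬ G.Adj b u := by
    rintro a b ha hb' hab hc hua hub ⟨o, ho, ho'⟩ cb
    have hob : ¬ G.Adj o b := fun hh => hc ⟨o, ho, hh, by omega⟩
    have hau : G.Adj a u := by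
      by_contra hau
      refine (h.anchor_zero (o := o) (by omega)).false_of_nonadj (p := a) (p' := u) (q := b) ?_
      simp only [Set.mem_ofPred_eq]; and_intros <;> grind
    refine ⟨hau, fun hbu => ?_⟩
    obtain ⟨g, hg⟩ := h.exists_lower b (by omega)
    exact h.false_of_triangle (a := b) (b := a) (c := u) (o := o) (g := g) (by omega) (by omega)
      hab.symm hbu hau ho ho' hob hg (fun hh => hc ⟨g, ⟨hh, by omega⟩, hg⟩)
      (fun hh => cb ⟨g, hg, hh, by omega⟩)
  have both : ¬ (HasCommonParent G lev v u ∧ HasCommonParent G lev w u) := by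
    rintro ⟨⟨o, ho, ho'⟩, o2, hw, hw'⟩
    have := h.adj_iff_of_parents (v := u) (g := o) (g' := o2) (t := w) (by omega) hu ho' hw'
      (by omega)
    exact hcp ⟨o, ho, this.2 hw.1, by omega⟩
  have e1 := split v w rfl hv.symm hvw hcp hne hne'
  have e2 := split w v hv.symm rfl hvw.symm (fun hh => hcp (hsym _ _ hh)) hne' hne
  have e3 := tri v w rfl hv.symm hvw hcp hne hne'
  have e4 := tri w v hv.symm rfl hvw.symm (fun hh => hcp (hsym _ _ hh)) hne' hne
  rw [levelSign, levelSign, if_neg hne.symm, if_neg hne'.symm, if_pos huv.symm,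
    if_pos (hv.symm.trans huv.symm)]
  unfold adjMat
  clear hb hsym split tri hu hcp hvw
  obtain ⟨P, hP⟩ : ∃ P, HasCommonParent G lev v u ↔ P := ⟨_, Iff.rfl⟩
  obtain ⟨P', hP'⟩ : ∃ P, HasCommonParent G lev w u ↔ P := ⟨_, Iff.rfl⟩
  simp only [hP, hP'] at *
  clear hP hP'
  by_cases a : P <;> by_cases b : P' <;> by_cases c : G.Adj v u <;> by_cases d : G.Adj w u <;>
    simp_all

theorem levelSign_eq_zero_of_nonadj (h : AnchoredLevels G lev x L) {u v w : V}
    (hd : L = 0 ∨ L + 3 ≤ lev v) (hv : SingleParented G lev v)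
    (hne : u ≠ v) (hne' : u ≠ w) (hvw : ¬ G.Adj v w) (hvw' : v ≠ w)
    (hcp : HasCommonParent G lev v w) : levelSign G lev v u = 0 := by
  have hb := h.basic
  obtain ⟨o, ho, ho'⟩ := hcp
  by_cases hl : lev v = lev u
  · rw [levelSign, if_neg hne.symm, if_pos hl]
    unfold adjMat
    by_cases hou : G.Adj o u
    · have : HasCommonParent G lev v u := ⟨o, ho, hou, by omega⟩
      rw [if_pos this, if_pos, sub_self]
      by_contra hvu
      refine (h.anchor_zero (o := o) (by omega)).false_of_three (p := v) (p' := w) (p'' := u) ?_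
      simp only [Set.mem_ofPred_eq]; and_intros <;> grind
    · rw [if_neg, if_neg, sub_self]
      · rintro ⟨k, hk, hk'⟩
        have := h.adj_iff_of_parents (v := v) (g := o) (g' := k) (t := u) (by omega) hv ho hk
          (by omega)
        exact hou (this.2 hk'.1)
      · exact h.not_adj_of_nonadj_siblings (o := o) (by omega) ho ho' hvw hvw' (by omega) hou
  · rw [levelSign, if_neg hne.symm, if_neg hl]

/-- The sign is multiplicative. -/
theorem levelSign_mul (h : AnchoredLevels G lev x L) {u v w : V}
    (hd : L = 0 ∨ L + 3 ≤ lev v) (hu : SingleParented G lev u) (hv : SingleParented G lev v)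
    (hw : SingleParented G lev w) (hvw : levelSign G lev v w ≠ 0) :
    levelSign G lev v u = levelSign G lev v w * levelSign G lev w u := by
  have hlev := lev_eq_of_levelSign_ne_zero hvw
  by_cases h1 : v = w
  · rw [h1, levelSign_self, one_mul]
  by_cases h2 : u = v
  · rw [h2, levelSign_comm w v, levelSign_mul_self hvw, levelSign_self]
  by_cases h3 : u = w
  · rw [h3, levelSign_self, mul_one]
  rcases levelSign_cases hvw h1 with ⟨e, ha, hc⟩ | ⟨e, ha, hc⟩
  · rw [e, one_mul]
    by_cases huv : lev u = lev v
    · exact h.levelSign_eq_of_adj hd hu hlev huv h2 h3 ha hc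
    · have e1 := mt (lev_eq_of_levelSign_ne_zero (G := G) (lev := lev) (u := v) (v := u)) (by omega)
      have e2 := mt (lev_eq_of_levelSign_ne_zero (G := G) (lev := lev) (u := w) (v := u)) (by omega)
      rw [not_not.1 e1, not_not.1 e2]
  · obtain ⟨k, hk, hk'⟩ := hc
    rw [h.levelSign_eq_zero_of_nonadj hd hv h2 h3 ha h1 ⟨k, hk, hk'⟩,
      h.levelSign_eq_zero_of_nonadj (by omega) hw h3 h2 (fun hh => ha hh.symm) (Ne.symm h1)
        ⟨k, hk', hk⟩, mul_zero]

/-- Equivalent vertices have the same children up to sign. -/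
theorem levelSign_mul_adjMat (h : AnchoredLevels G lev x L) {v w t : V}
    (hd : L = 0 ∨ L + 3 ≤ lev v) (hvw : levelSign G lev v w ≠ 0) (ht : lev w + 1 = lev t) :
    levelSign G lev v w * adjMat G v t = adjMat G w t := by
  have hb := h.basic
  have hlev := lev_eq_of_levelSign_ne_zero hvw
  by_cases h1 : v = w
  · rw [h1, levelSign_self, one_mul]
  rcases levelSign_cases hvw h1 with ⟨e, ha, hc⟩ | ⟨e, ha, k, hk, hk'⟩
  · rw [e, one_mul]
    simp only [adjMat, h.adj_child_iff (t := t) (by omega) hlev ha hc (by omega)]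
  · have hkt : ¬ G.Adj k t := fun hh => by grind
    have a1 := h.not_adj_of_nonadj_siblings (q := t) (o := k) (by omega) hk hk' ha h1 (by omega) hkt
    have a2 := h.not_adj_of_nonadj_siblings (q := t) (o := k) (by omega) hk' hk
      (fun hh => ha hh.symm) (Ne.symm h1) (by omega) hkt
    simp [adjMat, a1, a2]

theorem levelSign_eq_one_of_child (h : AnchoredLevels G lev x L) {v w t : V}
    (hd : L = 0 ∨ L + 3 ≤ lev v) (hvw : levelSign G lev v w ≠ 0) (ht : IsParent G lev w t) :
    levelSign G lev v w = 1 := by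
  have := h.levelSign_mul_adjMat hd hvw ht.2
  by_cases h1 : v = w
  · rw [h1, levelSign_self]
  rcases levelSign_cases hvw h1 with ⟨e, -⟩ | ⟨e, -⟩
  · exact e
  · rw [e] at this
    by_cases hh : G.Adj v t <;> simp [adjMat, hh, ht.1] at this
    norm_num at this

theorem levelSign_parents_ne_zero_iff (h : AnchoredLevels G lev x L) {u g g' : V}
    (hd : L = 0 ∨ L + 4 ≤ lev u) (hg : IsParent G lev g u) (hg' : IsParent G lev g' u) :
    levelSign G lev g g' ≠ 0 ↔ ¬ Separated G lev g g' := by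
  by_cases hne : g = g'
  · simp [hne, levelSign_self]
  constructor
  · intro hh hs
    have := h.levelSign_eq_one_of_child (by omega) hh hg'
    rcases levelSign_cases hh hne with ⟨-, h1⟩ | ⟨h1, -⟩
    · grind
    · norm_num [h1] at this
  · intro hs
    have h1 : G.Adj g g' ∧ ¬ HasCommonParent G lev g g' := by grind
    rw [levelSign, if_neg hne, if_pos (by omega), if_neg h1.2]
    simp [adjMat, h1.1]

end AnchoredLevels

section LevelRep

variable {V : Type*} [Fintype V] [Nonempty V] {G : SimpleGraph V} {lev : V → ℕ}

theorem levelRep_spec {v : V} (hv : SingleParented G lev v) :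
    SingleParented G lev (levelRep G lev v) ∧ levelSign G lev (levelRep G lev v) v ≠ 0 :=
  Classical.epsilon_spec (p := fun o => SingleParented G lev o ∧ levelSign G lev o v ≠ 0)
    ⟨v, hv, by simp [levelSign_self]⟩

theorem lev_levelRep {v : V} (hv : SingleParented G lev v) : lev (levelRep G lev v) = lev v :=
  lev_eq_of_levelSign_ne_zero (levelRep_spec hv).2

end LevelRep

namespace AnchoredLevels

variable {V : Type*} [Fintype V] [Nonempty V] {G : SimpleGraph V} {lev : V → ℕ} {x : ℝ} {L : ℕ}

theorem levelRep_eq (h : AnchoredLevels G lev x L) {v w : V}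
    (hd : L = 0 ∨ L + 3 ≤ lev v) (hv : SingleParented G lev v) (hw : SingleParented G lev w)
    (hvw : levelSign G lev v w ≠ 0) : levelRep G lev v = levelRep G lev w := by
  have hlev := lev_eq_of_levelSign_ne_zero hvw
  unfold levelRep
  congr 1
  funext o
  refine propext (and_congr_right fun ho => ?_)
  rw [levelSign_comm o v, levelSign_comm o w, h.levelSign_mul hd ho hv hw hvw]
  simp [hvw]

theorem levelSign_ne_zero_of_levelRep_eq (h : AnchoredLevels G lev x L) {v w : V}
    (hd : L = 0 ∨ L + 3 ≤ lev v) (hv : SingleParented G lev v) (hw : SingleParented G lev w)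
    (hvw : levelRep G lev v = levelRep G lev w) : levelSign G lev v w ≠ 0 := by
  have h1 := levelRep_spec hv
  have h2 := levelRep_spec hw
  have h3 := lev_levelRep hv
  rw [h.levelSign_mul hd hw hv h1.1 (by rw [levelSign_comm]; exact h1.2), hvw]
  refine mul_ne_zero ?_ h2.2
  rw [← hvw, levelSign_comm]
  exact h1.2

theorem levelRep_levelRep (h : AnchoredLevels G lev x L) {v : V}
    (hd : L = 0 ∨ L + 3 ≤ lev v) (hv : SingleParented G lev v) :
    levelRep G lev (levelRep G lev v) = levelRep G lev v :=
  h.levelRep_eq (by rwa [lev_levelRep hv]) (levelRep_spec hv).1 hv (levelRep_spec hv).2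

/-- Values of the realising vectors at a representative of a parent. -/
theorem levelVec_levelRep_parent (h : AnchoredLevels G lev x L) {u g w : V}
    (hd : L = 0 ∨ L + 4 ≤ lev u) (hg : IsParent G lev g u) (hw : lev u ≤ lev w) :
    levelVec G lev w (levelRep G lev g) = if lev w = lev u then adjMat G g w else 0 := by
  have hs := h.singleParented_of_child (by omega) hg
  have h1 := levelRep_spec hs
  have h2 := lev_levelRep hs
  rw [levelVec, if_pos ⟨h1.1, h.levelRep_levelRep (by omega) hs⟩]
  by_cases hl : lev w = lev u
  · rw [if_pos (by omega), if_pos hl,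
      ← h.levelSign_mul_adjMat (t := w) (by omega) h1.2 (by omega),
      h.levelSign_eq_one_of_child (by omega) h1.2 hg, one_mul]
  · rw [if_neg (by omega), if_neg (by omega), if_neg hl]

theorem levelVec_ne_zero_of_levelRep (h : AnchoredLevels G lev x L) {u g o : V}
    (hd : L = 0 ∨ L + 4 ≤ lev u) (hg : IsParent G lev g u) (ho : levelVec G lev u o ≠ 0)
    (hlo : lev u = lev o + 1) (hs : ¬ Separated G lev o g) : o = levelRep G lev g := by
  unfold levelVec at ho
  split_ifs at ho with h1
  · have hou : IsParent G lev o u := by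
      refine ⟨?_, hlo.symm⟩
      by_contra hh
      simp [adjMat, hh] at ho
    rw [← h1.2]
    exact h.levelRep_eq (by omega) h1.1 (h.singleParented_of_child (by omega) hg)
      ((h.levelSign_parents_ne_zero_iff hd hou hg).2 hs)
  · exact absurd rfl ho

theorem sum_levelVec_of_single (h : AnchoredLevels G lev x L) {u g : V}
    (hd : L = 0 ∨ L + 4 ≤ lev u) (hu : SingleParented G lev u) (hg : IsParent G lev g u)
    (f : V → ℝ) : ∑ o, levelVec G lev u o * f o =
      f (levelRep G lev g) + levelSign G lev (levelRep G lev u) u * f (levelRep G lev u) := by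
  have hs := h.singleParented_of_child (by omega) hg
  have e1 : levelVec G lev u (levelRep G lev g) = 1 := by
    rw [h.levelVec_levelRep_parent hd hg le_rfl, if_pos rfl]
    simp [adjMat, hg.1]
  have e2 : levelVec G lev u (levelRep G lev u) = levelSign G lev (levelRep G lev u) u := by
    rw [levelVec, if_pos ⟨(levelRep_spec hu).1, h.levelRep_levelRep (by omega) hu⟩,
      if_neg (by rw [lev_levelRep hu]; omega), if_pos ⟨(lev_levelRep hu).symm, hu⟩]
  have hne : levelRep G lev g ≠ levelRep G lev u := by
    intro hh
    have := congrArg lev hh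
    rw [lev_levelRep hs, lev_levelRep hu] at this
    omega
  rw [← Finset.sum_subset (Finset.subset_univ {levelRep G lev g, levelRep G lev u}),
    Finset.sum_pair hne, e1, e2, one_mul]
  intro o _ ho
  simp only [Finset.mem_insert, Finset.mem_singleton, not_or] at ho
  by_contra hh
  have hh' := left_ne_zero_of_mul hh
  by_cases hlo : lev u = lev o + 1
  · refine ho.1 (h.levelVec_ne_zero_of_levelRep hd hg hh' hlo (hu o g ?_ hg))
    refine ⟨?_, hlo.symm⟩
    by_contra hou
    simp [levelVec, hlo, adjMat, hou] at hh'
  · unfold levelVec at hh'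
    rw [if_neg hlo] at hh'
    split_ifs at hh' with h1 h2
    · exact ho.2 (h1.2 ▸ h.levelRep_eq (by omega) h1.1 hu hh')
    · exact hh' rfl
    · exact hh' rfl

theorem sum_levelVec_of_double (h : AnchoredLevels G lev x L) {u g g' : V}
    (hd : L = 0 ∨ L + 4 ≤ lev u) (hg : IsParent G lev g u) (hg' : IsParent G lev g' u)
    (hgg : Separated G lev g g') (f : V → ℝ) : ∑ o, levelVec G lev u o * f o =
      f (levelRep G lev g) + f (levelRep G lev g') := by
  have hu : ¬ SingleParented G lev u := fun hh => hh g g' hg hg' hgg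
  have e1 : ∀ k, IsParent G lev k u → levelVec G lev u (levelRep G lev k) = 1 := by
    intro k hk
    rw [h.levelVec_levelRep_parent hd hk le_rfl, if_pos rfl]
    simp [adjMat, hk.1]
  have hne : levelRep G lev g ≠ levelRep G lev g' := by
    intro hh
    have := h.levelSign_ne_zero_of_levelRep_eq (by omega) (h.singleParented_of_child (by omega) hg)
      (h.singleParented_of_child (by omega) hg') hh
    exact (h.levelSign_parents_ne_zero_iff hd hg hg').1 this hgg
  rw [← Finset.sum_subset (Finset.subset_univ {levelRep G lev g, levelRep G lev g'}),
    Finset.sum_pair hne, e1 g hg, e1 g' hg', one_mul, one_mul]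
  intro o _ ho
  simp only [Finset.mem_insert, Finset.mem_singleton, not_or] at ho
  by_contra hh
  have hh' := left_ne_zero_of_mul hh
  have hlo : lev u = lev o + 1 := by
    by_contra hlo
    simp [levelVec, hlo, hu] at hh'
  have hou : IsParent G lev o u := by
    refine ⟨?_, hlo.symm⟩
    by_contra hou
    simp [levelVec, hlo, adjMat, hou] at hh'
  have h1 : Separated G lev o g := by
    by_contra hs
    exact ho.1 (h.levelVec_ne_zero_of_levelRep hd hg hh' hlo hs)
  have h2 : Separated G lev o g' := by
    by_contra hs
    exact ho.2 (h.levelVec_ne_zero_of_levelRep hd hg' hh' hlo hs)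
  exact h.not_three_separated_parents hd hou hg hg' h1 h2 hgg

theorem sum_levelVec_of_le (h : AnchoredLevels G lev x L) {u w : V}
    (hd : L = 0 ∨ L + 4 ≤ lev u) (h0 : 0 < lev u) (huw : lev u ≤ lev w)
    (hsw : lev u = lev w → SingleParented G lev u → SingleParented G lev w) :
    ∑ o, levelVec G lev u o * levelVec G lev w o = gramEntry G 2 u w := by
  have hb := h.basic
  by_cases hu : SingleParented G lev u
  · obtain ⟨g, hg⟩ := h.exists_lower u h0
    have hρ := levelRep_spec hu
    have hl := lev_levelRep hu
    have hsq := levelSign_mul_self hρ.2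
    have ev : levelVec G lev w (levelRep G lev u) = if lev w = lev u + 1 then
        adjMat G (levelRep G lev u) w else if lev w = lev u ∧ SingleParented G lev w then
        levelSign G lev (levelRep G lev u) w else 0 := by
      rw [levelVec, if_pos ⟨hρ.1, h.levelRep_levelRep (by omega) hu⟩, hl]
    rw [h.sum_levelVec_of_single hd hu hg, h.levelVec_levelRep_parent hd hg huw, ev]
    rcases huw.eq_or_lt with hl1 | hl1
    · have hw := hsw hl1 hu
      rw [if_pos hl1.symm, if_neg (by omega), if_pos ⟨hl1.symm, hw⟩,
        h.levelSign_mul (by omega) hw hρ.1 hu hρ.2, ← mul_assoc, hsq, one_mul]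
      by_cases huw' : u = w
      · subst huw'
        simp [levelSign_self, gramEntry, adjMat, hg.1]
        norm_num
      · rw [levelSign, if_neg huw', if_pos hl1, gramEntry, if_neg huw']
        have : HasCommonParent G lev u w ↔ G.Adj g w := by
          constructor
          · rintro ⟨k, hk, hk'⟩
            exact (h.adj_iff_of_parents (by omega) hu hg hk (by omega)).2 hk'.1
          · exact fun hgw => ⟨g, hg, hgw, by omega⟩
        by_cases hgw : G.Adj g w <;> simp [adjMat, this, hgw]
    · rw [if_neg (by omega), zero_add]
      have huw' : u ≠ w := by rintro rfl; omega
      rw [gramEntry, if_neg huw', add_zero]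
      by_cases hl2 : lev w = lev u + 1
      · rw [if_pos hl2, h.levelSign_mul_adjMat (by omega) hρ.2 (by omega)]
      · rw [if_neg hl2, if_neg (by omega), mul_zero]
        have : ¬ G.Adj u w := fun hh => by grind
        simp [adjMat, this]
  · obtain ⟨g, g', hg, hg', hs⟩ : ∃ g g', IsParent G lev g u ∧ IsParent G lev g' u ∧
        Separated G lev g g' := by
      unfold SingleParented at hu
      push Not at hu
      obtain ⟨g, g', h1, h2, h3⟩ := hu
      exact ⟨g, g', h1, h2, h3⟩
    rw [h.sum_levelVec_of_double hd hg hg' hs, h.levelVec_levelRep_parent hd hg huw,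
      h.levelVec_levelRep_parent hd hg' huw]
    by_cases huw' : u = w
    · subst huw'
      simp [gramEntry, adjMat, hg.1, hg'.1]
      norm_num
    · have key := h.adj_iff_of_separated_parents (t := w) (by omega) hg hg' hs huw (Ne.symm huw')
      rw [gramEntry, if_neg huw', add_zero]
      by_cases hl : lev w = lev u
      · rw [if_pos hl, if_pos hl]
        unfold adjMat
        by_cases a : G.Adj g w <;> by_cases b : G.Adj g' w <;> simp_all
      · have : ¬ G.Adj u w := fun hh => by grind
        simp [hl, adjMat, this]

theorem sum_levelVec (h : AnchoredLevels G lev x L) {u w : V}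
    (hu : L = 0 ∨ L + 4 ≤ lev u) (hu0 : 0 < lev u) (hw : L = 0 ∨ L + 4 ≤ lev w) (hw0 : 0 < lev w) :
    ∑ o, levelVec G lev u o * levelVec G lev w o = gramEntry G 2 u w := by
  have key : (lev u ≤ lev w ∧ (lev u = lev w → SingleParented G lev u → SingleParented G lev w)) ∨
      (lev w ≤ lev u ∧ (lev w = lev u → SingleParented G lev w → SingleParented G lev u)) := by
    rcases lt_trichotomy (lev u) (lev w) with hl | hl | hl
    · exact .inl ⟨hl.le, fun h => absurd h hl.ne⟩
    · by_cases hw : SingleParented G lev w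
      · exact .inl ⟨hl.le, fun _ _ => hw⟩
      · exact .inr ⟨hl.ge, fun _ h => absurd h hw⟩
    · exact .inr ⟨hl.le, fun h => absurd h hl.ne⟩
  rcases key with ⟨h1, h2⟩ | ⟨h1, h2⟩
  · exact h.sum_levelVec_of_le hu hu0 h1 h2
  · rw [gramEntry_comm, ← h.sum_levelVec_of_le hw hw0 h1 h2]
    exact Finset.sum_congr rfl fun o _ => mul_comm _ _

end AnchoredLevels

theorem qform_eq_sum_gramEntry {V : Type*} [Fintype V] (G : SimpleGraph V) (t : ℝ) (f : V → ℝ) :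
    qform G t f = ∑ u, ∑ v, f u * f v * gramEntry G t u v := by
  unfold qform gramEntry
  rw [Finset.mul_sum, ← Finset.sum_add_distrib]
  refine Finset.sum_congr rfl fun u _ => ?_
  have : t * f u ^ 2 = ∑ v, f u * f v * (if u = v then t else 0) := by
    simp; ring
  rw [this, ← Finset.sum_add_distrib]
  exact Finset.sum_congr rfl fun v _ => by ring

/-- The form of `A + 2 I` is nonnegative on functions supported far from the base. -/
theorem AnchoredLevels.qform_two_nonneg {V : Type*} [Fintype V] {G : SimpleGraph V} {lev : V → ℕ}
    {x : ℝ} {L : ℕ} (h : AnchoredLevels G lev x L) {f : V → ℝ}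
    (hf : ∀ v, f v ≠ 0 → 0 < lev v ∧ (L = 0 ∨ L + 4 ≤ lev v)) : 0 ≤ qform G 2 f := by
  rcases isEmpty_or_nonempty V with hV | hV
  · simp [qform]
  have : qform G 2 f = ∑ o, (∑ u, f u * levelVec G lev u o) ^ 2 := by
    rw [qform_eq_sum_gramEntry]
    simp only [pow_two, Finset.sum_mul_sum]
    rw [Finset.sum_comm (s := Finset.univ) (t := Finset.univ)
      (f := fun o u => ∑ w, f u * levelVec G lev u o * (f w * levelVec G lev w o))]
    refine Finset.sum_congr rfl fun u _ => ?_
    rw [Finset.sum_comm]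
    refine Finset.sum_congr rfl fun w _ => ?_
    by_cases hu : f u = 0
    · simp [hu]
    by_cases hw : f w = 0
    · simp [hw]
    rw [← h.sum_levelVec (hf u hu).2 (hf u hu).1 (hf w hw).2 (hf w hw).1, Finset.mul_sum]
    exact Finset.sum_congr rfl fun o _ => by ring
  rw [this]
  exact Finset.sum_nonneg fun o _ => sq_nonneg _

/-- The function with value `∑ c i` over the indices mapped to `v`. -/
noncomputable def pushSum {V : Type*} {n : ℕ} (s : Fin n → V) (c : Fin n → ℝ) (v : V) : ℝ :=
  ∑ i, if s i = v then c i else 0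

theorem pushSum_eq_zero {V : Type*} {n : ℕ} {s : Fin n → V} {c : Fin n → ℝ} {v : V}
    (h : ∀ i, s i ≠ v) :
    pushSum s c v = 0 :=
  Finset.sum_eq_zero fun i _ => by simp [h i]

section Forms

variable {V : Type*} [Fintype V]

/-- The bilinear form of `A + t I`. -/
noncomputable def bform (G : SimpleGraph V) (t : ℝ) (f g : V → ℝ) : ℝ :=
  ∑ u, ∑ v, f u * g v * gramEntry G t u v

theorem bform_self (G : SimpleGraph V) (t : ℝ) (f : V → ℝ) : bform G t f f = qform G t f :=
  (qform_eq_sum_gramEntry G t f).symm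

theorem bform_comm (G : SimpleGraph V) (t : ℝ) (f g : V → ℝ) : bform G t f g = bform G t g f := by
  unfold bform
  rw [Finset.sum_comm]
  refine Finset.sum_congr rfl fun u _ => Finset.sum_congr rfl fun v _ => ?_
  rw [gramEntry_comm]
  ring

theorem bform_add_left (G : SimpleGraph V) (t : ℝ) (f f' g : V → ℝ) :
    bform G t (f + f') g = bform G t f g + bform G t f' g := by
  simp only [bform, ← Finset.sum_add_distrib, Pi.add_apply, add_mul]

theorem bform_smul_left (G : SimpleGraph V) (t c : ℝ) (f g : V → ℝ) :
    bform G t (c • f) g = c * bform G t f g := by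
  simp only [bform, Finset.mul_sum, Pi.smul_apply, smul_eq_mul, mul_assoc]

theorem qform_add (G : SimpleGraph V) (t : ℝ) (f g : V → ℝ) :
    qform G t (f + g) = qform G t f + 2 * bform G t f g + qform G t g := by
  rw [← bform_self, bform_add_left, bform_comm G t f (f + g), bform_comm G t g (f + g),
    bform_add_left, bform_add_left, bform_comm G t g f, bform_self, bform_self]
  ring

theorem qform_add_smul (G : SimpleGraph V) (t c : ℝ) (f g : V → ℝ) :
    qform G t (f + c • g) = qform G t f + 2 * c * bform G t f g + c ^ 2 * qform G t g := by
  rw [qform_add, ← bform_self G t (c • g), bform_smul_left, bform_comm G t f, bform_smul_left,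
    bform_comm G t g (c • g), bform_smul_left, bform_comm G t g f, bform_self]
  ring

theorem qform_eq_add (G : SimpleGraph V) (s t : ℝ) (f : V → ℝ) :
    qform G t f = qform G s f + (t - s) * ∑ u, f u ^ 2 := by
  unfold qform
  ring

theorem bform_single_right (G : SimpleGraph V) (t : ℝ) (f : V → ℝ) (o : V) :
    bform G t f (Pi.single o 1) = ∑ v, f v * gramEntry G t v o := by
  unfold bform
  refine Finset.sum_congr rfl fun u _ => ?_
  rw [Finset.sum_eq_single o]
  · simp
  · intro b _ hb; simp [hb]
  · simp

theorem qform_single (G : SimpleGraph V) (t : ℝ) (o : V) : qform G t (Pi.single o 1) = t := by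
  rw [← bform_self, bform_single_right, Finset.sum_eq_single o]
  · simp [gramEntry, adjMat]
  · intro b _ hb; simp [hb]
  · simp

theorem sum_pushSum {n : ℕ} (s : Fin n → V) (c : Fin n → ℝ) (F : V → ℝ) :
    ∑ v, pushSum s c v * F v = ∑ i, c i * F (s i) := by
  simp only [pushSum, Finset.sum_mul]
  rw [Finset.sum_comm]
  exact Finset.sum_congr rfl fun i _ => by simp

theorem qform_pushSum (G : SimpleGraph V) (t : ℝ) {n : ℕ} (s : Fin n → V) (c : Fin n → ℝ) :
    qform G t (pushSum s c) = ∑ i, ∑ j, c i * c j * gramEntry G t (s i) (s j) := by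
  rw [qform_eq_sum_gramEntry]
  have : ∀ u, ∑ v, pushSum s c u * pushSum s c v * gramEntry G t u v =
      pushSum s c u * ∑ j, c j * gramEntry G t u (s j) := fun u => by
    rw [← sum_pushSum s c (gramEntry G t u), Finset.mul_sum]
    simp only [mul_assoc]
  simp only [this]
  rw [sum_pushSum s c fun u => ∑ j, c j * gramEntry G t u (s j)]
  simp only [Finset.mul_sum, mul_assoc]

/-- It suffices to check the anchoring inequality on functions with small support. -/
theorem anchored_of_forall_qform {G : SimpleGraph V} {t r : ℝ} {N : ℕ} {o : V} {S : Set V}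
    (h : ∀ T : Finset V, T.card ≤ N → ∀ f : V → ℝ, (∀ v ∉ T, f v = 0) → (∀ v ∉ S, f v = 0) →
      (∑ v, f v * adjMat G o v) ^ 2 ≤ r * qform G t f) : Anchored G t r N o S := by
  intro n hn s hs c
  have := h (Finset.univ.image s) ((Finset.card_image_le.trans (by simp)).trans hn) (pushSum s c)
    (fun v hv => pushSum_eq_zero fun i hi => hv (by simp [← hi]))
    (fun v hv => pushSum_eq_zero fun i hi => hv (hi ▸ hs i))
  rwa [sum_pushSum s c (adjMat G o), qform_pushSum] at this

theorem Anchored.relax {G : SimpleGraph V} {t t' r r' : ℝ} {N : ℕ} {o : V} {S : Set V}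
    (h : Anchored G t r N o S) (hr : 0 < r) (ht : t ≤ t') (hr' : r ≤ r') :
    Anchored G t' r' N o S := by
  intro n hn s hs c
  have h1 := h n hn s hs c
  rw [← qform_pushSum] at h1 ⊢
  have h2 := qform_mono (G := G) ht (pushSum s c)
  have h3 : 0 ≤ r * qform G t (pushSum s c) := (sq_nonneg _).trans h1
  have h4 := nonneg_of_mul_nonneg_right h3 hr
  have h5 : 0 ≤ qform G t' (pushSum s c) := h4.trans h2
  refine h1.trans ?_
  exact (mul_le_mul_of_nonneg_left h2 hr.le).trans (mul_le_mul_of_nonneg_right hr' h5)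

theorem anchored_of_nonneg {G : SimpleGraph V} {t : ℝ} (ht : 0 < t) {o : V} {S : Set V}
    (hS : o ∉ S) (h : ∀ f : V → ℝ, (∀ v, v ≠ o → v ∉ S → f v = 0) → 0 ≤ qform G t f) (N : ℕ) :
    Anchored G t t N o S := by
  refine anchored_of_forall_qform fun T _ f _ hf => ?_
  have hσ : ∑ v, f v * adjMat G o v = bform G t f (Pi.single o 1) := by
    rw [bform_single_right]
    refine Finset.sum_congr rfl fun v _ => ?_
    by_cases hv : v = o
    · simp [hv, hf o hS]
    · simp [gramEntry, hv, adjMat_comm G o v]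
  have h1 := h (f + (-(bform G t f (Pi.single o 1)) / t) • Pi.single o 1) fun v hv hvS => by
    simp [hf v hvS, hv]
  rw [qform_add_smul, qform_single] at h1
  rw [hσ]
  set σ := bform G t f (Pi.single o 1)
  have h2 : t * (qform G t f + 2 * (-σ / t) * σ + (-σ / t) ^ 2 * t) = t * qform G t f - σ ^ 2 := by
    field_simp
    ring
  have h3 := mul_nonneg ht.le h1
  linarith

end Forms

/-- The anchoring parameters along a geodesic. -/
noncomputable def anchorSeq (t : ℝ) : ℕ → ℝ
  | 0 => t
  | k + 1 => t - 1 / anchorSeq t k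

theorem one_le_anchorSeq {t : ℝ} (ht : 2 ≤ t) (k : ℕ) : 1 ≤ anchorSeq t k := by
  induction k with
  | zero => simp only [anchorSeq]; linarith
  | succ k ih =>
    have : 1 / anchorSeq t k ≤ 1 := by rw [div_le_one (by linarith)]; exact ih
    simp only [anchorSeq]; linarith

theorem anchorSeq_le {t x : ℝ} (ht : 2 ≤ t) (hx : 1 < x) (htx : t ≤ x + 1 / x) (k : ℕ) :
    anchorSeq t k ≤ max x (t - k * (x + 1 / x - t)) := by
  induction k with
  | zero => simp [anchorSeq]
  | succ k ih =>
    have h1 := one_le_anchorSeq ht k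
    simp only [anchorSeq]
    rcases le_total (anchorSeq t k) x with h | h
    · refine le_max_of_le_left ?_
      have := one_div_le_one_div_of_le (by linarith) h
      linarith
    · have : x + 1 / x ≤ anchorSeq t k + 1 / anchorSeq t k := by
        rw [← sub_nonneg]
        have e : anchorSeq t k + 1 / anchorSeq t k - (x + 1 / x) =
            (anchorSeq t k - x) * (anchorSeq t k * x - 1) / (anchorSeq t k * x) := by
          have : anchorSeq t k ≠ 0 := by positivity
          field_simp
          ring
        rw [e]
        have : 0 ≤ anchorSeq t k * x - 1 := by nlinarith
        have : 0 ≤ anchorSeq t k - x := by linarith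
        positivity
      push_cast
      rcases le_max_iff.1 ih with h2 | h2
      · exact le_max_of_le_left (by linarith)
      · exact le_max_of_le_right (by linarith)

theorem exists_anchorSeq_le {t x : ℝ} (ht : 2 ≤ t) (hx : 1 < x) (htx : t < x + 1 / x) :
    ∃ L, ∀ k ≥ L, anchorSeq t k ≤ x := by
  obtain ⟨L, hL⟩ := exists_nat_ge ((t - x) / (x + 1 / x - t))
  refine ⟨L, fun k hk => (anchorSeq_le ht hx htx.le k).trans (max_le le_rfl ?_)⟩
  rw [div_le_iff₀ (by linarith)] at hL
  have : (L : ℝ) ≤ k := by exact_mod_cast hk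
  nlinarith

/-- Anchoring along geodesics for a form which is nonnegative away from the lowest levels. -/
theorem anchored_of_levels {V : Type*} [Fintype V] {G : SimpleGraph V} {lev : V → ℕ} {t : ℝ}
    {l : ℕ} (ht : 2 ≤ t) (hlev : ∀ u v, G.Adj u v → lev u ≤ lev v + 1)
    (hlow : ∀ v, 0 < lev v → ∃ u, G.Adj u v ∧ lev u + 1 = lev v)
    (hQ : ∀ f : V → ℝ, (∀ v, lev v < l → f v = 0) → 0 ≤ qform G t f) (k : ℕ) :
    ∀ N o, lev o = l + k → Anchored G t (anchorSeq t k) N o {v | lev o < lev v} := by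
  induction k with
  | zero =>
    intro N o ho
    refine anchored_of_nonneg (by linarith) (by simp) (fun f hf => hQ f fun v hv => ?_) N
    refine hf v (by rintro rfl; omega) ?_
    simp only [Set.mem_ofPred_eq]
    omega
  | succ k ih =>
    intro N o ho
    obtain ⟨g, hgo, hg⟩ := hlow o (by omega)
    have h1 := one_le_anchorSeq ht k
    have h2 := one_le_anchorSeq ht (k + 1)
    refine (ih (N + 1) g (by omega)).move (by linarith) ?_ ?_ hgo ?_ (by simp) ?_
    · simp only [anchorSeq] at h2
      linarith
    · simp only [Set.mem_ofPred_eq]; omega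
    · intro v hv
      simp only [Set.mem_ofPred_eq] at hv ⊢
      omega
    · intro v hv hgv
      have := hlev v g hgv.symm
      simp only [Set.mem_ofPred_eq] at hv
      omega

theorem dist_le_dist_add_one_of_adj {V : Type*} {G : SimpleGraph V} (hG : G.Connected) (p : V)
    {u v : V} (huv : G.Adj u v) : G.dist p u ≤ G.dist p v + 1 := by
  have := hG.dist_triangle (u := p) (v := v) (w := u)
  rwa [SimpleGraph.dist_eq_one_iff_adj.2 huv.symm] at this

theorem exists_adj_dist_add_one {V : Type*} {G : SimpleGraph V} (hG : G.Connected) {p v : V}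
    (hv : 0 < G.dist p v) : ∃ u, G.Adj u v ∧ G.dist p u + 1 = G.dist p v := by
  obtain ⟨w, hw⟩ := hG.exists_walk_length_eq_dist v p
  rw [SimpleGraph.dist_comm] at hw
  cases w with
  | nil => simp at hv
  | cons h w =>
    rename_i u
    refine ⟨u, h.symm, le_antisymm ?_ (dist_le_dist_add_one_of_adj hG p h)⟩
    rw [← hw, SimpleGraph.Walk.length_cons, SimpleGraph.dist_comm]
    exact Nat.add_le_add_right (SimpleGraph.dist_le w) 1

theorem anchoredLevels_dist {V : Type*} [Fintype V] {G : SimpleGraph V} {t x : ℝ} {L : ℕ}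
    (hG : G.Connected) (ht : 2 ≤ t) (hx : 1 < x) (hx6 : x ^ 6 < x ^ 2 + 1) (htx : t ≤ x + 1 / x)
    (hL : ∀ k ≥ L, anchorSeq t k ≤ x) (hQ : ∀ f, 0 ≤ qform G t f) (p : V) :
    AnchoredLevels G (G.dist p) x L := by
  have h1 : ∀ u v, G.Adj u v → G.dist p u ≤ G.dist p v + 1 := fun u v huv =>
    dist_le_dist_add_one_of_adj hG p huv
  have h2 : ∀ v, 0 < G.dist p v → ∃ u, G.Adj u v ∧ G.dist p u + 1 = G.dist p v := fun v hv =>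
    exists_adj_dist_add_one hG hv
  refine ⟨hx, hx6, h1, h2, fun u v hu hv => ?_, fun o ho => ?_⟩
  · rw [← hG.dist_eq_zero_iff.1 hu, hG.dist_eq_zero_iff.1 hv]
  · refine (anchored_of_levels (l := 0) ht h1 h2 (fun f _ => hQ f) _ 9 o (zero_add _).symm).relax
      ?_ htx (hL _ ho)
    linarith [one_le_anchorSeq ht (G.dist p o)]

theorem card_level_le {V : Type*} [Fintype V] {G : SimpleGraph V} {lev : V → ℕ} {p : V} {Δ : ℕ}
    (hdeg : ∀ v, (Finset.univ.filter (G.Adj v)).card ≤ Δ)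
    (hlow : ∀ v, 0 < lev v → ∃ u, G.Adj u v ∧ lev u + 1 = lev v) (h0 : ∀ v, lev v = 0 → v = p)
    (i : ℕ) : (Finset.univ.filter fun v => lev v = i).card ≤ Δ ^ i := by
  induction i with
  | zero =>
    rw [pow_zero, Finset.card_le_one]
    intro a ha b hb
    simp only [Finset.mem_filter, Finset.mem_univ, true_and] at ha hb
    rw [h0 a ha, h0 b hb]
  | succ i ih =>
    have : (Finset.univ.filter fun v => lev v = i + 1) ⊆
        (Finset.univ.filter fun v => lev v = i).biUnion fun u => Finset.univ.filter (G.Adj u) := by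
      intro v hv
      simp only [Finset.mem_filter, Finset.mem_univ, true_and, Finset.mem_biUnion] at hv ⊢
      obtain ⟨u, hu, hu'⟩ := hlow v (by omega)
      exact ⟨u, by omega, hu⟩
    refine (Finset.card_le_card this).trans (Finset.card_biUnion_le.trans ?_)
    refine (Finset.sum_le_sum fun u _ => hdeg u).trans ?_
    rw [Finset.sum_const, smul_eq_mul, pow_succ]
    exact Nat.mul_le_mul_right _ ih

theorem exists_le_lev {V : Type*} [Fintype V] {G : SimpleGraph V} {lev : V → ℕ} {p : V} {Δ : ℕ}
    (hdeg : ∀ v, (Finset.univ.filter (G.Adj v)).card ≤ Δ)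
    (hlow : ∀ v, 0 < lev v → ∃ u, G.Adj u v ∧ lev u + 1 = lev v) (h0 : ∀ v, lev v = 0 → v = p)
    {D : ℕ} (hD : ∑ i ∈ Finset.range D, Δ ^ i < Fintype.card V) : ∃ v, D ≤ lev v := by
  by_contra! hh
  refine hD.not_ge ?_
  rw [← Finset.card_univ, Finset.card_eq_sum_card_fiberwise (f := lev) (t := Finset.range D)
    (fun v _ => by simpa using hh v)]
  exact Finset.sum_le_sum fun i _ => card_level_le hdeg hlow h0 i

/-- Cutting a function between two consecutive levels. -/
theorem qform_cut {V : Type*} [Fintype V] {G : SimpleGraph V} {lev : V → ℕ} {Δ : ℕ} {f : V → ℝ}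
    (hdeg : ∀ v, (Finset.univ.filter (G.Adj v)).card ≤ Δ)
    (hlev : ∀ u v, G.Adj u v → lev u ≤ lev v + 1) (j : ℕ)
    (h1 : 0 ≤ qform G 2 fun v => if lev v ≤ j then f v else 0)
    (h2 : 0 ≤ qform G 2 fun v => if lev v ≤ j then 0 else f v) :
    0 ≤ qform G 2 f + Δ * (∑ v, (if lev v = j then f v ^ 2 else 0) +
      ∑ v, if lev v = j + 1 then f v ^ 2 else 0) := by
  set f1 : V → ℝ := fun v => if lev v ≤ j then f v else 0 with hf1
  set f2 : V → ℝ := fun v => if lev v ≤ j then 0 else f v with hf2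
  have hf : f = f1 + f2 := by
    funext v
    by_cases h : lev v ≤ j <;> simp [hf1, hf2, h]
  have hA : ∀ F : V → ℝ, (∀ v, 0 ≤ F v) →
      ∑ u, ∑ v, adjMat G u v * F u ≤ Δ * ∑ u, F u := fun F hF => by
    rw [Finset.mul_sum]
    refine Finset.sum_le_sum fun u _ => ?_
    rw [← Finset.sum_mul]
    refine mul_le_mul_of_nonneg_right ?_ (hF u)
    simp only [adjMat, Finset.sum_boole]
    exact_mod_cast hdeg u
  have hb : -(∑ u, ∑ v, adjMat G u v * (if lev u = j then f u ^ 2 else 0) +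
      ∑ u, ∑ v, adjMat G u v * (if lev u = j + 1 then f u ^ 2 else 0)) ≤ 2 * bform G 2 f1 f2 := by
    rw [Finset.sum_comm (f := fun u v => adjMat G u v * (if lev u = j + 1 then f u ^ 2 else 0)),
      bform, neg_le_iff_add_nonneg]
    simp only [Finset.mul_sum, ← Finset.sum_add_distrib]
    refine Finset.sum_nonneg fun u _ => Finset.sum_nonneg fun v _ => ?_
    rw [adjMat_comm G v u]
    have hA0 : 0 ≤ adjMat G u v := by unfold adjMat; split_ifs <;> norm_num
    have e1 : (0 : ℝ) ≤ if lev u = j then f u ^ 2 else 0 := by split_ifs <;> positivity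
    have e2 : (0 : ℝ) ≤ if lev v = j + 1 then f v ^ 2 else 0 := by split_ifs <;> positivity
    by_cases hu : lev u ≤ j
    · by_cases hv : lev v ≤ j
      · simp only [hf2, hv, if_true, mul_zero, zero_mul]
        positivity
      · have huv : u ≠ v := by rintro rfl; exact hv hu
        rw [gramEntry, if_neg huv, add_zero]
        by_cases ha : G.Adj u v
        · have := hlev v u ha.symm
          rw [if_pos (by omega), if_pos (by omega)]
          simp only [hf1, hf2, hu, hv, if_true, if_false, adjMat, ha]
          nlinarith [sq_nonneg (f u + f v)]
        · simp [adjMat, ha]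
    · simp only [hf1, hu, if_false, mul_zero, zero_mul]
      positivity
  have hc : 0 ≤ 2 * bform G 2 f1 f2 + Δ * (∑ v, (if lev v = j then f v ^ 2 else 0) +
      ∑ v, if lev v = j + 1 then f v ^ 2 else 0) := by
    have a1 := hA (fun u => if lev u = j then f u ^ 2 else 0) fun v => by
      split_ifs <;> positivity
    have a2 := hA (fun u => if lev u = j + 1 then f u ^ 2 else 0) fun v => by
      split_ifs <;> positivity
    rw [mul_add]
    linarith
  have e : qform G 2 f = qform G 2 f1 + 2 * bform G 2 f1 f2 + qform G 2 f2 := by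
    rw [← qform_add, ← hf]
  linarith

theorem sum_level_mass_le {V : Type*} [Fintype V] (lev : V → ℕ) (f : V → ℝ) (a J : ℕ) :
    ∑ j ∈ Finset.range J, ∑ v, (if lev v = a + j then f v ^ 2 else 0) ≤ ∑ v, f v ^ 2 := by
  rw [Finset.sum_comm]
  refine Finset.sum_le_sum fun v _ => ?_
  by_cases h : ∃ i ∈ Finset.range J, lev v = a + i
  · obtain ⟨i, hi, hv⟩ := h
    rw [Finset.sum_eq_single_of_mem i hi fun k _ hk => if_neg (by omega), if_pos hv]
  · push Not at h
    rw [Finset.sum_eq_zero fun i hi => if_neg (h i hi)]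
    positivity

/-- Large connected graphs of bounded degree. -/
theorem exists_qform_nonneg_of_degree_le {t x ε : ℝ} (ht : 2 ≤ t) (hx : 1 < x)
    (hx6 : x ^ 6 < x ^ 2 + 1) (htx : t < x + 1 / x) (hε : 0 < ε) (Δ : ℕ) :
    ∃ N, ∀ (V : Type*) [Fintype V] (G : SimpleGraph V), G.Connected → (∀ f, 0 ≤ qform G t f) →
      (∀ v, (Finset.univ.filter (G.Adj v)).card ≤ Δ) → N < Fintype.card V →
      ∀ f, 0 ≤ qform G (2 + ε) f := by
  obtain ⟨L, hL⟩ := exists_anchorSeq_le ht hx htx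
  obtain ⟨J, hJ⟩ := exists_nat_gt (2 * Δ / ε)
  refine ⟨∑ i ∈ Finset.range (2 * L + 8 + J), Δ ^ i, fun V _ G hG hQ hdeg hN f => ?_⟩
  obtain ⟨p⟩ := hG.nonempty
  have hlevels := anchoredLevels_dist hG ht hx hx6 htx.le hL hQ
  obtain ⟨q, hq⟩ := exists_le_lev (p := p) hdeg (hlevels p).exists_lower
    (fun v hv => (hlevels p).eq_of_zero v p hv (by simp)) hN
  have hcut : ∀ j ∈ Finset.range J, 0 ≤ qform G 2 f +
      Δ * (∑ v, (if G.dist p v = L + 4 + j then f v ^ 2 else 0) +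
        ∑ v, if G.dist p v = L + 5 + j then f v ^ 2 else 0) := by
    intro j hj
    rw [Finset.mem_range] at hj
    have e : L + 5 + j = L + 4 + j + 1 := by omega
    rw [e]
    refine qform_cut hdeg (hlevels p).lev_le (L + 4 + j) ?_ ?_
    · refine (hlevels q).qform_two_nonneg fun v hv => ?_
      have h1 : G.dist p v ≤ L + 4 + j := by
        by_contra hh
        simp [hh] at hv
      have h2 := hG.dist_triangle (u := p) (v := v) (w := q)
      rw [SimpleGraph.dist_comm (u := v)] at h2
      omega
    · refine (hlevels p).qform_two_nonneg fun v hv => ?_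
      have h1 : ¬ G.dist p v ≤ L + 4 + j := by
        intro hh
        simp [hh] at hv
      omega
  have hsum := Finset.sum_nonneg hcut
  rw [Finset.sum_add_distrib, ← Finset.mul_sum, Finset.sum_add_distrib, Finset.sum_const,
    Finset.card_range, nsmul_eq_mul] at hsum
  have m1 := sum_level_mass_le (G.dist p) f (L + 4) J
  have m2 := sum_level_mass_le (G.dist p) f (L + 5) J
  have hS : 0 ≤ ∑ v, f v ^ 2 := Finset.sum_nonneg fun _ _ => sq_nonneg _
  have hΔ : (0 : ℝ) ≤ Δ := Nat.cast_nonneg _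
  have hJ0 : (0 : ℝ) < J := lt_of_le_of_lt (by positivity) hJ
  rw [div_lt_iff₀ hε] at hJ
  have h3 : 0 ≤ J * qform G 2 f + Δ * (2 * ∑ v, f v ^ 2) := by
    refine hsum.trans (add_le_add_right (mul_le_mul_of_nonneg_left ?_ hΔ) _)
    linarith
  rw [qform_eq_add G 2 (2 + ε)]
  have h4 : 0 ≤ J * (qform G 2 f + (2 + ε - 2) * ∑ v, f v ^ 2) := by nlinarith
  exact nonneg_of_mul_nonneg_right h4 hJ0

/-- A form of Ramsey's theorem. -/
theorem exists_clique_or_independent (s m : ℕ) :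
    ∃ R, ∀ (V : Type*) (G : SimpleGraph V) (T : Finset V), R ≤ T.card →
      (∃ K ⊆ T, K.card = m ∧ ∀ u ∈ K, ∀ v ∈ K, u ≠ v → G.Adj u v) ∨
      ∃ I ⊆ T, I.card = s ∧ ∀ u ∈ I, ∀ v ∈ I, ¬ G.Adj u v := by
  induction s generalizing m with
  | zero => exact ⟨0, fun V G T _ => .inr ⟨∅, by simp, by simp, by simp⟩⟩
  | succ s ihs =>
    induction m with
    | zero => exact ⟨0, fun V G T _ => .inl ⟨∅, by simp, by simp, by simp⟩⟩
    | succ m ihm =>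
      obtain ⟨R₁, h₁⟩ := ihs (m + 1)
      obtain ⟨R₂, h₂⟩ := ihm
      refine ⟨R₁ + R₂ + 1, fun V G T hT => ?_⟩
      obtain ⟨v, hv⟩ := Finset.card_pos.1 (by omega : 0 < T.card)
      have hc := Finset.card_filter_add_card_filter_not (s := T.erase v) (p := G.Adj v)
      rw [Finset.card_erase_of_mem hv] at hc
      rcases le_or_gt R₁ ((T.erase v).filter fun w => ¬ G.Adj v w).card with h | h
      · rcases h₁ V G _ h with ⟨K, hK, hK'⟩ | ⟨I, hI, hIm, hIm'⟩
        · exact .inl ⟨K, fun w hw => Finset.mem_of_mem_erase (Finset.mem_filter.1 (hK hw)).1, hK'⟩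
        · have hIv : ∀ w ∈ I, w ≠ v ∧ w ∈ T ∧ ¬ G.Adj v w := fun w hw => by
            have := hI hw
            simpa [and_assoc] using this
          refine .inr ⟨insert v I, ?_, ?_, ?_⟩
          · intro w hw
            rcases Finset.mem_insert.1 hw with rfl | hw
            exacts [hv, (hIv w hw).2.1]
          · rw [Finset.card_insert_of_notMem (fun h => (hIv v h).1 rfl), hIm]
          · intro u hu w hw huw
            rcases Finset.mem_insert.1 hu with rfl | hu' <;>
              rcases Finset.mem_insert.1 hw with rfl | hw'
            · exact huw.ne rfl
            · exact (hIv w hw').2.2 huw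
            · exact (hIv u hu').2.2 huw.symm
            · exact hIm' u hu' w hw' huw
      · rcases h₂ V G ((T.erase v).filter (G.Adj v)) (by omega) with ⟨K, hK, hK', hK''⟩ |
            ⟨I, hI, hIm⟩
        · have hKv : ∀ w ∈ K, w ≠ v ∧ w ∈ T ∧ G.Adj v w := fun w hw => by
            have := hK hw
            simpa [and_assoc] using this
          refine .inl ⟨insert v K, ?_, ?_, ?_⟩
          · intro w hw
            rcases Finset.mem_insert.1 hw with rfl | hw
            exacts [hv, (hKv w hw).2.1]
          · rw [Finset.card_insert_of_notMem (fun h => (hKv v h).1 rfl), hK']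
          · intro u hu w hw huw
            rcases Finset.mem_insert.1 hu with rfl | hu' <;>
              rcases Finset.mem_insert.1 hw with rfl | hw'
            · exact absurd rfl huw
            · exact (hKv w hw').2.2
            · exact (hKv u hu').2.2.symm
            · exact hK'' u hu' w hw' huw
        · exact .inr ⟨I, fun w hw => Finset.mem_of_mem_erase (Finset.mem_filter.1 (hI hw)).1, hIm⟩

/-- The indicator function of a finite set. -/
noncomputable def ind {V : Type*} (S : Finset V) (v : V) : ℝ := if v ∈ S then 1 else 0

/-- The vertices adjacent to almost all vertices of `K`. -/
def cliqueHull {V : Type*} (G : SimpleGraph V) (K : Finset V) : Set V :=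
  {v | (K.filter fun u => ¬ G.Adj v u).card ≤ 4}

theorem mem_cliqueHull {V : Type*} {G : SimpleGraph V} {K : Finset V}
    (hK : ∀ u ∈ K, ∀ v ∈ K, u ≠ v → G.Adj u v) {v : V} (hv : v ∈ K) : v ∈ cliqueHull G K := by
  have : (K.filter fun u => ¬ G.Adj v u) ⊆ {v} := by
    intro u hu
    rw [Finset.mem_filter] at hu
    by_contra hh
    exact hu.2 (hK v hv u hu.1 fun h => hh (by simp [h]))
  have := Finset.card_le_card this
  rw [Finset.card_singleton] at this
  show (K.filter fun u => ¬ G.Adj v u).card ≤ 4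
  omega

section Clique

variable {V : Type*} [Fintype V] {G : SimpleGraph V} {t : ℝ}

theorem bform_ind_right (f : V → ℝ) (S : Finset V) :
    bform G t f (ind S) = ∑ u, f u * ∑ v ∈ S, gramEntry G t u v := by
  unfold bform ind
  refine Finset.sum_congr rfl fun u _ => ?_
  rw [Finset.mul_sum, ← Finset.sum_filter_add_sum_filter_not Finset.univ (· ∈ S)]
  simp only [Finset.filter_univ_mem]
  rw [Finset.sum_eq_zero (s := Finset.univ.filter (· ∉ S)), add_zero]
  · exact Finset.sum_congr rfl fun v hv => by simp [hv]
  · intro v hv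
    simp only [Finset.mem_filter, Finset.mem_univ, true_and] at hv
    simp [hv]

theorem bform_ind_ind (S T : Finset V) :
    bform G t (ind S) (ind T) = ∑ u ∈ S, ∑ v ∈ T, gramEntry G t u v := by
  rw [bform_ind_right]
  simp only [ind, ite_mul, one_mul, zero_mul]
  rw [← Finset.sum_filter, Finset.filter_univ_mem]

theorem bform_single_ind (w : V) (T : Finset V) :
    bform G t (Pi.single w 1) (ind T) = ∑ v ∈ T, gramEntry G t w v := by
  rw [bform_ind_right, Finset.sum_eq_single w]
  · simp
  · intro b _ hb; simp [hb]
  · simp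

theorem qform_ind_clique {K : Finset V} (hK : ∀ u ∈ K, ∀ v ∈ K, u ≠ v → G.Adj u v) :
    qform G t (ind K) = K.card ^ 2 + (t - 1) * K.card := by
  rw [← bform_self, bform_ind_ind]
  have : ∀ u ∈ K, ∑ v ∈ K, gramEntry G t u v = K.card + (t - 1) := by
    intro u hu
    have : ∀ v ∈ K, gramEntry G t u v = 1 + if u = v then t - 1 else 0 := by
      intro v hv
      by_cases huv : u = v
      · simp [gramEntry, adjMat, huv]
      · simp [gramEntry, adjMat, huv, hK u hu v hv huv]
    rw [Finset.sum_congr rfl this, Finset.sum_add_distrib, Finset.sum_ite_eq, if_pos hu]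
    simp
  rw [Finset.sum_congr rfl this]
  simp
  ring

/-- Stars with five leaves are excluded. -/
theorem not_independent_of_adj (ht : t ≤ 21 / 10) (hQ : ∀ f, 0 ≤ qform G t f) {v : V}
    {I : Finset V} (hI : I.card = 5) (hind : ∀ u ∈ I, ∀ w ∈ I, ¬ G.Adj u w) :
    ¬ ∀ u ∈ I, G.Adj v u := by
  intro hv
  have h := hQ (ind I + (-2 : ℝ) • Pi.single v 1)
  rw [qform_add_smul, qform_single, bform_comm, bform_single_ind, ← bform_self, bform_ind_ind] at h
  have e1 : ∑ u ∈ I, ∑ w ∈ I, gramEntry G t u w = 5 * t := by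
    have : ∀ u ∈ I, ∑ w ∈ I, gramEntry G t u w = t := by
      intro u hu
      rw [Finset.sum_eq_single_of_mem u hu]
      · simp [gramEntry, adjMat]
      · intro w hw hwu
        simp [gramEntry, adjMat, hwu.symm, hind u hu w hw]
    rw [Finset.sum_congr rfl this]
    simp [hI]
  have e2 : ∑ u ∈ I, gramEntry G t v u = 5 := by
    have : ∀ u ∈ I, gramEntry G t v u = 1 := by
      intro u hu
      simp [gramEntry, adjMat, hv u hu, (hv u hu).ne]
    rw [Finset.sum_congr rfl this]
    simp [hI]
  rw [e1, e2] at h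
  linarith

/-- A vertex outside a clique has at most four neighbours or at most four non-neighbours in it. -/
theorem card_adj_or_card_not_adj (ht : t ≤ 21 / 10) (hQ : ∀ f, 0 ≤ qform G t f) {K : Finset V}
    (hK : ∀ u ∈ K, ∀ v ∈ K, u ≠ v → G.Adj u v) {v : V} (hv : v ∉ K) :
    (K.filter (G.Adj v)).card ≤ 4 ∨ (K.filter fun u => ¬ G.Adj v u).card ≤ 4 := by
  by_contra! hh
  obtain ⟨A, hA, hA5⟩ := Finset.exists_subset_card_eq (n := 5) hh.1
  obtain ⟨B, hB, hB5⟩ := Finset.exists_subset_card_eq (n := 5) hh.2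
  have hA' : ∀ u ∈ A, u ∈ K ∧ G.Adj v u := fun u hu => Finset.mem_filter.1 (hA hu)
  have hB' : ∀ u ∈ B, u ∈ K ∧ ¬ G.Adj v u := fun u hu => Finset.mem_filter.1 (hB hu)
  have h := hQ (Pi.single v 1 + (-1 / 2 : ℝ) • (ind A + (-1 : ℝ) • ind B))
  rw [qform_add_smul, qform_single, qform_add_smul, bform_ind_ind,
    qform_ind_clique fun u hu w hw => hK u (hA' u hu).1 w (hA' w hw).1,
    qform_ind_clique fun u hu w hw => hK u (hB' u hu).1 w (hB' w hw).1,
    bform_comm, bform_add_left, bform_smul_left, bform_comm, bform_single_ind, bform_comm,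
    bform_single_ind] at h
  have e1 : ∑ u ∈ A, gramEntry G t v u = 5 := by
    have : ∀ u ∈ A, gramEntry G t v u = 1 := by
      intro u hu
      have := (hA' u hu).2
      simp [gramEntry, adjMat, this, this.ne]
    rw [Finset.sum_congr rfl this]
    simp [hA5]
  have e2 : ∑ u ∈ B, gramEntry G t v u = 0 := by
    refine Finset.sum_eq_zero fun u hu => ?_
    have hvu : v ≠ u := fun h => hv (h ▸ (hB' u hu).1)
    simp [gramEntry, adjMat, (hB' u hu).2, hvu]
  have e3 : ∑ u ∈ A, ∑ w ∈ B, gramEntry G t u w = 25 := by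
    have : ∀ u ∈ A, ∑ w ∈ B, gramEntry G t u w = 5 := by
      intro u hu
      have : ∀ w ∈ B, gramEntry G t u w = 1 := by
        intro w hw
        have huw : u ≠ w := by
          rintro rfl
          exact (hB' u hw).2 (hA' u hu).2
        simp [gramEntry, adjMat, huw, hK u (hA' u hu).1 w (hB' w hw).1 huw]
      rw [Finset.sum_congr rfl this]
      simp [hB5]
    rw [Finset.sum_congr rfl this]
    simp [hA5]
    norm_num
  rw [e1, e2, e3, hA5, hB5] at h
  norm_num at h
  linarith

theorem abs_sum_gramEntry_sub_le (ht2 : 2 ≤ t) (ht : t ≤ 21 / 10) (hQ : ∀ f, 0 ≤ qform G t f)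
    {K : Finset V} (hK : ∀ u ∈ K, ∀ v ∈ K, u ≠ v → G.Adj u v) (v : V) :
    |∑ u ∈ K, gramEntry G t v u - K.card * (if v ∈ cliqueHull G K then 1 else 0)| ≤ 4 := by
  by_cases hv : v ∈ K
  · rw [if_pos (mem_cliqueHull hK hv)]
    have : ∀ u ∈ K, gramEntry G t v u = 1 + if v = u then t - 1 else 0 := by
      intro u hu
      by_cases huv : v = u
      · simp [gramEntry, adjMat, huv]
      · simp [gramEntry, adjMat, huv, hK v hv u hu huv]
    rw [Finset.sum_congr rfl this, Finset.sum_add_distrib, Finset.sum_ite_eq, if_pos hv]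
    simp only [Finset.sum_const, nsmul_eq_mul, mul_one]
    rw [abs_le]
    constructor <;> linarith
  · have e : ∑ u ∈ K, gramEntry G t v u = (K.filter (G.Adj v)).card := by
      have : ∀ u ∈ K, gramEntry G t v u = if G.Adj v u then 1 else 0 := by
        intro u hu
        have huv : v ≠ u := fun h => hv (h ▸ hu)
        simp [gramEntry, adjMat, huv]
      rw [Finset.sum_congr rfl this, Finset.sum_boole]
    have hc := Finset.card_filter_add_card_filter_not (s := K) (p := G.Adj v)
    rw [e, abs_le]
    by_cases hh : (K.filter fun u => ¬ G.Adj v u).card ≤ 4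
    · rw [if_pos (show v ∈ cliqueHull G K from hh), ← hc]
      have : ((K.filter fun u => ¬ G.Adj v u).card : ℝ) ≤ 4 := by exact_mod_cast hh
      push_cast
      constructor
      · linarith
      · have : (0 : ℝ) ≤ ((K.filter fun u => ¬ G.Adj v u).card : ℝ) := Nat.cast_nonneg _
        linarith
    · rw [if_neg (show v ∉ cliqueHull G K from hh)]
      have h4 := (card_adj_or_card_not_adj ht hQ hK hv).resolve_right hh
      have : ((K.filter (G.Adj v)).card : ℝ) ≤ 4 := by exact_mod_cast h4
      have : (0 : ℝ) ≤ (K.filter (G.Adj v)).card := Nat.cast_nonneg _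
      constructor <;> linarith

end Clique

/-- The graph obtained by adding a vertex adjacent to exactly the vertices of `S`. -/
def addApex {V : Type*} (G : SimpleGraph V) (S : Set V) : SimpleGraph (Option V) where
  Adj
    | none, none => False
    | none, some v => v ∈ S
    | some u, none => u ∈ S
    | some u, some v => G.Adj u v
  symm := ⟨by
    rintro (_ | u) (_ | v) h
    · exact h
    · exact h
    · exact h
    · exact SimpleGraph.Adj.symm h⟩
  loopless := ⟨by
    rintro (_ | u) h
    · exact h
    · exact G.loopless.irrefl u h⟩

section AddApex

variable {V : Type*} {G : SimpleGraph V} {S : Set V}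

@[simp] theorem addApex_some_some (u v : V) : (addApex G S).Adj (some u) (some v) ↔ G.Adj u v :=
  Iff.rfl

@[simp] theorem addApex_none_some (v : V) : (addApex G S).Adj none (some v) ↔ v ∈ S :=
  Iff.rfl

theorem addApex_connected (hG : G.Connected) {k : V} (hk : k ∈ S) : (addApex G S).Connected := by
  rw [SimpleGraph.connected_iff_exists_forall_reachable]
  refine ⟨none, ?_⟩
  rintro (_ | v)
  · exact SimpleGraph.Reachable.refl _
  · have h1 : (addApex G S).Adj none (some k) := hk
    exact h1.reachable.trans ((hG.preconnected k v).map (⟨some, fun h => h⟩ : G →g addApex G S))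

theorem qform_addApex [Fintype V] (t : ℝ) {f : Option V → ℝ} (hf : f none = 0) :
    qform (addApex G S) t f = qform G t (fun v => f (some v)) := by
  simp [qform, Fintype.sum_option, hf, adjMat]

end AddApex

/-- The added vertex adjacent to the hull of a large clique is an anchor. -/
theorem anchored_addApex {V : Type*} [Fintype V] {G : SimpleGraph V} {t t' : ℝ} (ht2 : 2 ≤ t)
    (ht : t ≤ 21 / 10) (hQ : ∀ f, 0 ≤ qform G t f) {K : Finset V}
    (hK : ∀ u ∈ K, ∀ v ∈ K, u ≠ v → G.Adj u v) (hK0 : 0 < K.card) {N : ℕ}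
    (hN : 10 * N ≤ (t' - t) * K.card) :
    Anchored (addApex G (cliqueHull G K)) t' 1 N none {v | v ≠ none} := by
  refine anchored_of_forall_qform fun T hT f hfT hf => ?_
  have hf0 : f none = 0 := hf none (by simp)
  set y : V → ℝ := fun v => f (some v) with hy
  rw [qform_addApex t' hf0, one_mul]
  have hσ : ∑ v, f v * adjMat (addApex G (cliqueHull G K)) none v =
      ∑ v, y v * if v ∈ cliqueHull G K then 1 else 0 := by
    rw [Fintype.sum_option, hf0, zero_mul, zero_add]
    simp [adjMat, hy]
  rw [hσ]
  set σ := ∑ v, y v * (if v ∈ cliqueHull G K then (1 : ℝ) else 0) with hσ'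
  set s := ∑ v, |y v| with hs
  set m : ℝ := (K.card : ℝ) with hm
  have hm0 : 0 < m := Nat.cast_pos.2 hK0
  have hσs : |σ| ≤ s := by
    refine (Finset.abs_sum_le_sum_abs _ _).trans (Finset.sum_le_sum fun v _ => ?_)
    split_ifs <;> simp
  have hb : |bform G t y (ind K) - m * σ| ≤ 4 * s := by
    rw [bform_ind_right, hσ', hs, Finset.mul_sum, Finset.mul_sum, ← Finset.sum_sub_distrib]
    refine (Finset.abs_sum_le_sum_abs _ _).trans (Finset.sum_le_sum fun v _ => ?_)
    have := abs_sum_gramEntry_sub_le ht2 ht hQ hK v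
    rw [show y v * ∑ u ∈ K, gramEntry G t v u - m * (y v * if v ∈ cliqueHull G K then 1 else 0) =
      (∑ u ∈ K, gramEntry G t v u - m * (if v ∈ cliqueHull G K then 1 else 0)) * y v by ring,
      abs_mul]
    exact mul_le_mul_of_nonneg_right this (abs_nonneg _)
  have hY : s ^ 2 ≤ N * ∑ v, y v ^ 2 := by
    have e1 : s = ∑ v ∈ T, |f v| := by
      rw [Finset.sum_subset (Finset.subset_univ T) fun v _ hv => by simp [hfT v hv],
        Fintype.sum_option, hf0, abs_zero, zero_add]
    have e2 : ∑ v, y v ^ 2 = ∑ v ∈ T, |f v| ^ 2 := by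
      rw [Finset.sum_subset (Finset.subset_univ T) fun v _ hv => by simp [hfT v hv],
        Fintype.sum_option, hf0]
      simp [hy]
    rw [e1, e2]
    refine (sq_sum_le_card_mul_sum_sq).trans (mul_le_mul_of_nonneg_right ?_ ?_)
    · exact_mod_cast hT
    · exact Finset.sum_nonneg fun _ _ => sq_nonneg _
  have h := hQ (y + (-σ / m) • ind K)
  rw [qform_add_smul, qform_ind_clique hK, ← hm] at h
  rw [qform_eq_add G t t']
  set Y := ∑ v, y v ^ 2
  have hY0 : 0 ≤ Y := Finset.sum_nonneg fun _ _ => sq_nonneg _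
  have hs0 : 0 ≤ s := Finset.sum_nonneg fun _ _ => abs_nonneg _
  set b := bform G t y (ind K)
  have h1 : 0 ≤ m * qform G t y - 2 * σ * b + σ ^ 2 * (m + (t - 1)) := by
    have e : m * (qform G t y + 2 * (-σ / m) * b + (-σ / m) ^ 2 * (m ^ 2 + (t - 1) * m)) =
        m * qform G t y - 2 * σ * b + σ ^ 2 * (m + (t - 1)) := by
      field_simp
      ring
    rw [← e]
    exact mul_nonneg hm0.le h
  have h2 : σ * (b - m * σ) ≥ -(4 * s ^ 2) := by
    have : |σ * (b - m * σ)| ≤ s * (4 * s) := by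
      rw [abs_mul]
      exact mul_le_mul hσs hb (abs_nonneg _) hs0
    have := neg_le_of_abs_le this
    nlinarith
  have h3 : σ ^ 2 ≤ s ^ 2 := sq_le_sq' (by linarith [neg_le_of_abs_le hσs]) (le_of_abs_le hσs)
  have h4 : 10 * s ^ 2 ≤ (t' - t) * m * Y := by nlinarith
  have h5 : 0 ≤ m * (qform G t y + (t' - t) * Y - σ ^ 2) := by nlinarith
  linarith [nonneg_of_mul_nonneg_right h5 hm0]

/-- Connected graphs with a vertex of large degree. -/
theorem exists_qform_nonneg_of_lt_degree {t x : ℝ} (ht2 : 2 ≤ t) (hx : 1 < x)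
    (hx6 : x ^ 6 < x ^ 2 + 1) (htx : t < x + 1 / x) :
    ∃ Δ, ∀ (V : Type*) [Fintype V] (G : SimpleGraph V), G.Connected → (∀ f, 0 ≤ qform G t f) →
      (∃ v, Δ ≤ (Finset.univ.filter (G.Adj v)).card) → ∀ f, 0 ≤ qform G 2 f := by
  obtain ⟨L, hL⟩ := exists_anchorSeq_le ht2 hx htx
  have hx1 := le_of_pow_six_lt hx6
  have ht : t ≤ 21 / 10 := by
    have : x + 1 / x ≤ 21 / 10 := by
      rw [← sub_nonneg]
      have : 21 / 10 - (x + 1 / x) = (x / 10 - (x - 1) ^ 2) / x := by field_simp; ring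
      rw [this]
      refine div_nonneg ?_ (by linarith)
      nlinarith
    linarith
  obtain ⟨m, hm⟩ := exists_nat_gt (10 * (9 + L : ℕ) / (x + 1 / x - t))
  have hm0 : 0 < m := by
    have h0 : (0 : ℝ) ≤ 10 * (9 + L : ℕ) / (x + 1 / x - t) :=
      div_nonneg (by positivity) (by linarith)
    exact_mod_cast h0.trans_lt hm
  rw [div_lt_iff₀ (by linarith)] at hm
  obtain ⟨Δ, hΔ⟩ := exists_clique_or_independent 5 m
  refine ⟨Δ, fun V _ G hG hQ ⟨v, hv⟩ => ?_⟩
  rcases hΔ V G _ hv with ⟨K, -, rfl, hK⟩ | ⟨I, hI, hI5, hI'⟩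
  swap
  · exact absurd (fun u hu => (Finset.mem_filter.1 (hI hu)).2)
      (not_independent_of_adj ht hQ hI5 hI')
  obtain ⟨k, hk⟩ := Finset.card_pos.1 hm0
  set H := addApex G (cliqueHull G K) with hH
  have hHc : H.Connected := addApex_connected hG (mem_cliqueHull hK hk)
  have h1 : ∀ u v, H.Adj u v → H.dist none u ≤ H.dist none v + 1 := fun u v huv =>
    dist_le_dist_add_one_of_adj hHc none huv
  have h2 : ∀ v, 0 < H.dist none v → ∃ u, H.Adj u v ∧ H.dist none u + 1 = H.dist none v :=
    fun v hv => exists_adj_dist_add_one hHc hv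
  have hnone : ∀ v, 0 < H.dist none v ↔ v ≠ none := fun v => by
    rw [Nat.pos_iff_ne_zero, Ne, hHc.dist_eq_zero_iff, eq_comm]
  have hx0 : x + 1 / x - 1 / x = x := by ring
  have low : ∀ i ≤ L, ∀ o, H.dist none o = i →
      Anchored H (x + 1 / x) x (9 + L - i) o {v | H.dist none o < H.dist none v} := by
    intro i
    induction i with
    | zero =>
      intro _ o ho
      rw [hHc.dist_eq_zero_iff] at ho
      subst ho
      refine ((anchored_addApex (N := 9 + L) ht2 ht hQ hK hm0 (by linarith)).relax one_pos le_rfl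
        hx.le).mono le_rfl fun v hv => ?_
      simp only [SimpleGraph.dist_self, Set.mem_ofPred_eq] at hv
      exact (hnone v).1 hv
    | succ i ih =>
      intro hi o ho
      obtain ⟨g, hgo, hg⟩ := h2 o (by omega)
      have h3 := ih (by omega) g (by omega)
      rw [show 9 + L - i = 9 + L - (i + 1) + 1 by omega] at h3
      have h4 := h3.move (o := o) (S := {v | H.dist none o < H.dist none v}) (by linarith)
        (by rw [hx0]; linarith) (by simp only [Set.mem_ofPred_eq]; omega) hgo
        (fun v hv => by simp only [Set.mem_ofPred_eq] at hv ⊢; omega) (by simp)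
        (fun v hv hgv => by
          have := h1 v g hgv.symm
          simp only [Set.mem_ofPred_eq] at hv
          omega)
      rwa [hx0] at h4
  have hlevels : AnchoredLevels H (H.dist none) x 0 := by
    refine ⟨hx, hx6, h1, h2, fun u v hu hv => ?_, fun o _ => ?_⟩
    · rw [← hHc.dist_eq_zero_iff.1 hu, hHc.dist_eq_zero_iff.1 hv]
    · rcases le_or_gt (H.dist none o) L with ho | ho
      · exact (low _ ho o rfl).mono (by omega) le_rfl
      · obtain ⟨i, hi⟩ := Nat.exists_eq_add_of_lt ho
        refine (anchored_of_levels (l := 1) ht2 h1 h2 (fun f hf => ?_) (L + i) 9 o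
          (by omega)).relax ?_ htx.le (hL _ (by omega))
        · rw [hH, qform_addApex t (hf none (by simp))]
          exact hQ _
        · linarith [one_le_anchorSeq ht2 (L + i)]
  intro f
  have h3 := hlevels.qform_two_nonneg (f := fun v => v.elim 0 f) fun v hv =>
    ⟨(hnone v).2 (by rintro rfl; exact hv rfl), .inl rfl⟩
  rwa [hH, qform_addApex 2 rfl] at h3

theorem sum_subtype_of_ne_zero {V : Type*} [Fintype V] {p : V → Prop} {F : V → ℝ}
    (hF : ∀ v, F v ≠ 0 → p v) : ∑ v : {v // p v}, F v = ∑ v, F v := by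
  rw [← Fintype.sum_subtype_add_sum_subtype p F,
    Finset.sum_eq_zero (s := (Finset.univ : Finset {v // ¬ p v})), add_zero]
  rintro ⟨v, hv⟩ _
  by_contra h
  exact hv (hF v h)

theorem qform_toSimpleGraph_nonneg {V : Type*} [Fintype V] {G : SimpleGraph V} {t : ℝ}
    (hQ : ∀ f, 0 ≤ qform G t f) (C : G.ConnectedComponent) (f : C → ℝ) :
    0 ≤ qform C.toSimpleGraph t f := by
  set F : V → ℝ := fun v => if h : v ∈ C then f ⟨v, h⟩ else 0 with hF
  have hf : ∀ v : C, f v = F v := fun v => by simp [hF, show (v : V) ∈ C from v.2]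
  have h0 : ∀ v, F v ≠ 0 → v ∈ C := fun v hv => by
    by_contra hh
    exact hv (by simp [hF, hh])
  have e : qform C.toSimpleGraph t f = qform G t F := by
    unfold qform
    congr 1
    · rw [← sum_subtype_of_ne_zero (p := (· ∈ C)) (F := fun u => ∑ v, adjMat G u v * F u * F v)]
      · refine Finset.sum_congr rfl fun u _ => ?_
        rw [← sum_subtype_of_ne_zero (p := (· ∈ C)) (F := fun v => adjMat G u v * F u * F v)]
        · exact Finset.sum_congr rfl fun v _ => by rw [hf u, hf v]; rfl
        · exact fun v hv => h0 v (right_ne_zero_of_mul hv)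
      · intro u hu
        by_contra hh
        refine hu (Finset.sum_eq_zero fun v _ => ?_)
        rw [not_not.1 (mt (h0 u) hh)]
        ring
    · rw [← sum_subtype_of_ne_zero (p := (· ∈ C)) (F := fun u => F u ^ 2)]
      · exact congrArg _ (Finset.sum_congr rfl fun v _ => by rw [hf v])
      · exact fun v hv => h0 v (pow_ne_zero_iff two_ne_zero |>.1 hv)
  rw [e]
  exact hQ F

/-- The smallest eigenvalue is attained on a connected component. -/
theorem exists_component_minEig {V : Type*} [Fintype V] [Nonempty V] (G : SimpleGraph V) :
    ∃ C : G.ConnectedComponent, minEig (adjMat C.toSimpleGraph) = minEig (adjMat G) := by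
  obtain ⟨f, hf, hf'⟩ := isEigenvalue_minEig G
  obtain ⟨w, hw⟩ := Function.ne_iff.mp hf
  set C := G.connectedComponentMk w with hC
  have hwC : w ∈ C := SimpleGraph.ConnectedComponent.connectedComponentMk_mem
  have : Nonempty C := ⟨⟨w, hwC⟩⟩
  refine ⟨C, le_antisymm ?_ ?_⟩
  · refine csInf_le (finite_setOf_isEigenvalue _).bddBelow ⟨fun v => f v, ?_, ?_⟩
    · exact Function.ne_iff.mpr ⟨⟨w, hwC⟩, hw⟩
    · funext u
      have h1 := congrFun hf' u
      simp only [Matrix.mulVec, dotProduct, Pi.smul_apply] at h1 ⊢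
      rw [← h1, ← sum_subtype_of_ne_zero (p := (· ∈ C)) (F := fun v => adjMat G u v * f v)]
      · rfl
      · intro v hv
        have hadj : G.Adj u v := by
          by_contra hh
          simp [adjMat, hh] at hv
        exact (C.mem_supp_congr_adj hadj).1 u.2
  · rw [le_minEig_iff]
    exact qform_toSimpleGraph_nonneg ((le_minEig_iff G _).1 le_rfl) C

/-- Large connected graphs with smallest eigenvalue above the threshold. -/
theorem exists_qform_nonneg {t x ε : ℝ} (ht : 2 ≤ t) (hx : 1 < x) (hx6 : x ^ 6 < x ^ 2 + 1)
    (htx : t < x + 1 / x) (hε : 0 < ε) :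
    ∃ N, ∀ (V : Type*) [Fintype V] (G : SimpleGraph V), G.Connected → (∀ f, 0 ≤ qform G t f) →
      N < Fintype.card V → ∀ f, 0 ≤ qform G (2 + ε) f := by
  obtain ⟨Δ, hΔ⟩ := exists_qform_nonneg_of_lt_degree ht hx hx6 htx
  obtain ⟨N, hN⟩ := exists_qform_nonneg_of_degree_le ht hx hx6 htx hε Δ
  refine ⟨N, fun V _ G hG hQ hV f => ?_⟩
  by_cases h : ∃ v, Δ ≤ (Finset.univ.filter (G.Adj v)).card
  · exact (hΔ V G hG hQ h f).trans (qform_mono (by linarith) f)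
  · push Not at h
    exact hN V G hG hQ (fun v => (h v).le) hV f

/-- Smallest eigenvalues do not accumulate strictly between the threshold and `-2`. -/
theorem exists_le_abs_minEig_add {x lam : ℝ} (hx : 1 < x) (hx6 : x ^ 6 < x ^ 2 + 1)
    (hlam : 2 < lam) (hlx : lam < x + 1 / x) :
    ∃ δ > 0, ∀ (n : ℕ) (G : SimpleGraph (Fin n)), 0 < n → minEig (adjMat G) ≠ -lam →
      δ ≤ |minEig (adjMat G) - (-lam)| := by
  set t := (lam + (x + 1 / x)) / 2 with ht
  obtain ⟨N, hN⟩ := exists_qform_nonneg (t := t) (ε := (lam - 2) / 2) (by linarith) hx hx6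
    (by linarith) (by linarith)
  set F : Set ℝ := (⋃ n ∈ Set.Iic N, Set.range fun G : SimpleGraph (Fin n) => minEig (adjMat G)) \
    {-lam} with hF
  have hFfin : F.Finite :=
    Set.Finite.subset (Set.Finite.biUnion (Set.finite_Iic N) fun n _ => Set.finite_range _)
      Set.sdiff_subset
  obtain ⟨δ, hδ, hball⟩ := Metric.isOpen_iff.1 hFfin.isClosed.isOpen_compl (-lam) (by simp [hF])
  refine ⟨min δ (min (t - lam) ((lam - 2) / 2)),
    lt_min hδ (lt_min (by linarith) (by linarith)), fun n G hn hne => ?_⟩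
  by_contra! hlt
  obtain ⟨h1, h2, h3⟩ := by simpa only [lt_min_iff] using hlt
  have : Nonempty (Fin n) := ⟨⟨0, hn⟩⟩
  obtain ⟨C, hC⟩ := exists_component_minEig G
  have hQ : ∀ f, 0 ≤ qform G t f := by
    have : -t ≤ minEig (adjMat G) := by linarith [neg_lt_of_abs_lt h2]
    simpa using (le_minEig_iff G _).1 this
  have : Nonempty C := C.connected_toSimpleGraph.nonempty
  rcases le_or_gt (Fintype.card C) N with hc | hc
  · have h4 : minEig (adjMat G) ∈ Fᶜ := hball (by rwa [Metric.mem_ball, Real.dist_eq])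
    refine h4 ⟨?_, hne⟩
    simp only [Set.mem_iUnion, Set.mem_range, Set.mem_Iic]
    have : Nonempty (Fin (Fintype.card C)) := (Fintype.equivFin C).symm.nonempty
    exact ⟨_, hc, C.toSimpleGraph.comap (Fintype.equivFin C).symm,
      (minEig_comap_equiv _ _).trans hC⟩
  · have h4 := hN C C.toSimpleGraph C.connected_toSimpleGraph (qform_toSimpleGraph_nonneg hQ C) hc
    rw [show 2 + (lam - 2) / 2 = -(-(2 + (lam - 2) / 2)) by ring] at h4
    have h5 := (le_minEig_iff C.toSimpleGraph _).2 h4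
    rw [hC] at h5
    linarith [lt_of_abs_lt h3]

/-- The graph obtained from `G` and `H` by joining the vertex `o` of `G` to all vertices of `H`. -/
def attach {V W : Type*} (G : SimpleGraph V) (o : V) (H : SimpleGraph W) :
    SimpleGraph (V ⊕ W) where
  Adj
    | .inl u, .inl v => G.Adj u v
    | .inl u, .inr _ => u = o
    | .inr _, .inl v => v = o
    | .inr u, .inr v => H.Adj u v
  symm := ⟨by
    rintro (u | u) (v | v) h
    · exact SimpleGraph.Adj.symm h
    · exact h
    · exact h
    · exact SimpleGraph.Adj.symm h⟩
  loopless := ⟨by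
    rintro (u | u) h
    · exact G.loopless.irrefl u h
    · exact H.loopless.irrefl u h⟩

theorem qform_attach {V W : Type*} [Fintype V] [Fintype W] (G : SimpleGraph V) (o : V)
    (H : SimpleGraph W) (t : ℝ) (f : V ⊕ W → ℝ) :
    qform (attach G o H) t f = qform G t (fun v => f (.inl v)) + qform H t (fun w => f (.inr w)) +
      2 * f (.inl o) * ∑ w, f (.inr w) := by
  have e1 : ∀ u v, adjMat (attach G o H) (.inl u) (.inl v) = adjMat G u v := fun _ _ => rfl
  have e2 : ∀ u v, adjMat (attach G o H) (.inr u) (.inr v) = adjMat H u v := fun _ _ => rfl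
  have e3 : ∀ u v, adjMat (attach G o H) (.inl u) (.inr v) = if u = o then 1 else 0 :=
    fun _ _ => rfl
  have e4 : ∀ u v, adjMat (attach G o H) (.inr u) (.inl v) = if v = o then 1 else 0 :=
    fun _ _ => rfl
  simp only [qform, Fintype.sum_sum_type, e1, e2, e3, e4, ite_mul, one_mul, zero_mul,
    Finset.sum_add_distrib, Finset.sum_ite_eq', Finset.mem_univ, if_true]
  rw [Finset.sum_comm (f := fun u w => if u = o then f (.inl u) * f (.inr w) else 0)]
  simp only [Finset.sum_ite_eq', Finset.mem_univ, if_true, ← Finset.mul_sum, ← Finset.sum_mul]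
  ring

/-- There is a rooted graph for which the form of `A + t I` is positive definite, is at least `r`
times the square of the value at the root, with equality for a function of value one at the root
and square norm at least `n`. -/
def HasRooted (t r n : ℝ) : Prop :=
  ∃ (V : Type) (_ : Fintype V) (G : SimpleGraph V) (o : V), (∀ f, qform G t f = 0 → f = 0) ∧
    (∀ f, r * f o ^ 2 ≤ qform G t f) ∧ ∃ y : V → ℝ, y o = 1 ∧ qform G t y = r ∧ n ≤ ∑ v, y v ^ 2

namespace HasRooted

variable {t r n : ℝ}

theorem mono (h : HasRooted t r n) {n' : ℝ} (hn : n' ≤ n) : HasRooted t r n' := by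
  obtain ⟨V, _, G, o, h1, h2, y, h3, h4, h5⟩ := h
  exact ⟨V, _, G, o, h1, h2, y, h3, h4, hn.trans h5⟩

theorem single (ht : 0 < t) : HasRooted t t 1 := by
  have e : ∀ f : Unit → ℝ, qform (⊥ : SimpleGraph Unit) t f = t * f () ^ 2 := fun f => by
    simp [qform, adjMat]
  refine ⟨Unit, inferInstance, ⊥, (), fun f hf => ?_, fun f => (e f).ge, 1, rfl, ?_, by simp⟩
  · rw [e] at hf
    funext u
    simpa [ht.ne'] using hf
  · rw [e]; simp

/-- Attaching a graph `H` to the root, with the new root given by `ρ`. -/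
theorem attach (h : HasRooted t r n) {W : Type} [Fintype W] (H : SimpleGraph W) (ρ : Option W)
    {r' : ℝ} {y : Option W → ℝ}
    (hF : ∀ f : Option W → ℝ, r' * f ρ ^ 2 ≤
      r * f none ^ 2 + qform H t (fun w => f (some w)) + 2 * f none * ∑ w, f (some w))
    (hF0 : ∀ f : Option W → ℝ,
      r * f none ^ 2 + qform H t (fun w => f (some w)) + 2 * f none * ∑ w, f (some w) = 0 → f = 0)
    (hr' : 0 ≤ r') (hyρ : y ρ = 1)
    (hy : r * y none ^ 2 + qform H t (fun w => y (some w)) + 2 * y none * ∑ w, y (some w) = r') :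
    HasRooted t r' (y none ^ 2 * n + ∑ w, y (some w) ^ 2) := by
  obtain ⟨V, _, G, o, h1, h2, z, h3, h4, h5⟩ := h
  let e : (V ⊕ W → ℝ) → Option W → ℝ := fun f a => a.elim (f (.inl o)) fun w => f (.inr w)
  have hr (f : V ⊕ W → ℝ) : f (ρ.elim (.inl o) .inr) = e f ρ := by cases ρ <;> rfl
  refine ⟨V ⊕ W, inferInstance, _root_.attach G o H, ρ.elim (.inl o) .inr, fun f hf => ?_,
    fun f => ?_, Sum.elim (y none • z) fun w => y (some w), ?_, ?_, ?_⟩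
  · rw [qform_attach] at hf
    have a1 := hF (e f)
    have a2 := h2 fun v => f (.inl v)
    have a3 : 0 ≤ r' * e f ρ ^ 2 := by positivity
    have a4 : e f = 0 := hF0 (e f) (by simp only [e, Option.elim] at a1 a3 ⊢; linarith)
    have a5 : ∀ w, f (.inr w) = 0 := fun w => congrFun a4 (some w)
    have a6 : f (.inl o) = 0 := congrFun a4 none
    have a7 : qform H t (fun w => f (.inr w)) = 0 := by simp [a5, qform]
    rw [a6, a7] at hf
    have a8 := h1 (fun v => f (.inl v)) (by linarith)
    funext v
    rcases v with v | w
    exacts [congrFun a8 v, a5 w]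
  · rw [hr f, qform_attach]
    have a1 := hF (e f)
    have a2 := h2 fun v => f (.inl v)
    simp only [e, Option.elim] at a1 ⊢
    linarith
  · rw [hr (Sum.elim (y none • z) fun w => y (some w))]
    simp only [e, Sum.elim_inl, Sum.elim_inr, Pi.smul_apply, h3, smul_eq_mul, mul_one]
    rw [← hyρ]
    cases ρ <;> rfl
  · rw [qform_attach]
    have : qform G t (y none • z) = y none ^ 2 * r := by
      rw [← bform_self, bform_smul_left, bform_comm, bform_smul_left, bform_self, h4]
      ring
    simp only [Sum.elim_inl, Sum.elim_inr, Pi.smul_apply, h3, smul_eq_mul, mul_one]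
    rw [show (fun v => y none * z v) = y none • z from rfl, this]
    linarith
  · rw [Fintype.sum_sum_type]
    simp only [Sum.elim_inl, Sum.elim_inr, Pi.smul_apply, smul_eq_mul, mul_pow, ← Finset.mul_sum]
    gcongr

/-- Attaching a pendant vertex to the root. -/
theorem pendant (h : HasRooted t r n) (ht : 0 < t) (hr : 1 / t < r) :
    HasRooted t (r - 1 / t) n := by
  have e : ∀ f : Unit → ℝ, qform (⊥ : SimpleGraph Unit) t f = t * f () ^ 2 := fun f => by
    simp [qform, adjMat]
  have key : ∀ f : Option Unit → ℝ, r * f none ^ 2 + qform (⊥ : SimpleGraph Unit) t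
      (fun w => f (some w)) + 2 * f none * ∑ w, f (some w) =
      (r - 1 / t) * f none ^ 2 + t * (f (some ()) + f none / t) ^ 2 := fun f => by
    rw [e]
    simp only [Finset.univ_unique, Finset.sum_singleton, PUnit.default_eq_unit]
    field_simp
    ring
  have := h.attach (⊥ : SimpleGraph Unit) none (r' := r - 1 / t)
    (y := fun w => w.elim 1 fun _ => -(1 / t)) (fun f => ?_) (fun f hf => ?_) (by linarith) rfl ?_
  · refine this.mono ?_
    simp only [Option.elim]
    have : 0 ≤ ∑ w : Unit, (-(1 / t)) ^ 2 := Finset.sum_nonneg fun _ _ => sq_nonneg _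
    linarith
  · rw [key]
    have : 0 ≤ t * (f (some ()) + f none / t) ^ 2 := by positivity
    linarith
  · rw [key] at hf
    have a1 : 0 ≤ t * (f (some ()) + f none / t) ^ 2 := by positivity
    have a2 : 0 ≤ (r - 1 / t) * f none ^ 2 := mul_nonneg (by linarith) (sq_nonneg _)
    have a3 : (r - 1 / t) * f none ^ 2 = 0 := by linarith
    have a4 : f none = 0 := by
      rcases mul_eq_zero.1 a3 with h | h
      · linarith
      · simpa using h
    rw [a4] at hf
    have a5 : f (some ()) = 0 := by simpa [ht.ne'] using hf
    funext w
    rcases w with _ | w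
    exacts [a4, a5]
  · rw [key fun w => w.elim 1 fun _ => -(1 / t)]
    simp only [Option.elim]
    ring

/-- Completing the root to a clique with `k + 2` vertices and moving the root to another vertex of
the clique. -/
theorem clique (h : HasRooted t r n) (k : ℕ) {D : ℝ} (ht : 1 < t) (hr : 0 < r)
    (hD : D = r * (t - 1) - (1 - r) * k) (hD0 : 0 < D)
    (hr' : 0 < (t - 1) * (D - (1 - r)) / D) :
    HasRooted t ((t - 1) * (D - (1 - r)) / D) (((t - 1) / D) ^ 2 * n + 1) := by
  set a := t - 1 with ha
  set p := 1 - r with hp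
  set r' := a * (D - p) / D with hr'def
  have ha0 : 0 < a := by linarith
  have e : ∀ g : Fin (k + 1) → ℝ, qform (⊤ : SimpleGraph (Fin (k + 1))) t g =
      a * ∑ i, g i ^ 2 + (∑ i, g i) ^ 2 := fun g => by
    have : ∀ u v, adjMat (⊤ : SimpleGraph (Fin (k + 1))) u v * g u * g v =
        g u * g v - if u = v then g u ^ 2 else 0 := fun u v => by
      by_cases huv : u = v
      · simp [adjMat, huv, pow_two]
      · simp [adjMat, huv]
    simp only [qform, this, Finset.sum_sub_distrib, Finset.sum_ite_eq, Finset.mem_univ, if_true,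
      pow_two (∑ i, g i), Finset.sum_mul_sum]
    rw [ha]
    ring
  have key : ∀ f : Option (Fin (k + 1)) → ℝ, r * f none ^ 2 +
      qform (⊤ : SimpleGraph (Fin (k + 1))) t (fun w => f (some w)) + 2 * f none * ∑ w, f (some w) =
      r' * f (some 0) ^ 2 + r * (f none + (∑ w, f (some w)) / r) ^ 2 +
      (a * ∑ i : Fin k, (f (some i.succ) - p / D * f (some 0)) ^ 2 -
        p / r * (∑ i : Fin k, (f (some i.succ) - p / D * f (some 0))) ^ 2) := fun f => by
    rw [e]
    simp only [Fin.sum_univ_succ, Finset.sum_sub_distrib, sub_sq, Finset.sum_add_distrib,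
      Finset.sum_const, Finset.card_univ, Fintype.card_fin, nsmul_eq_mul, ← Finset.sum_mul,
      ← Finset.mul_sum]
    generalize ∑ i : Fin k, f (some i.succ) = s
    generalize ∑ i : Fin k, f (some i.succ) ^ 2 = T
    generalize f none = z
    generalize f (some 0) = u
    have hq : r' = a * (1 - p / D) := by rw [hr'def]; field_simp
    have hk : a * (p / D) * r = p * (1 + k * (p / D)) := by
      field_simp
      rw [hD]
      ring
    rw [hq]
    generalize p / D = q at hk ⊢
    rw [hp] at hk ⊢
    field_simp
    linear_combination (u ^ 2 * (1 - k * q) + 2 * u * s) * hk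
  have rest : ∀ f : Option (Fin (k + 1)) → ℝ,
      min a (D / r) * ∑ i : Fin k, (f (some i.succ) - p / D * f (some 0)) ^ 2 ≤
      a * ∑ i : Fin k, (f (some i.succ) - p / D * f (some 0)) ^ 2 -
        p / r * (∑ i : Fin k, (f (some i.succ) - p / D * f (some 0))) ^ 2 := fun f => by
    have hcs := sq_sum_le_card_mul_sum_sq (s := (Finset.univ : Finset (Fin k)))
      (f := fun i => f (some i.succ) - p / D * f (some 0))
    rw [Finset.card_univ, Fintype.card_fin] at hcs
    set E := ∑ i : Fin k, (f (some i.succ) - p / D * f (some 0)) ^ 2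
    set s := ∑ i : Fin k, (f (some i.succ) - p / D * f (some 0))
    have hE : 0 ≤ E := Finset.sum_nonneg fun _ _ => sq_nonneg _
    rcases le_total 0 p with hp0 | hp0
    · have h1 : min a (D / r) * E ≤ D / r * E := mul_le_mul_of_nonneg_right (min_le_right _ _) hE
      have h2 : p / r * s ^ 2 ≤ p / r * (k * E) := mul_le_mul_of_nonneg_left hcs (by positivity)
      have h3 : D / r * E = a * E - p / r * (k * E) := by
        rw [hD]
        field_simp
      linarith
    · have h1 : min a (D / r) * E ≤ a * E := mul_le_mul_of_nonneg_right (min_le_left _ _) hE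
      have h2 : p / r * s ^ 2 ≤ 0 :=
        mul_nonpos_of_nonpos_of_nonneg (div_nonpos_of_nonpos_of_nonneg hp0 hr.le) (sq_nonneg _)
      linarith
  have hm : 0 < min a (D / r) := lt_min ha0 (by positivity)
  have := h.attach (⊤ : SimpleGraph (Fin (k + 1))) (some 0) (r' := r')
    (y := fun w => w.elim (-(a / D)) (Fin.cons 1 fun _ => p / D)) (fun f => ?_) (fun f hf => ?_)
    hr'.le rfl ?_
  · refine this.mono ?_
    simp only [Option.elim, Fin.sum_univ_succ, Fin.cons_zero, Fin.cons_succ]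
    have : 0 ≤ ∑ w : Fin k, (p / D) ^ 2 := Finset.sum_nonneg fun _ _ => sq_nonneg _
    rw [neg_sq]
    linarith
  · rw [key]
    have a1 := rest f
    have a2 : 0 ≤ min a (D / r) * ∑ i : Fin k, (f (some i.succ) - p / D * f (some 0)) ^ 2 :=
      mul_nonneg hm.le (Finset.sum_nonneg fun _ _ => sq_nonneg _)
    have a3 : 0 ≤ r * (f none + (∑ w, f (some w)) / r) ^ 2 := by positivity
    linarith
  · rw [key] at hf
    have a1 := rest f
    have a2 : 0 ≤ ∑ i : Fin k, (f (some i.succ) - p / D * f (some 0)) ^ 2 :=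
      Finset.sum_nonneg fun _ _ => sq_nonneg _
    have a2' := mul_nonneg hm.le a2
    have a3 : 0 ≤ r * (f none + (∑ w, f (some w)) / r) ^ 2 := by positivity
    have a4 : 0 ≤ r' * f (some 0) ^ 2 := by positivity
    have b1 : f (some 0) = 0 := by
      have : r' * f (some 0) ^ 2 = 0 := by linarith
      simpa [hr'.ne'] using this
    have b2 : ∑ i : Fin k, (f (some i.succ) - p / D * f (some 0)) ^ 2 = 0 := by
      have : min a (D / r) * ∑ i : Fin k, (f (some i.succ) - p / D * f (some 0)) ^ 2 = 0 := by
        linarith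
      exact (mul_eq_zero.1 this).resolve_left hm.ne'
    rw [Finset.sum_eq_zero_iff_of_nonneg fun _ _ => sq_nonneg _] at b2
    have b3 : ∀ i : Fin k, f (some i.succ) = 0 := fun i => by
      have := b2 i (Finset.mem_univ i)
      simpa [b1] using this
    have b4 : f none = 0 := by
      have : r * (f none + (∑ w, f (some w)) / r) ^ 2 = 0 := by linarith
      rw [Fin.sum_univ_succ, b1, Finset.sum_eq_zero fun i _ => b3 i] at this
      simpa [hr.ne'] using this
    funext w
    rcases w with _ | w
    · exact b4
    · refine Fin.cases b1 b3 w
  · rw [key fun w => w.elim (-(a / D)) (Fin.cons 1 fun _ => p / D)]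
    simp only [Option.elim, Fin.sum_univ_succ, Fin.cons_zero, Fin.cons_succ, mul_one, sub_self]
    simp only [Finset.sum_const, Finset.card_univ, Fintype.card_fin, nsmul_eq_mul]
    have : -(a / D) + (1 + k * (p / D)) / r = 0 := by
      field_simp
      rw [hD]
      ring
    rw [this]
    ring

end HasRooted

namespace HasRooted

variable {t r n x : ℝ}

/-- Attaching a vertex to the root and moving the root to the new vertex. -/
theorem extend (h : HasRooted t r n) (ht : 1 < t) (hr : 0 < r) (hr' : 0 < t - 1 / r) :
    HasRooted t (t - 1 / r) ((1 / r) ^ 2 * n + 1) := by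
  have ha : 0 < t - 1 := by linarith
  have e : (t - 1) * (r * (t - 1) - (1 - r)) / (r * (t - 1)) = t - 1 / r := by
    field_simp
    ring
  have := h.clique 0 (D := r * (t - 1)) ht hr (by push_cast; ring) (by positivity) (by rwa [e])
  rw [e] at this
  convert this using 3
  field_simp

theorem exists_lt_one_of_pendant (hx : 1 < x) (ht : 1 < t) (htx : 1 / t ≤ 1 - 1 / x)
    (h : HasRooted t r n) (hr : 1 / x ≤ r) : ∃ r', 1 / x ≤ r' ∧ r' < 1 ∧ HasRooted t r' n := by
  have ht0 : 0 < 1 / t := by positivity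
  have hx0 : 0 < 1 / x := by positivity
  obtain ⟨d, hd⟩ : ∃ d : ℕ, r < 1 + d * (1 / t) := by
    obtain ⟨d, hd⟩ := exists_nat_gt ((r - 1) / (1 / t))
    rw [div_lt_iff₀ ht0] at hd
    exact ⟨d, by linarith⟩
  induction d generalizing r with
  | zero => exact ⟨r, hr, by simpa using hd, h⟩
  | succ d ih =>
    by_cases h1 : r < 1
    · exact ⟨r, hr, h1, h⟩
    · push Not at h1
      push_cast at hd
      exact ih (h.pendant (by linarith) (by linarith)) (by linarith) (by linarith)

theorem exists_clique_size {a : ℝ} (hx : 1 < x) (hxa : x * a = x ^ 2 - x + 1) (ha1 : 1 < a)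
    (haa : a * (a - 1) ≤ x - 1) (hr : 1 / x ≤ r) (hr1 : r < 1) :
    ∃ (k : ℕ) (D : ℝ), 0 < D ∧ D = r * a - (1 - r) * k ∧ 1 / x ≤ a * (D - (1 - r)) / D ∧
      a * (D - (1 - r)) / D < 1 := by
  have hx0 : 0 < 1 / x := by positivity
  have hr0 : 0 < r := by linarith
  have hex : ∃ k : ℕ, (a ^ 2 + k * (a - 1)) * (r * a - (1 - r) * k) < a ^ 2 := by
    obtain ⟨k, hk⟩ := exists_nat_gt (r * a / (1 - r))
    rw [div_lt_iff₀ (by linarith)] at hk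
    refine ⟨k, lt_of_le_of_lt (mul_nonpos_of_nonneg_of_nonpos ?_ (by linarith)) (by positivity)⟩
    have : 0 ≤ (k : ℝ) * (a - 1) := mul_nonneg k.cast_nonneg (by linarith)
    positivity
  obtain ⟨k, hk, hmin⟩ : ∃ k : ℕ, (a ^ 2 + k * (a - 1)) * (r * a - (1 - r) * k) < a ^ 2 ∧
      ∀ j < k, a ^ 2 ≤ (a ^ 2 + j * (a - 1)) * (r * a - (1 - r) * j) :=
    ⟨Nat.find hex, Nat.find_spec hex, fun j hj => not_lt.1 (Nat.find_min hex hj)⟩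
  obtain ⟨D, hD⟩ : ∃ D, D = r * a - (1 - r) * k := ⟨_, rfl⟩
  have hk0 : (0 : ℝ) ≤ k := k.cast_nonneg
  have hlow : a ^ 2 ≤ D * (x * a + (x - 1) * k) := by
    rcases k with _ | j
    · push_cast at hD ⊢
      have : 1 ≤ r * x := by rwa [div_le_iff₀ (by linarith)] at hr
      rw [hD]
      nlinarith [mul_le_mul_of_nonneg_left this (sq_nonneg a)]
    · have hT := hmin j (Nat.lt_succ_self j)
      have hj0 : (0 : ℝ) ≤ j := j.cast_nonneg
      push_cast at hD ⊢
      set M := a ^ 2 + (j : ℝ) * (a - 1) with hM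
      have hM0 : 0 < M := by
        have : 0 ≤ (j : ℝ) * (a - 1) := mul_nonneg hj0 (by linarith)
        positivity
      have hDM : a ≤ D * M := by
        have : (a + j) * a ≤ (a + j) * (D * M) := by
          have e1 : (a + j) * (D * M) =
              (a + j + 1) * (M * (r * a - (1 - r) * j)) - a * M := by
            rw [hD]; ring
          have e2 : (a + j + 1) * a ^ 2 - a * M = (a + j) * a := by rw [hM]; ring
          have := mul_le_mul_of_nonneg_left hT (by linarith : 0 ≤ a + j + 1)
          linarith
        exact le_of_mul_le_mul_left this (by linarith)
      have hD0 : 0 < D := by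
        by_contra hc
        have := mul_nonneg (by linarith : 0 ≤ -D) hM0.le
        linarith
      have hN : a * M ≤ x * a + (x - 1) * (j + 1) := by
        rw [hM]
        nlinarith [mul_le_mul_of_nonneg_left haa hj0,
          mul_le_mul_of_nonneg_left haa (by linarith : 0 ≤ a)]
      nlinarith [mul_le_mul_of_nonneg_left hN hD0.le]
  have hN0 : 0 < x * a + (x - 1) * k := by
    have : 0 ≤ (x - 1) * k := mul_nonneg (by linarith) hk0
    have : 0 < x * a := by positivity
    linarith
  have hD0 : 0 < D := by
    by_contra hc
    have := mul_nonneg (by linarith : 0 ≤ -D) hN0.le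
    nlinarith
  have hak : 0 < a + k := by linarith
  have e1 : (a + k) * (D - (1 - r)) = D * (a + k + 1) - a := by
    rw [hD]; ring
  have hl : 1 / x ≤ a * (D - (1 - r)) / D := by
    rw [div_le_div_iff₀ (by linarith) hD0, one_mul]
    refine le_of_mul_le_mul_left (a := a + k) ?_ hak
    have e2 : (a + k) * (a * (D - (1 - r)) * x) = (x * a) * (D * (a + k + 1) - a) := by
      rw [← e1]; ring
    have e3 : (x * a) * (a + k + 1) - (a + k) = x * (x * a + (x - 1) * k) := by
      linear_combination (a + k) * hxa
    nlinarith [mul_le_mul_of_nonneg_left hlow (by linarith : 0 ≤ x)]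
  have hu : a * (D - (1 - r)) / D < 1 := by
    rw [div_lt_one hD0]
    refine lt_of_mul_lt_mul_left (a := a + k) ?_ hak.le
    rw [← hD] at hk
    nlinarith
  exact ⟨k, D, hD0, hD, hl, hu⟩

theorem exists_lt_one_of_clique (hx : 1 < x) (ht : t = x + 1 / x)
    (hx3 : x ^ 3 + 2 * x ≤ 3 * x ^ 2 + 1)
    (h : HasRooted t r n) (hn : 0 ≤ n) (hr : 1 / x ≤ r) (hr1 : r < 1) :
    ∃ r', 1 / x ≤ r' ∧ r' < 1 ∧ HasRooted t r' (n + 1) := by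
  obtain ⟨a, ha⟩ : ∃ a, a = t - 1 := ⟨_, rfl⟩
  have hx0 : 0 < 1 / x := by positivity
  have hxa : x * a = x ^ 2 - x + 1 := by
    rw [ha, ht]
    field_simp
    ring
  have ha1 : 1 < a := by
    by_contra hc
    nlinarith
  have haa : a * (a - 1) ≤ x - 1 := by
    have : x ^ 2 * (a * (a - 1)) ≤ x ^ 2 * (x - 1) := by
      calc _ = (x * a) * (x * a - x) := by ring
        _ = (x - 1) * ((x ^ 2 - x + 1) * (x - 1)) := by rw [hxa]; ring
        _ ≤ (x - 1) * x ^ 2 := mul_le_mul_of_nonneg_left (by nlinarith) (by linarith)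
        _ = _ := by ring
    exact le_of_mul_le_mul_left this (by positivity)
  obtain ⟨k, D, hD0, hD, hl, hu⟩ := exists_clique_size hx hxa ha1 haa hr hr1
  refine ⟨_, hl, hu, ?_⟩
  rw [ha] at hD hl ⊢
  refine (h.clique k (by linarith) (by linarith) hD hD0 (by linarith)).mono ?_
  have hDa : D ≤ t - 1 := by
    have h1 := mul_nonneg (by linarith : 0 ≤ 1 - r) k.cast_nonneg (α := ℝ)
    have h2 := mul_le_mul_of_nonneg_right hr1.le (by linarith : 0 ≤ t - 1)
    linarith
  have h1 : 1 ≤ (t - 1) / D := by rwa [one_le_div₀ hD0]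
  have h2 : 1 ≤ ((t - 1) / D) ^ 2 := one_le_pow₀ h1
  linarith [mul_le_mul_of_nonneg_right h2 hn]

theorem exists_start_of_le (hx : 1 < x) (ht : t = x + 1 / x) (hx6 : x ^ 2 + 1 ≤ x ^ 6)
    (ht1 : t ≤ 104 / 50) : ∃ r, 1 / x ≤ r ∧ r < 1 ∧ HasRooted t r 1 := by
  have hx0 : 0 < x := by linarith
  have hx0' : 0 < 1 / x := by positivity
  have htx : x * t = x ^ 2 + 1 := by rw [ht]; field_simp
  have ht2 : 2 < t := by nlinarith
  have ht0 : 0 < t := by linarith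
  have htt : 0 < t ^ 2 - 1 := by nlinarith
  have e1 : t - 1 / t = (t ^ 2 - 1) / t := by field_simp
  have hr1 : 0 < t - 1 / t := by rw [e1]; positivity
  have h1 := (single ht0).extend (by linarith) ht0 hr1
  have hlow : 1 / x ≤ t - 1 / (t - 1 / t) - 1 / t := by
    have e2 : t - 1 / (t - 1 / t) - 1 / t = t - (2 * t ^ 2 - 1) / (t * (t ^ 2 - 1)) := by
      rw [e1]
      field_simp
      ring
    have : (2 * t ^ 2 - 1) / (t * (t ^ 2 - 1)) ≤ x := by
      rw [div_le_iff₀ (by positivity)]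
      refine le_of_mul_le_mul_left (a := x ^ 2) ?_ (by positivity)
      have e3 : x ^ 2 * (2 * t ^ 2 - 1) = 2 * (x * t) ^ 2 - x ^ 2 := by ring
      have e4 : x ^ 2 * (x * (t * (t ^ 2 - 1))) = (x * t) * ((x * t) ^ 2 - x ^ 2) := by ring
      rw [e3, e4, htx]
      nlinarith
    rw [e2]
    linarith
  have hup : t - 1 / (t - 1 / t) - 1 / t < 1 := by
    have e2 : t - 1 / (t - 1 / t) - 1 / t =
        (t ^ 4 - 3 * t ^ 2 + 1) / (t * (t ^ 2 - 1)) := by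
      rw [e1]
      field_simp
      ring
    rw [e2, div_lt_one (by positivity)]
    have : t ^ 4 - 3 * t ^ 2 + 1 - t * (t ^ 2 - 1) < 0 := by
      nlinarith [mul_nonneg (by linarith : 0 ≤ t - 2) (by linarith : 0 ≤ 104 / 50 - t),
        mul_nonneg (mul_nonneg (by linarith : 0 ≤ t - 2) (by linarith : 0 ≤ 104 / 50 - t)) ht0.le,
        mul_nonneg (mul_nonneg (by linarith : 0 ≤ t - 2) (by linarith : 0 ≤ 104 / 50 - t))
          (sq_nonneg t)]
    linarith
  have ht' : 0 < 1 / t := by positivity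
  have h2 := (h1.extend (by linarith) hr1 (by linarith)).pendant ht0 (by linarith)
  refine ⟨_, hlow, hup, h2.mono ?_⟩
  have : 0 ≤ (1 / (t - 1 / t)) ^ 2 * ((1 / t) ^ 2 * 1 + 1) := by positivity
  linarith

theorem exists_start_of_clique (hx : 1 < x) (ht : t = x + 1 / x) (k : ℕ)
    (hlow : (k + 1) / (t + k) + 1 / t ≤ x) (hup : t - (k + 1) / (t + k) - 1 / t < 1) :
    ∃ r, 1 / x ≤ r ∧ r < 1 ∧ HasRooted t r 1 := by
  have hx0 : 0 < x := by linarith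
  have hx0' : 0 < 1 / x := by positivity
  have htx : x * t = x ^ 2 + 1 := by rw [ht]; field_simp
  have ht2 : 2 < t := by nlinarith
  have ht0 : 0 < t := by linarith
  have ht1 : 0 < t - 1 := by linarith
  have ht' : 0 < 1 / t := by positivity
  have e : (t - 1) * ((t - 1) * (t + k) - (1 - t)) / ((t - 1) * (t + k)) =
      t - (k + 1) / (t + k) := by
    field_simp
    ring
  have h1 := (single ht0).clique k (D := (t - 1) * (t + k)) (by linarith) ht0 (by ring)
    (by positivity) (by rw [e]; linarith)
  rw [e] at h1
  refine ⟨_, ?_, hup, (h1.pendant ht0 (by linarith)).mono ?_⟩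
  · linarith
  · have : 0 ≤ ((t - 1) / ((t - 1) * (t + k))) ^ 2 * 1 := by positivity
    linarith

theorem exists_start (hx : 1 < x) (ht : t = x + 1 / x) (hx6 : x ^ 2 + 1 ≤ x ^ 6)
    (hx1 : x < 176 / 100) : ∃ r, 1 / x ≤ r ∧ r < 1 ∧ HasRooted t r 1 := by
  have hx0 : 0 < x := by linarith
  have htx : x * t = x ^ 2 + 1 := by rw [ht]; field_simp
  have ht2 : 2 < t := by nlinarith
  by_cases h1 : t ≤ 104 / 50
  · exact exists_start_of_le hx ht hx6 h1
  push Not at h1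
  by_cases h2 : t ≤ 109 / 50
  · refine exists_start_of_clique hx ht 3 ?_ ?_
    · have h3 : 13 / 10 ≤ x := by nlinarith
      have h4 : 1 / t ≤ 50 / 104 := by rw [div_le_div_iff₀ (by linarith) (by norm_num)]; linarith
      have h5 : ((3 : ℕ) + 1 : ℝ) / (t + (3 : ℕ)) ≤ 8 / 10 := by
        push_cast
        rw [div_le_div_iff₀ (by linarith) (by norm_num)]; linarith
      linarith
    · have h4 : 50 / 109 ≤ 1 / t := by rw [div_le_div_iff₀ (by norm_num) (by linarith)]; linarith
      have h5 : 77 / 100 ≤ ((3 : ℕ) + 1 : ℝ) / (t + (3 : ℕ)) := by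
        push_cast
        rw [div_le_div_iff₀ (by norm_num) (by linarith)]; linarith
      linarith
  push Not at h2
  have h6 : t ≤ 233 / 100 := by nlinarith
  refine exists_start_of_clique hx ht 19 ?_ ?_
  · have h3 : 148 / 100 ≤ x := by nlinarith
    have h4 : 1 / t ≤ 50 / 109 := by rw [div_le_div_iff₀ (by linarith) (by norm_num)]; linarith
    have h5 : ((19 : ℕ) + 1 : ℝ) / (t + (19 : ℕ)) ≤ 95 / 100 := by
      push_cast
      rw [div_le_div_iff₀ (by linarith) (by norm_num)]; linarith
    linarith
  · have h4 : 42 / 100 ≤ 1 / t := by rw [div_le_div_iff₀ (by norm_num) (by linarith)]; linarith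
    have h5 : 93 / 100 ≤ ((19 : ℕ) + 1 : ℝ) / (t + (19 : ℕ)) := by
      push_cast
      rw [div_le_div_iff₀ (by norm_num) (by linarith)]; linarith
    linarith

theorem exists_lt_one (hx : 1 < x) (ht : t = x + 1 / x) (hx6 : x ^ 2 + 1 ≤ x ^ 6) (n : ℕ) :
    ∃ r, 1 / x ≤ r ∧ r < 1 ∧ HasRooted t r (n + 1) := by
  have hx0 : 0 < x := by linarith
  have hx0' : 0 < 1 / x := by positivity
  have htx : x * t = x ^ 2 + 1 := by rw [ht]; field_simp
  have ht2 : 2 < t := by nlinarith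
  rcases lt_or_ge x (176 / 100) with h1 | h1
  · induction n with
    | zero => simpa using exists_start hx ht hx6 h1
    | succ n ih =>
      obtain ⟨r, h2, h3, h4⟩ := ih
      push_cast
      refine h4.exists_lt_one_of_clique hx ht ?_ (by positivity) h2 h3
      nlinarith [mul_nonneg (by linarith : 0 ≤ x - 1) (by linarith : 0 ≤ 176 / 100 - x)]
  · have htx' : 1 / t ≤ 1 - 1 / x := by
      have e : (1 : ℝ) - 1 / x = (x - 1) / x := by field_simp
      rw [e, div_le_div_iff₀ (by linarith) hx0]
      refine le_of_mul_le_mul_left (a := x) ?_ hx0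
      have e' : x * ((x - 1) * t) = (x - 1) * (x ^ 2 + 1) := by rw [← htx]; ring
      rw [e']
      nlinarith [mul_nonneg (by linarith : 0 ≤ x - 176 / 100) (sq_nonneg x),
        mul_nonneg (by linarith : 0 ≤ x - 176 / 100) hx0.le]
    have hxt : 1 / x ≤ t := by linarith
    induction n with
    | zero =>
      simpa using exists_lt_one_of_pendant hx (by linarith) htx' (single (by linarith)) hxt
    | succ n ih =>
      obtain ⟨r, h2, h3, h4⟩ := ih
      have hr : 0 < r := by linarith
      have h5 : 1 / r ≤ x := by
        rw [div_le_iff₀ hr]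
        rwa [div_le_iff₀' hx0] at h2
      push_cast
      refine exists_lt_one_of_pendant hx (by linarith) htx'
        ((h4.extend (by linarith) hr (by linarith)).mono ?_) (by linarith)
      have h6 : 1 ≤ 1 / r := by rw [one_le_div₀ hr]; exact h3.le
      have h7 : (1 : ℝ) ≤ (1 / r) ^ 2 := by nlinarith
      nlinarith [mul_le_mul_of_nonneg_right h7 (by positivity : (0 : ℝ) ≤ n + 1)]

theorem exists_minEig (h : HasRooted t r n) (hr : 0 ≤ r) (hn : 0 < n) :
    ∃ (m : ℕ) (G : SimpleGraph (Fin m)), 0 < m ∧ -t < minEig (adjMat G) ∧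
      minEig (adjMat G) + t ≤ r / n := by
  obtain ⟨V, _, G, o, h1, h2, y, h3, h4, h5⟩ := h
  have : Nonempty V := ⟨o⟩
  have hpos : 0 < Fintype.card V := Fintype.card_pos
  have : Nonempty (Fin (Fintype.card V)) := ⟨⟨0, hpos⟩⟩
  refine ⟨Fintype.card V, G.comap (Fintype.equivFin V).symm, hpos, ?_⟩
  rw [minEig_comap_equiv]
  constructor
  · obtain ⟨f, hf, hf'⟩ := isEigenvalue_minEig G
    have e := qform_of_eigenvector hf' t
    have hs := sum_sq_pos hf
    have h6 : 0 ≤ qform G t f := (mul_nonneg hr (sq_nonneg _)).trans (h2 f)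
    have h7 : qform G t f ≠ 0 := fun h => hf (h1 f h)
    have h8 : 0 < (minEig (adjMat G) + t) * ∑ u, f u ^ 2 := by
      rw [← e]
      exact lt_of_le_of_ne h6 h7.symm
    have := (mul_pos_iff_of_pos_right hs).1 h8
    linarith
  · have h6 := (le_minEig_iff G (minEig (adjMat G))).1 le_rfl y
    rw [qform_eq_add G t] at h6
    rw [le_div_iff₀ hn]
    rw [h4] at h6
    by_cases hc : minEig (adjMat G) + t ≤ 0
    · exact (mul_nonpos_of_nonpos_of_nonneg hc hn.le).trans hr
    · push Not at hc
      nlinarith [mul_le_mul_of_nonneg_left h5 hc.le]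

end HasRooted

/-- Every real number greater than two is `x + 1 / x` for some `x > 1`. -/
theorem exists_eq_add_one_div {t : ℝ} (ht : 2 < t) : ∃ x : ℝ, 1 < x ∧ t = x + 1 / x := by
  have h0 : 0 < t ^ 2 - 4 := by nlinarith
  have h1 := Real.sq_sqrt h0.le
  have h2 := Real.sqrt_nonneg (t ^ 2 - 4)
  set s := Real.sqrt (t ^ 2 - 4)
  have hx : 0 < (t + s) / 2 := by linarith
  refine ⟨(t + s) / 2, by linarith, ?_⟩
  rw [← sub_eq_iff_eq_add', eq_div_iff hx.ne']
  linarith [show (t - (t + s) / 2) * ((t + s) / 2) = (t ^ 2 - s ^ 2) / 4 by ring]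

theorem add_one_div_lt {x y : ℝ} (hx : 1 ≤ x) (hxy : x < y) : x + 1 / x < y + 1 / y := by
  have hx0 : 0 < x := by linarith
  have hy0 : 0 < y := by linarith
  have h : y + 1 / y - (x + 1 / x) = (y - x) * (x * y - 1) / (x * y) := by
    field_simp
    ring
  have h1 : 0 < x * y - 1 := by nlinarith
  have : 0 < y + 1 / y - (x + 1 / x) := by
    rw [h]
    have := sub_pos.2 hxy
    positivity
  linarith

/-- For `λ > 2`, `-λ` is a limit point of the set of smallest eigenvalues of graphs
if and only if `λ ≥ λ*`. -/
theorem neg_lam_limit_point_iff (βs lamStar : ℝ) (hβs : βs ^ 3 = βs + 1)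
    (hstar : lamStar = Real.sqrt βs + (Real.sqrt βs)⁻¹) (lam : ℝ) (hlam : 2 < lam) :
    (∀ ε : ℝ, 0 < ε → ∃ (n : ℕ) (G : SimpleGraph (Fin n)), 0 < n ∧
        minEig (adjMat G) ≠ -lam ∧ |minEig (adjMat G) - (-lam)| < ε) ↔ lamStar ≤ lam := by
  have hβ1 : 1 < βs := by
    by_contra hc
    nlinarith [sq_nonneg βs, sq_nonneg (βs + 1), sq_nonneg (βs - 1)]
  have hb2 : Real.sqrt βs ^ 2 = βs := Real.sq_sqrt (by linarith)
  have hb1 : 1 < Real.sqrt βs := by rwa [Real.lt_sqrt zero_le_one, one_pow]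
  set b := Real.sqrt βs
  have hpoly : ∀ y : ℝ, y ^ 6 - (y ^ 2 + 1) =
      (y ^ 2 - b ^ 2) * (y ^ 4 + y ^ 2 * b ^ 2 + b ^ 4 - 1) := fun y => by
    rw [← hb2] at hβs
    linear_combination hβs
  have hfac : ∀ y : ℝ, 0 < y ^ 4 + y ^ 2 * b ^ 2 + b ^ 4 - 1 := fun y => by
    have : 1 < b ^ 4 := one_lt_pow₀ hb1 (by norm_num)
    have : 0 ≤ y ^ 4 + y ^ 2 * b ^ 2 := by positivity
    linarith
  rw [← one_div] at hstar
  obtain ⟨x, hx, hlx⟩ := exists_eq_add_one_div hlam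
  constructor
  · intro h
    by_contra! hc
    have hxb : x < b := by
      by_contra! hbx
      rcases hbx.eq_or_lt with rfl | hbx
      · linarith
      · linarith [add_one_div_lt hb1.le hbx]
    have hxy : x < (x + b) / 2 := by linarith
    have hy6 : ((x + b) / 2) ^ 6 < ((x + b) / 2) ^ 2 + 1 := by
      have := mul_neg_of_neg_of_pos (sub_neg.2 (pow_lt_pow_left₀ (by linarith : (x + b) / 2 < b)
        (by linarith) two_ne_zero)) (hfac ((x + b) / 2))
      rw [← hpoly] at this
      linarith
    obtain ⟨δ, hδ, hδ'⟩ := exists_le_abs_minEig_add (hx.trans hxy) hy6 hlam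
      (hlx ▸ add_one_div_lt hx.le hxy)
    obtain ⟨n, G, hn, hne, hlt⟩ := h δ hδ
    exact absurd hlt (not_lt.2 (hδ' n G hn hne))
  · intro h ε hε
    have hbx : b ≤ x := by
      by_contra! hxb
      linarith [add_one_div_lt hx.le hxb]
    have hx6 : x ^ 2 + 1 ≤ x ^ 6 := by
      have := mul_nonneg (sub_nonneg.2 (pow_le_pow_left₀ (by linarith : 0 ≤ b) hbx 2)) (hfac x).le
      rw [← hpoly] at this
      linarith
    obtain ⟨m, hm⟩ := exists_nat_one_div_lt hε
    obtain ⟨r, hr, hr1, hr2⟩ := HasRooted.exists_lt_one hx hlx hx6 m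
    have hr0 : 0 ≤ r := le_trans (by positivity) hr
    obtain ⟨n, G, hn, h1, h2⟩ := hr2.exists_minEig hr0 (by positivity)
    have h3 : r / (m + 1) ≤ 1 / (m + 1) := by gcongr
    refine ⟨n, G, hn, h1.ne', ?_⟩
    rw [sub_neg_eq_add, abs_of_pos (by linarith)]
    linarith
end

section
/- For every real λ < 2 there exist ℓ, m ∈ ℕ⁺ such that every graph in the extension family X(C, ℓ, m) of the claw C and every graph in the extension family X(D, ℓ, m) of the diamond D has smallest eigenvalue strictly less than −λ. -/
open Classical

/-- The path extension `(F, A, ℓ)`: add a new path `v₀ v₁ ⋯ v_ℓ` and join `v₀` to every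
vertex of `A`. -/
def pathExt {V : Type*} (F : SimpleGraph V) (A : Set V) (ℓ : ℕ) :
    SimpleGraph (V ⊕ Fin (ℓ + 1)) :=
  SimpleGraph.fromRel fun x y =>
    match x, y with
    | Sum.inl u, Sum.inl v => F.Adj u v
    | Sum.inl u, Sum.inr i => u ∈ A ∧ i = 0
    | Sum.inr i, Sum.inr j => (j : ℕ) = (i : ℕ) + 1
    | _, _ => False

/-- The path-clique extension `(F, A, ℓ, K_m)`: the path extension `(F, A, ℓ)` together with
a clique on `m` new vertices, each joined to `v_ℓ`. -/
def pathCliqueExt {V : Type*} (F : SimpleGraph V) (A : Set V) (ℓ m : ℕ) :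
    SimpleGraph ((V ⊕ Fin (ℓ + 1)) ⊕ Fin m) :=
  SimpleGraph.fromRel fun x y =>
    match x, y with
    | Sum.inl a, Sum.inl b => (pathExt F A ℓ).Adj a b
    | Sum.inl (Sum.inr i), Sum.inr _ => (i : ℕ) = ℓ
    | Sum.inr a, Sum.inr b => a ≠ b
    | _, _ => False

/-- The clique extension `(F, A, K_m)`: add a clique on `m` new vertices, each joined to
every vertex of `A`. -/
def cliqueExt {V : Type*} (F : SimpleGraph V) (A : Set V) (m : ℕ) :
    SimpleGraph (V ⊕ Fin m) :=
  SimpleGraph.fromRel fun x y =>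
    match x, y with
    | Sum.inl u, Sum.inl v => F.Adj u v
    | Sum.inl u, Sum.inr _ => u ∈ A
    | Sum.inr a, Sum.inr b => a ≠ b
    | _, _ => False

/-- The claw `K_{1,3}` (center `0`). -/
def claw : SimpleGraph (Fin 4) := SimpleGraph.fromRel fun x _ => x = 0

/-- The diamond `K₄` minus the edge `{2,3}`. -/
def diamond : SimpleGraph (Fin 4) :=
  SimpleGraph.fromRel fun x y => ¬(x = 2 ∧ y = 3) ∧ ¬(x = 3 ∧ y = 2)

open Matrix in
/-- A test vector with Rayleigh quotient below `c` forces the smallest eigenvalue below `c`. -/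
theorem minEig_lt_of_dotProduct_lt {V : Type*} [Fintype V] {A : Matrix V V ℝ}
    (hA : A.IsSymm) {c : ℝ} {x : V → ℝ} (hx : x ⬝ᵥ A *ᵥ x < c * (x ⬝ᵥ x)) :
    minEig A < c := by
  have hH : (A - c • (1 : Matrix V V ℝ)).IsHermitian := by
    rw [Matrix.IsHermitian, Matrix.conjTranspose_eq_transpose_of_trivial, Matrix.transpose_sub,
      hA.eq, Matrix.transpose_smul, Matrix.transpose_one]
  have hnot : ¬ (A - c • (1 : Matrix V V ℝ)).PosSemidef := by
    intro h
    have h0 := h.dotProduct_mulVec_nonneg x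
    rw [star_trivial, Matrix.sub_mulVec, Matrix.smul_mulVec, Matrix.one_mulVec,
      dotProduct_sub, dotProduct_smul, smul_eq_mul] at h0
    linarith
  rw [hH.posSemidef_iff_eigenvalues_nonneg, Pi.le_def] at hnot
  push Not at hnot
  obtain ⟨i, hi⟩ := hnot
  have hfin : {μ : ℝ | IsEigenvalue A μ}.Finite := by
    refine (Module.End.finite_hasEigenvalue (Matrix.toLin' A)).subset ?_
    rintro μ ⟨v, hv, hAv⟩
    exact Module.End.hasEigenvalue_of_hasEigenvector
      ⟨Module.End.mem_eigenspace_iff.2 (by simpa using hAv), hv⟩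
  have hmem : IsEigenvalue A (hH.eigenvalues i + c) := by
    refine ⟨(hH.eigenvectorBasis i).ofLp, ?_, ?_⟩
    · intro h
      exact hH.eigenvectorBasis.orthonormal.ne_zero i (by ext j; simpa using congrFun h j)
    · have h := hH.mulVec_eigenvectorBasis i
      rw [Matrix.sub_mulVec, Matrix.smul_mulVec, Matrix.one_mulVec, sub_eq_iff_eq_add] at h
      rw [h, add_smul]
  have hi' : hH.eigenvalues i < 0 := by simpa using hi
  exact (csInf_le hfin.bddBelow hmem).trans_lt (by linarith)

theorem adjMat_isSymm {V : Type*} [Fintype V] (G : SimpleGraph V) : (adjMat G).IsSymm := by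
  ext i j
  simp [adjMat, G.adj_comm]

/-- The quadratic form of the adjacency matrix of a graph. -/
noncomputable def adjForm {V : Type*} [Fintype V] (G : SimpleGraph V) (x : V → ℝ) : ℝ :=
  ∑ i, ∑ j, if G.Adj i j then x i * x j else 0

theorem minEig_adjMat_lt {V : Type*} [Fintype V] {G : SimpleGraph V} {c : ℝ} {x : V → ℝ}
    (hx : adjForm G x < c * ∑ i, x i ^ 2) : minEig (adjMat G) < c := by
  apply minEig_lt_of_dotProduct_lt (adjMat_isSymm G) (x := x)
  convert hx using 1
  · simp [adjForm, dotProduct, Matrix.mulVec, adjMat, Finset.mul_sum]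
  · simp [dotProduct, sq]

/-- The sum of the entries of `x` over `A`. -/
noncomputable def sumOn {V : Type*} [Fintype V] (A : Set V) (x : V → ℝ) : ℝ :=
  ∑ i, if i ∈ A then x i else 0

theorem adjForm_cliqueExt {V : Type*} [Fintype V] (G : SimpleGraph V) (B : Set V) (m : ℕ)
    (y : V → ℝ) (t : ℝ) :
    adjForm (cliqueExt G B m) (Sum.elim y fun _ => t) =
      adjForm G y + 2 * (m * t) * sumOn B y + (m * t) ^ 2 - m * t ^ 2 := by
  have hVV (u v : V) : (cliqueExt G B m).Adj (.inl u) (.inl v) ↔ G.Adj u v := by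
    simp only [cliqueExt, SimpleGraph.fromRel_adj, ne_eq, Sum.inl.injEq, G.adj_comm v u, or_self,
      and_iff_right_iff_imp]
    exact fun h => h.ne
  have hVm (u : V) (a : Fin m) : (cliqueExt G B m).Adj (.inl u) (.inr a) ↔ u ∈ B := by
    simp [cliqueExt]
  have hmV (u : V) (a : Fin m) : (cliqueExt G B m).Adj (.inr a) (.inl u) ↔ u ∈ B := by
    simp [cliqueExt]
  have hmm (a b : Fin m) : (cliqueExt G B m).Adj (.inr a) (.inr b) ↔ a ≠ b := by
    simp +contextual [cliqueExt]
  have hclique : (∑ a : Fin m, ∑ b : Fin m, if a ≠ b then t * t else 0) =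
      (m * t) ^ 2 - m * t ^ 2 := by
    have h (a b : Fin m) : (if a ≠ b then t * t else 0) = t * t - if a = b then t * t else 0 := by
      split_ifs <;> simp_all
    simp only [h, Finset.sum_sub_distrib, Finset.sum_ite_eq, Finset.sum_const]
    simp
    ring
  have hcross (f : ℝ → ℝ) (hf : ∀ r, f r = r * t) :
      (∑ u, if u ∈ B then f (y u) else 0) = t * sumOn B y := by
    simp only [sumOn, Finset.mul_sum, hf]
    exact Finset.sum_congr rfl fun u _ => by split_ifs <;> ring
  simp only [adjForm, Fintype.sum_sum_type, Sum.elim_inl, Sum.elim_inr, hVV, hVm, hmV, hmm,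
    Finset.sum_add_distrib, hclique, Finset.sum_const, Finset.card_univ, Fintype.card_fin,
    nsmul_eq_mul, hcross (fun r => t * r) fun r => mul_comm t r]
  have h : (∑ u, (m : ℝ) * if u ∈ B then y u * t else 0) = m * (t * sumOn B y) := by
    rw [← Finset.mul_sum, hcross (fun r => r * t) fun _ => rfl]
  rw [h]
  ring

theorem minEig_cliqueExt_lt {V : Type*} [Fintype V] {G : SimpleGraph V} {B : Set V} {m : ℕ}
    (hm : 0 < m) {y : V → ℝ} {k lam : ℝ} (hpos : 0 < ∑ i, y i ^ 2)
    (hform : adjForm G y + 2 * ∑ i, y i ^ 2 ≤ sumOn B y ^ 2)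
    (hsum : sumOn B y ^ 2 ≤ k * ∑ i, y i ^ 2) (hlam : lam ≤ 2) (hk : k < (2 - lam) * m) :
    minEig (adjMat (cliqueExt G B m)) < -lam := by
  have hm' : (0 : ℝ) < m := by exact_mod_cast hm
  apply minEig_adjMat_lt (x := Sum.elim y fun _ => -sumOn B y / m)
  rw [adjForm_cliqueExt]
  simp only [Fintype.sum_sum_type, Sum.elim_inl, Sum.elim_inr, Finset.sum_const,
    Finset.card_univ, Fintype.card_fin, nsmul_eq_mul]
  set S := sumOn B y
  set n := ∑ i, y i ^ 2
  have h1 : (m : ℝ) * (-S / m) = -S := by field_simp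
  have h2 : (m : ℝ) * (-S / m) ^ 2 = S ^ 2 / m := by field_simp
  rw [h1, h2]
  have h3 : S ^ 2 / m < (2 - lam) * n := by
    rw [div_lt_iff₀ hm']
    nlinarith
  have h4 : 0 ≤ (2 - lam) * (S ^ 2 / m) := mul_nonneg (by linarith) (by positivity)
  linarith

theorem pathCliqueExt_eq_cliqueExt {V : Type*} (F : SimpleGraph V) (A : Set V) (ℓ m : ℕ) :
    pathCliqueExt F A ℓ m = cliqueExt (pathExt F A ℓ) {Sum.inr (Fin.last ℓ)} m := by
  ext x y
  rcases x with (u | i) | a <;> rcases y with (v | j) | b <;>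
    simp [pathCliqueExt, cliqueExt, Fin.ext_iff]

theorem sum_path (ℓ : ℕ) (c : ℝ) :
    (∑ i : Fin (ℓ + 1), ∑ j : Fin (ℓ + 1), if (j : ℕ) = i + 1 then c else 0) = ℓ * c := by
  have hlast (j : Fin (ℓ + 1)) : ((j : ℕ) = ℓ + 1) ↔ False := by
    simpa using j.isLt.ne
  rw [Fin.sum_univ_castSucc]
  simp only [Fin.val_last, hlast, Fin.val_castSucc, if_false, Finset.sum_const_zero, add_zero]
  have h (i : Fin ℓ) (j : Fin (ℓ + 1)) : ((j : ℕ) = i + 1) ↔ j = i.succ := by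
    simp [Fin.ext_iff]
  simp [h]

/-- The vector equal to `y` on the base and to `c, -c, c, …` along the path. -/
def pathVector {V : Type*} (ℓ : ℕ) (y : V → ℝ) (c : ℝ) : V ⊕ Fin (ℓ + 1) → ℝ :=
  Sum.elim y fun i => (-1) ^ (i : ℕ) * c

theorem sum_sq_pathVector {V : Type*} [Fintype V] (ℓ : ℕ) (y : V → ℝ) (c : ℝ) :
    ∑ i, pathVector ℓ y c i ^ 2 = ∑ i, y i ^ 2 + (ℓ + 1) * c ^ 2 := by
  simp [pathVector, mul_pow, ← pow_mul, mul_comm _ 2]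

theorem adjForm_pathExt {V : Type*} [Fintype V] (F : SimpleGraph V) (A : Set V) (ℓ : ℕ)
    (y : V → ℝ) (c : ℝ) :
    adjForm (pathExt F A ℓ) (pathVector ℓ y c) =
      adjForm F y + 2 * c * sumOn A y - 2 * ℓ * c ^ 2 := by
  have hVV (u v : V) : (pathExt F A ℓ).Adj (.inl u) (.inl v) ↔ F.Adj u v := by
    simp only [pathExt, SimpleGraph.fromRel_adj, ne_eq, Sum.inl.injEq, F.adj_comm v u, or_self,
      and_iff_right_iff_imp]
    exact fun h => h.ne
  have hVp (u : V) (i : Fin (ℓ + 1)) :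
      (pathExt F A ℓ).Adj (.inl u) (.inr i) ↔ i = 0 ∧ u ∈ A := by
    simp [pathExt, and_comm]
  have hpV (u : V) (i : Fin (ℓ + 1)) :
      (pathExt F A ℓ).Adj (.inr i) (.inl u) ↔ i = 0 ∧ u ∈ A := by
    simp [pathExt, and_comm]
  have hpp (i j : Fin (ℓ + 1)) :
      (if (pathExt F A ℓ).Adj (.inr i) (.inr j) then
        ((-1) ^ (i : ℕ) * c) * ((-1) ^ (j : ℕ) * c) else 0) =
      (if (j : ℕ) = i + 1 then -c ^ 2 else 0) + if (i : ℕ) = j + 1 then -c ^ 2 else 0 := by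
    have hadj : (pathExt F A ℓ).Adj (.inr i) (.inr j) ↔
        (j : ℕ) = i + 1 ∨ (i : ℕ) = j + 1 := by
      simp only [pathExt, SimpleGraph.fromRel_adj, ne_eq, Sum.inr.injEq, Fin.ext_iff]
      omega
    have hsq (k : ℕ) : ((-1 : ℝ) ^ k) ^ 2 = 1 := by simp [← pow_mul, mul_comm k 2]
    simp only [hadj]
    by_cases h1 : (j : ℕ) = i + 1
    · have h2 : ¬ (i : ℕ) = j + 1 := by omega
      simp only [h1, true_or, if_true, if_neg (show ¬ (i : ℕ) = i + 1 + 1 by omega)]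
      linear_combination -c ^ 2 * hsq i
    · by_cases h2 : (i : ℕ) = j + 1
      · simp only [h2, or_true, if_true, if_neg (show ¬ (j : ℕ) = j + 1 + 1 by omega)]
        linear_combination -c ^ 2 * hsq j
      · simp [h1, h2]
  have hcross (f : ℝ → ℝ) (hf : ∀ r, f r = r * c) :
      (∑ u, if u ∈ A then f (y u) else 0) = c * sumOn A y := by
    simp only [sumOn, Finset.mul_sum, hf]
    exact Finset.sum_congr rfl fun u _ => by split_ifs <;> ring
  have hpath : (∑ i : Fin (ℓ + 1), ∑ j : Fin (ℓ + 1),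
      if (i : ℕ) = j + 1 then -c ^ 2 else 0) = ℓ * -c ^ 2 := by
    rw [Finset.sum_comm, sum_path]
  have hVpSum : (∑ u : V, ∑ i : Fin (ℓ + 1),
      if i = 0 ∧ u ∈ A then y u * ((-1) ^ (i : ℕ) * c) else 0) = c * sumOn A y := by
    simp only [ite_and, Finset.sum_ite_eq', Finset.mem_univ, if_true]
    simpa using hcross (fun r => r * c) fun _ => rfl
  have hpVSum : (∑ i : Fin (ℓ + 1), ∑ u : V,
      if i = 0 ∧ u ∈ A then (-1) ^ (i : ℕ) * c * y u else 0) = c * sumOn A y := by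
    rw [Finset.sum_comm, ← hVpSum]
    simp only [mul_comm]
  simp only [adjForm, pathVector, Fintype.sum_sum_type, Sum.elim_inl, Sum.elim_inr, hVV, hVp, hpV,
    hpp, Finset.sum_add_distrib, hVpSum, hpVSum, sum_path, hpath]
  ring

theorem sumOn_last_pathVector_sq {V : Type*} [Fintype V] (ℓ : ℕ) (y : V → ℝ) (c : ℝ) :
    sumOn {Sum.inr (Fin.last ℓ)} (pathVector ℓ y c) ^ 2 = c ^ 2 := by
  simp [sumOn, pathVector, mul_pow, ← pow_mul, mul_comm _ 2]

theorem minEig_pathExt_lt {V : Type*} [Fintype V] (F : SimpleGraph V) (A : Set V) {ℓ : ℕ}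
    {lam : ℝ} (h : 2 < (2 - lam) * (ℓ + 1)) : minEig (adjMat (pathExt F A ℓ)) < -lam := by
  apply minEig_adjMat_lt (x := pathVector ℓ 0 1)
  rw [adjForm_pathExt, sum_sq_pathVector]
  simp only [adjForm, sumOn, Pi.zero_apply, mul_zero, ite_self, Finset.sum_const_zero, ne_eq,
    OfNat.ofNat_ne_zero, not_false_eq_true, zero_pow]
  linarith

theorem minEig_pathCliqueExt_lt {V : Type*} [Fintype V] {F : SimpleGraph V} {A : Set V}
    {ℓ m : ℕ} (hm : 0 < m) {y : V → ℝ} {lam : ℝ} (hpos : 0 < ∑ i, y i ^ 2)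
    (hform : adjForm F y + 2 * ∑ i, y i ^ 2 ≤ sumOn A y ^ 2) (hlam : lam ≤ 2)
    (hm1 : 1 < (2 - lam) * m) : minEig (adjMat (pathCliqueExt F A ℓ m)) < -lam := by
  rw [pathCliqueExt_eq_cliqueExt]
  apply minEig_cliqueExt_lt hm (y := pathVector ℓ y (-sumOn A y)) (k := 1) ?_ ?_ ?_ hlam hm1
  · rw [sum_sq_pathVector]
    positivity
  · rw [sumOn_last_pathVector_sq, adjForm_pathExt, sum_sq_pathVector]
    linarith
  · rw [sumOn_last_pathVector_sq, sum_sq_pathVector]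
    nlinarith [mul_nonneg (Nat.cast_nonneg (α := ℝ) ℓ) (sq_nonneg (-sumOn A y))]

theorem sumOn_sq_le {V : Type*} [Fintype V] (A : Set V) (y : V → ℝ) :
    sumOn A y ^ 2 ≤ Fintype.card V * ∑ i, y i ^ 2 := by
  refine sq_sum_le_card_mul_sum_sq.trans ?_
  rw [Finset.card_univ]
  refine mul_le_mul_of_nonneg_left (Finset.sum_le_sum fun i _ => ?_) (Nat.cast_nonneg _)
  split_ifs
  · exact le_rfl
  · simp [sq_nonneg]

theorem adjForm_claw (y : Fin 4 → ℝ) : adjForm claw y = 2 * y 0 * (y 1 + y 2 + y 3) := by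
  simp [adjForm, claw, Fin.sum_univ_four]
  ring

theorem adjForm_diamond (y : Fin 4 → ℝ) :
    adjForm diamond y = 2 * (y 0 * y 1 + (y 0 + y 1) * (y 2 + y 3)) := by
  simp [adjForm, diamond, Fin.sum_univ_four]
  ring

theorem exists_claw_vector {A : Set (Fin 4)} (hA : A.Nonempty) :
    ∃ y : Fin 4 → ℝ, 0 < ∑ i, y i ^ 2 ∧
      adjForm claw y + 2 * ∑ i, y i ^ 2 ≤ sumOn A y ^ 2 := by
  let u : Fin 4 → ℝ := fun i => if i ∈ A then 1 else 0
  let a := 2 * u 0 - (u 1 + u 2 + u 3)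
  refine ⟨![2 * a, u 1 - a, u 2 - a, u 3 - a], ?_⟩
  rw [adjForm_claw]
  have hex : 0 ∈ A ∨ 1 ∈ A ∨ 2 ∈ A ∨ 3 ∈ A := by
    obtain ⟨i, hi⟩ := hA
    fin_cases i <;> simp_all
  by_cases h0 : 0 ∈ A <;> by_cases h1 : 1 ∈ A <;> by_cases h2 : 2 ∈ A <;> by_cases h3 : 3 ∈ A <;>
    simp [sumOn, Fin.sum_univ_four, a, u, h0, h1, h2, h3] at hex ⊢ <;> norm_num

theorem exists_diamond_vector {A : Set (Fin 4)} (hA : A.Nonempty) :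
    ∃ y : Fin 4 → ℝ, 0 < ∑ i, y i ^ 2 ∧
      adjForm diamond y + 2 * ∑ i, y i ^ 2 ≤ sumOn A y ^ 2 := by
  let u : Fin 4 → ℝ := fun i => if i ∈ A then 1 else 0
  let a := u 0 + u 1 - (u 2 + u 3)
  refine ⟨![a + u 0 - u 1, a + u 1 - u 0, u 2 - a, u 3 - a], ?_⟩
  rw [adjForm_diamond]
  have hex : 0 ∈ A ∨ 1 ∈ A ∨ 2 ∈ A ∨ 3 ∈ A := by
    obtain ⟨i, hi⟩ := hA
    fin_cases i <;> simp_all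
  by_cases h0 : 0 ∈ A <;> by_cases h1 : 1 ∈ A <;> by_cases h2 : 2 ∈ A <;> by_cases h3 : 3 ∈ A <;>
    simp [sumOn, Fin.sum_univ_four, a, u, h0, h1, h2, h3] at hex ⊢ <;> norm_num

/-- For every `λ < 2` there are `ℓ, m ≥ 1` such that every member of the extension families
`X(C, ℓ, m)` and `X(D, ℓ, m)` of the claw `C` and the diamond `D` has smallest eigenvalue
less than `-λ`. -/
theorem extension_families_of_claw_and_diamond (lam : ℝ) (hlam : lam < 2) :
    ∃ ℓ m : ℕ, 0 < ℓ ∧ 0 < m ∧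
      ∀ F : SimpleGraph (Fin 4), (F = claw ∨ F = diamond) →
        ∀ A : Set (Fin 4), A.Nonempty →
          minEig (adjMat (pathExt F A ℓ)) < -lam ∧
          (∀ ℓ₀ < ℓ, minEig (adjMat (pathCliqueExt F A ℓ₀ m)) < -lam) ∧
          minEig (adjMat (cliqueExt F A m)) < -lam := by
  obtain ⟨N, hN⟩ := exists_nat_gt (4 / (2 - lam))
  have hε : 0 < 2 - lam := by linarith
  have hN0 : 0 < N := by
    have : (0 : ℝ) < N := lt_trans (by positivity) hN
    exact_mod_cast this
  rw [div_lt_iff₀ hε, mul_comm] at hN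
  refine ⟨N, N, hN0, hN0, fun F hF A hA => ?_⟩
  obtain ⟨y, hpos, hform⟩ : ∃ y : Fin 4 → ℝ, 0 < ∑ i, y i ^ 2 ∧
      adjForm F y + 2 * ∑ i, y i ^ 2 ≤ sumOn A y ^ 2 := by
    rcases hF with rfl | rfl
    exacts [exists_claw_vector hA, exists_diamond_vector hA]
  refine ⟨minEig_pathExt_lt F A (by linarith),
    fun _ _ => minEig_pathCliqueExt_lt hN0 hpos hform hlam.le (by linarith),
    minEig_cliqueExt_lt hN0 hpos hform (by simpa using sumOn_sq_le A y) hlam.le hN⟩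
end
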